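/- There is an absolute constant c > 0 such that the following holds. For p, q ∈ ℍ², let d_X(p,q) := inf_{γ ∈ SL(2,ℤ)} d(p, γ·q) denote the distance on the modular surface X = PSL(2,ℤ)\ℍ². If P ⊆ ℍ² is a finite set of N ≥ 2 points such that d_X(p,q) ≠ 0 for all distinct p, q ∈ P (i.e. the points project to N distinct points of X), then |{d_X(p,q) : p,q ∈ P, p ≠ q}| ≥ c · N / log N. -/

import Mathlib

open scoped UpperHalfPlane MatrixGroups

noncomputable section

/-- The distance on the modular surface `X = PSL(2,ℤ)\ℍ²`, computed on representatives:
`d_X(p,q) = inf_{γ ∈ SL(2,ℤ)} d(p, γ·q)`. -/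
def modularDist (p q : ℍ) : ℝ :=
  ⨅ γ : SL(2, ℤ), dist p (γ • q)

set_option linter.all false


namespace GK

/-! ## Borsuk–Ulam via mod 2 chains -/
section BU

variable {E : Type*} [NormedAddCommGroup E] [NormedSpace ℝ E]

abbrev Ch (E : Type*) := List E →₀ ZMod 2

noncomputable def cone (b : E) : Ch E →ₗ[ZMod 2] Ch E := Finsupp.lmapDomain _ _ (List.cons b)

noncomputable def bdl : List E → Ch E
  | [] => 0
  | (x :: l) => Finsupp.single l 1 + cone x (bdl l)

noncomputable def bd : Ch E →ₗ[ZMod 2] Ch E := Finsupp.linearCombination _ bdl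

noncomputable def nu : Ch E →ₗ[ZMod 2] Ch E := Finsupp.lmapDomain _ _ (List.map (fun x => -x))

noncomputable def bary (l : List E) : E := (l.length : ℝ)⁻¹ • l.sum

noncomputable def sd : ℕ → Ch E →ₗ[ZMod 2] Ch E
  | 0 => LinearMap.id
  | (n+1) => Finsupp.linearCombination _ (fun l => cone (bary l) (sd n (bdl l)))

lemma add_self_Ch (c : Ch E) : c + c = 0 := by
  ext l; simp [CharTwo.add_self_eq_zero]

@[simp] lemma cone_single (b : E) (l : List E) (r : ZMod 2) :
    cone b (Finsupp.single l r) = Finsupp.single (b :: l) r := by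
  simp [cone]

@[simp] lemma bd_single (l : List E) : bd (Finsupp.single l 1) = bdl l := by
  simp [bd]

@[simp] lemma nu_single (l : List E) (r : ZMod 2) :
    nu (Finsupp.single l r) = Finsupp.single (l.map (fun x => -x)) r := by
  simp [nu]

@[simp] lemma sd_single (n : ℕ) (l : List E) :
    sd (n+1) (Finsupp.single l 1) = cone (bary l) (sd n (bdl l)) := by
  simp [sd]

lemma Ch_ext {M : Type*} [AddCommMonoid M] [Module (ZMod 2) M] {f g : Ch E →ₗ[ZMod 2] M}
    (h : ∀ l, f (Finsupp.single l 1) = g (Finsupp.single l 1)) : f = g := by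
  apply Finsupp.lhom_ext'
  intro l
  ext
  simpa using h l

lemma bd_cone (b : E) (c : Ch E) : bd (cone b c) = c + cone b (bd c) := by
  have : bd ∘ₗ cone b = LinearMap.id + cone b ∘ₗ bd := by
    apply Ch_ext
    intro l
    simp [bdl]
  exact LinearMap.congr_fun this c

lemma bd_bdl (l : List E) : bd (bdl l) = 0 := by
  induction l with
  | nil => simp [bdl]
  | cons x l ih =>
    simp only [bdl, map_add, bd_single, bd_cone, ih, map_zero, add_zero]
    exact add_self_Ch _

lemma nu_cone (b : E) (c : Ch E) : nu (cone b c) = cone (-b) (nu c) := by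
  have : nu ∘ₗ cone b = cone (-b) ∘ₗ nu := by
    apply Ch_ext
    intro l
    simp
  exact LinearMap.congr_fun this c

lemma nu_bdl (l : List E) : nu (bdl l) = bdl (l.map (fun x => -x)) := by
  induction l with
  | nil => simp [bdl]
  | cons x l ih => simp [bdl, nu_cone, ih]

lemma nu_bd (c : Ch E) : nu (bd c) = bd (nu c) := by
  have : nu ∘ₗ bd = bd ∘ₗ (nu : Ch E →ₗ[ZMod 2] Ch E) := by
    apply Ch_ext
    intro l
    simp [nu_bdl]
  exact LinearMap.congr_fun this c

lemma nu_nu (c : Ch E) : nu (nu c) = c := by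
  have : nu ∘ₗ nu = (LinearMap.id : Ch E →ₗ[ZMod 2] Ch E) := by
    apply Ch_ext
    intro l
    simp
  exact LinearMap.congr_fun this c

lemma list_sum_neg (l : List E) : (l.map (fun x => -x)).sum = - l.sum := by
  induction l with
  | nil => simp
  | cons x l ih => simp [ih]; abel

lemma bary_neg (l : List E) : bary (l.map (fun x => -x)) = - bary l := by
  simp [bary, list_sum_neg]

lemma nu_sd (n : ℕ) (c : Ch E) : nu (sd n c) = sd n (nu c) := by
  induction n generalizing c with
  | zero => simp [sd]
  | succ n ih =>
    have : nu ∘ₗ sd (n+1) = sd (n+1) ∘ₗ (nu : Ch E →ₗ[ZMod 2] Ch E) := by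
      apply Ch_ext
      intro l
      simp only [LinearMap.comp_apply, sd_single, nu_cone, ih, nu_single, bary_neg, nu_bdl]
    exact LinearMap.congr_fun this c

lemma bd_sd (n : ℕ) (c : Ch E) : bd (sd (n+1) c) = sd n (bd c) := by
  induction n generalizing c with
  | zero =>
    have : bd ∘ₗ sd 1 = sd 0 ∘ₗ (bd : Ch E →ₗ[ZMod 2] Ch E) := by
      apply Ch_ext
      intro l
      simp only [LinearMap.comp_apply, sd_single, bd_cone, bd_single]
      simp [sd, bd_bdl]
    exact LinearMap.congr_fun this c
  | succ n ih =>
    have : bd ∘ₗ sd (n+2) = sd (n+1) ∘ₗ (bd : Ch E →ₗ[ZMod 2] Ch E) := by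
      apply Ch_ext
      intro l
      simp only [LinearMap.comp_apply, sd_single, bd_cone, bd_single, ih, bd_bdl, map_zero, add_zero]
    exact LinearMap.congr_fun this c

/-- supports -/
def Sup (P : List E → Prop) : Submodule (ZMod 2) (Ch E) := Finsupp.supported _ _ {l | P l}

lemma single_mem_Sup {P : List E → Prop} {l : List E} (h : P l) (r : ZMod 2) :
    Finsupp.single l r ∈ Sup P := Finsupp.single_mem_supported _ _ h

lemma map_mem_Sup {P Q : List E → Prop} (f : Ch E →ₗ[ZMod 2] Ch E)
    (h : ∀ l, P l → f (Finsupp.single l 1) ∈ Sup Q) {c : Ch E} (hc : c ∈ Sup P) : f c ∈ Sup Q := by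
  have h2 : Sup P = Submodule.span (ZMod 2) ((fun l => Finsupp.single l 1) '' {l | P l}) :=
    Finsupp.supported_eq_span_single _ _
  rw [h2] at hc
  induction hc using Submodule.span_induction with
  | mem x hx =>
    obtain ⟨l, hl, rfl⟩ := hx
    exact h l hl
  | zero => simp
  | add x y _ _ hx hy => rw [map_add]; exact Submodule.add_mem _ hx hy
  | smul a x _ hx => rw [map_smul]; exact Submodule.smul_mem _ _ hx

lemma Sup_mono {P Q : List E → Prop} (h : ∀ l, P l → Q l) : Sup P ≤ Sup Q :=
  Finsupp.supported_mono h

/-- list property: length n, inside convex K, pairwise distances ≤ r -/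
def LP (n : ℕ) (K : Set E) (r : ℝ) (l : List E) : Prop :=
  l.length = n ∧ (∀ x ∈ l, x ∈ K) ∧ ∀ x ∈ l, ∀ y ∈ l, dist x y ≤ r

lemma bdl_mem (l : List E) : bdl l ∈ Sup (fun l' : List E => l'.length + 1 = l.length ∧ l' ⊆ l) := by
  induction l with
  | nil => simp [bdl]
  | cons x l ih =>
    refine Submodule.add_mem _ (single_mem_Sup ⟨rfl, List.subset_cons_self _ _⟩ _) ?_
    refine map_mem_Sup (cone x) ?_ ih
    rintro l' ⟨h1, h2⟩
    rw [cone_single]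
    exact single_mem_Sup ⟨by simp [h1], List.cons_subset_cons _ h2⟩ _

lemma list_sum_mem {K : Set E} (l : List E) (f : E → ℝ) (r : ℝ) (h : ∀ x ∈ l, f x ≤ r) :
    (l.map f).sum ≤ l.length * r := by
  induction l with
  | nil => simp
  | cons x l ih =>
    simp only [List.map_cons, List.sum_cons, List.length_cons, Nat.cast_add, Nat.cast_one]
    have := ih (fun y hy => h y (List.mem_cons_of_mem _ hy))
    have := h x List.mem_cons_self
    linarith

lemma bary_mem {K : Set E} (hK : Convex ℝ K) (l : List E) (hl : l ≠ []) (h : ∀ x ∈ l, x ∈ K) :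
    bary l ∈ K := by
  have hpos : (0:ℝ) < l.length := by
    have := List.length_pos_iff.mpr hl
    exact_mod_cast this
  have h1 : bary l = ∑ i : Fin l.length, (l.length : ℝ)⁻¹ • l.get i := by
    rw [bary, ← Finset.smul_sum]
    congr 1
    rw [← List.sum_ofFn, List.ofFn_get]
  rw [h1]
  apply hK.sum_mem
  · intros; positivity
  · simp [hpos.ne']
  · intro i _
    exact h _ (List.get_mem _ _)

lemma dist_bary (l : List E) (x : E) (hx : x ∈ l) (r : ℝ) (h : ∀ y ∈ l, dist y x ≤ r) (n : ℕ)
    (hl : l.length ≤ n + 1) (hr : 0 ≤ r) : dist (bary l) x ≤ n / (n + 1) * r := by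
  classical
  have hne : l ≠ [] := List.ne_nil_of_mem hx
  have hpos : (0:ℝ) < l.length := by
    have := List.length_pos_iff.mpr hne
    exact_mod_cast this
  have key : ‖l.sum - (l.length : ℝ) • x‖ ≤ ((l.length : ℝ) - 1) * r := by
    have hsum : ∀ (l : List E), ‖l.sum - (l.length : ℝ) • x‖ ≤ (l.map (fun y => dist y x)).sum := by
      intro l
      induction l with
      | nil => simp
      | cons y l ih =>
        simp only [List.sum_cons, List.length_cons, List.map_cons, Nat.cast_add, Nat.cast_one]
        have : y + l.sum - ((l.length : ℝ) + 1) • x = (y - x) + (l.sum - (l.length : ℝ) • x) := by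
          rw [add_smul, one_smul]; abel
        rw [this]
        refine (norm_add_le _ _).trans ?_
        rw [dist_eq_norm]
        linarith
    refine (hsum l).trans ?_
    have hp := List.perm_cons_erase hx
    rw [(hp.map (fun y => dist y x)).sum_eq]
    simp only [List.map_cons, dist_self, List.sum_cons, zero_add]
    have := list_sum_mem (K := Set.univ) (l.erase x) (fun y => dist y x) r
      (fun y hy => h y (List.mem_of_mem_erase hy))
    rw [List.length_erase_of_mem hx, Nat.cast_sub (List.length_pos_iff.mpr hne)] at this
    simpa using this
  have h2 : bary l - x = (l.length : ℝ)⁻¹ • (l.sum - (l.length : ℝ) • x) := by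
    rw [bary, smul_sub, smul_smul, inv_mul_cancel₀ hpos.ne', one_smul]
  rw [dist_eq_norm, h2, norm_smul, norm_inv, Real.norm_of_nonneg hpos.le]
  have hl' : (l.length : ℝ) ≤ n + 1 := by exact_mod_cast hl
  calc (l.length : ℝ)⁻¹ * ‖l.sum - (l.length : ℝ) • x‖ 
      ≤ (l.length : ℝ)⁻¹ * (((l.length : ℝ) - 1) * r) := by gcongr
    _ = (1 - (l.length : ℝ)⁻¹) * r := by field_simp
    _ ≤ n / (n + 1) * r := by
        apply mul_le_mul_of_nonneg_right _ hr
        have : (n : ℝ) / (n + 1) = 1 - ((n:ℝ) + 1)⁻¹ := by field_simp; ring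
        rw [this]
        have := inv_anti₀ hpos hl'
        linarith

lemma sd_mem {K : Set E} (hK : Convex ℝ K) (N n : ℕ) (hn : n ≤ N + 1) (r : ℝ) (hr : 0 ≤ r) (l : List E)
    (hl : LP n K r l) :
    sd n (Finsupp.single l 1) ∈ Sup (LP n (K ∩ convexHull ℝ {x | x ∈ l}) (N / (N + 1) * r)) := by
  induction n generalizing l with
  | zero =>
    simp only [sd, LinearMap.id_apply]
    apply single_mem_Sup
    obtain ⟨h1, -, -⟩ := hl
    have : l = [] := List.length_eq_zero_iff.mp h1
    subst this
    exact ⟨rfl, by simp, by simp⟩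
  | succ n ih =>
    rw [sd_single]
    obtain ⟨h1, h2, h3⟩ := hl
    have hne : l ≠ [] := by intro h; simp [h] at h1
    have hb := bdl_mem l
    have hsd : sd n (bdl l) ∈ Sup (LP n (K ∩ convexHull ℝ {x | x ∈ l}) (N / (N + 1) * r)) := by
      refine map_mem_Sup (sd n) ?_ hb
      rintro l' ⟨h4, h5⟩
      have := ih (by omega) l' ⟨by omega, fun x hx => h2 x (h5 hx), fun x hx y hy => h3 x (h5 hx) y (h5 hy)⟩
      refine Sup_mono ?_ this
      rintro l'' ⟨h6, h7, h8⟩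
      refine ⟨h6, fun x hx => ⟨(h7 x hx).1, ?_⟩, h8⟩
      exact convexHull_mono (fun y hy => h5 hy) (h7 x hx).2
    refine map_mem_Sup (cone (bary l)) ?_ hsd
    rintro l' ⟨h4, h5, h6⟩
    rw [cone_single]
    apply single_mem_Sup
    have hd : ∀ y ∈ l', dist (bary l) y ≤ N / (N + 1) * r := by
      intro y hy
      have hc : convexHull ℝ {x | x ∈ l} ⊆ Metric.closedBall (bary l) (N / (N + 1) * r) := by
        apply convexHull_min _ (convex_closedBall _ _)
        intro x hx
        rw [Metric.mem_closedBall, dist_comm]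
        exact dist_bary l x hx r (fun y hy => h3 y hy x hx) N (by omega) hr
      have := hc (h5 y hy).2
      rwa [Metric.mem_closedBall, dist_comm] at this
    refine ⟨by simp [h4], ?_, ?_⟩
    · intro x hx
      rcases List.mem_cons.mp hx with rfl | hx
      · exact ⟨bary_mem hK l hne h2, bary_mem (convex_convexHull _ _) l hne (fun x hx => subset_convexHull _ _ hx)⟩
      · exact h5 x hx
    · intro x hx y hy
      rcases List.mem_cons.mp hx with rfl | hx
      · rcases List.mem_cons.mp hy with rfl | hy
        · rw [dist_self]; positivity
        · exact hd y hy
      · rcases List.mem_cons.mp hy with rfl | hy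
        · rw [dist_comm]; exact hd x hx
        · exact h6 x hx y hy

/-- mixed cup product cochain -/
def cc : List (E → ZMod 2) → List E → ZMod 2
  | [], [_] => 1
  | (θ :: Θ), (x :: y :: l) => (θ x + θ y) * cc Θ (y :: l)
  | _, _ => 0

noncomputable def ccL (Θ : List (E → ZMod 2)) : Ch E →ₗ[ZMod 2] ZMod 2 :=
  Finsupp.linearCombination _ (cc Θ)

@[simp] lemma ccL_single (Θ : List (E → ZMod 2)) (l : List E) :
    ccL Θ (Finsupp.single l 1) = cc Θ l := by simp [ccL]

def aa (θ : E → ZMod 2) (Θ : List (E → ZMod 2)) : List E → ZMod 2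
  | [] => 0
  | (x :: l) => θ x * cc Θ (x :: l)

noncomputable def aaL (θ : E → ZMod 2) (Θ : List (E → ZMod 2)) : Ch E →ₗ[ZMod 2] ZMod 2 :=
  Finsupp.linearCombination _ (aa θ Θ)

@[simp] lemma aaL_single (θ) (Θ : List (E → ZMod 2)) (l : List E) :
    aaL θ Θ (Finsupp.single l 1) = aa θ Θ l := by simp [aaL]

lemma aaL_cone (θ) (Θ : List (E → ZMod 2)) (x : E) (c : Ch E) :
    aaL θ Θ (cone x c) = θ x * ccL Θ (cone x c) := by
  have : aaL θ Θ ∘ₗ cone x = θ x • (ccL Θ ∘ₗ cone x) := by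
    apply Ch_ext
    intro l
    simp [aa]
  simpa using LinearMap.congr_fun this c

lemma eqOn_Sup {M : Type*} [AddCommMonoid M] [Module (ZMod 2) M] {P : List E → Prop}
    {f g : Ch E →ₗ[ZMod 2] M} (h : ∀ l, P l → f (Finsupp.single l 1) = g (Finsupp.single l 1))
    {c : Ch E} (hc : c ∈ Sup P) : f c = g c := by
  have h2 : Sup P = Submodule.span (ZMod 2) ((fun l => Finsupp.single l 1) '' {l | P l}) :=
    Finsupp.supported_eq_span_single _ _
  rw [h2] at hc
  refine LinearMap.eqOn_span ?_ hc
  rintro _ ⟨l, hl, rfl⟩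
  exact h l hl

lemma cc_step (Θ : List (E → ZMod 2)) (h : ∀ l : List E, l.length = Θ.length + 2 → ccL Θ (bdl l) = 0)
    (θ : E → ZMod 2) {c : Ch E} (hc : c ∈ Sup (fun l' : List E => l'.length = Θ.length + 2)) :
    ccL (θ :: Θ) c = aaL θ Θ (bd c) := by
  refine eqOn_Sup (g := aaL θ Θ ∘ₗ bd) ?_ hc
  intro l hl
  match l with
  | [] => simp at hl
  | [x] => simp at hl
  | x :: y :: l =>
    have h1 := h _ hl
    rw [bdl, map_add, ccL_single] at h1
    rw [LinearMap.comp_apply, bd_single, bdl, map_add, aaL_cone, aaL_single, ccL_single]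
    rw [CharTwo.add_eq_zero] at h1
    rw [← h1]
    simp only [aa, cc]
    ring

lemma cc_cocycle (Θ : List (E → ZMod 2)) : ∀ l : List E, l.length = Θ.length + 2 → ccL Θ (bdl l) = 0 := by
  induction Θ with
  | nil =>
    intro l hl
    match l with
    | [x, y] =>
      simp only [bdl, map_add, ccL_single, cone_single, map_zero, add_zero, cc]
      decide
  | cons θ Θ ih =>
    intro l hl
    rw [cc_step Θ ih θ, bd_bdl, map_zero]
    refine Sup_mono ?_ (bdl_mem l)
    rintro l' ⟨h1, -⟩
    simp at hl
    omega

end BU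
end GK

namespace GK
section BU2
variable {n : ℕ}

abbrev TT (n : ℕ) : Set (Fin n → ℝ) := {x | ∑ i, |x i| = 1}

def SP (k : ℕ) (r : ℝ) (l : List (Fin n → ℝ)) : Prop :=
  ∃ K : Set (Fin n → ℝ), Convex ℝ K ∧ K ⊆ TT n ∧ LP (k+1) K r l

noncomputable def ee (n : ℕ) (j : ℕ) : Fin n → ℝ := fun i => if i.1 = j then 1 else 0

noncomputable def hh (n : ℕ) : ℕ → Ch (Fin n → ℝ)
  | 0 => Finsupp.single [ee n 0] 1
  | (k+1) => cone (ee n (k+1)) (hh n k + nu (hh n k))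

lemma bd_hh (k : ℕ) : bd (hh n (k+1)) = hh n k + nu (hh n k) := by
  induction k with
  | zero => rw [zero_add, hh.eq_2, bd_cone]; simp [hh, bdl, add_self_Ch]
  | succ k ih =>
    rw [hh, bd_cone, map_add, ← nu_bd, ih, map_add nu, nu_nu, add_comm (nu _), add_self_Ch, map_zero, add_zero]

def SG (n k : ℕ) (l : List (Fin n → ℝ)) : Prop := l.length = k + 1 ∧ ∃ σ : ℕ → ℝ, (∀ i, σ i = 1 ∨ σ i = -1) ∧
  ∀ x ∈ l, ∃ j ≤ k, x = σ j • ee n j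

lemma hh_SG (k : ℕ) : hh n k ∈ Sup (SG n k) := by
  induction k with
  | zero => exact single_mem_Sup ⟨rfl, fun _ => 1, by simp, by simp⟩ _
  | succ k ih =>
    have h2 : nu (hh n k) ∈ Sup (SG n k) := by
      refine map_mem_Sup nu ?_ ih
      rintro l ⟨h1, σ, hσ, h⟩
      rw [nu_single]
      refine single_mem_Sup ⟨by simpa using h1, fun i => - σ i, fun i => ?_, ?_⟩ _
      · rcases hσ i with h | h <;> simp [h]
      · intro x hx
        obtain ⟨y, hy, rfl⟩ := List.mem_map.1 hx
        obtain ⟨j, hj, rfl⟩ := h y hy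
        exact ⟨j, hj, by simp⟩
    refine map_mem_Sup (cone _) ?_ (Submodule.add_mem _ ih h2)
    rintro l ⟨h1, σ, hσ, h⟩
    rw [cone_single]
    refine single_mem_Sup ⟨by simpa using h1, Function.update σ (k+1) 1, fun i => ?_, ?_⟩ _
    · by_cases hi : i = k + 1 <;> simp [Function.update_apply, hi, hσ]
    · intro x hx
      rcases List.mem_cons.1 hx with rfl | hx
      · exact ⟨k+1, le_rfl, by simp⟩
      · obtain ⟨j, hj, rfl⟩ := h x hx
        exact ⟨j, by omega, by rw [Function.update_of_ne (by omega)]⟩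

lemma SG_SP {k : ℕ} (hk : k < n) {l : List (Fin n → ℝ)} (h : SG n k l) : SP k 2 l := by
  obtain ⟨h1, σ, hσ, h⟩ := h
  have hσ2 : ∀ i, σ i * σ i = 1 := fun i => by rcases hσ i with h | h <;> simp [h]
  refine ⟨{x | ∑ i, σ i.1 * x i = 1 ∧ ∀ i, 0 ≤ σ i.1 * x i}, ?_, ?_, h1, ?_, ?_⟩
  · rintro x ⟨hx1, hx2⟩ y ⟨hy1, hy2⟩ a b ha hb hab
    refine ⟨?_, fun i => ?_⟩
    · have : ∀ i, σ i.1 * (a • x + b • y) i = a * (σ i.1 * x i) + b * (σ i.1 * y i) := fun i => by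
        simp; ring
      simp_rw [this, Finset.sum_add_distrib, ← Finset.mul_sum, hx1, hy1]; linarith
    · have : σ i.1 * (a • x + b • y) i = a * (σ i.1 * x i) + b * (σ i.1 * y i) := by
        simp; ring
      rw [this]
      exact add_nonneg (mul_nonneg ha (hx2 i)) (mul_nonneg hb (hy2 i))
  · rintro x ⟨hx1, hx2⟩
    simp only [Set.mem_setOf_eq]
    rw [← hx1]
    refine Finset.sum_congr rfl fun i _ => ?_
    rw [← abs_of_nonneg (hx2 i), abs_mul]
    rcases hσ i with h | h <;> simp [h]
  · intro x hx
    obtain ⟨j, hj, rfl⟩ := h x hx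
    have e : ∀ i : Fin n, σ i.1 * (σ j • ee n j) i = if i = ⟨j, by omega⟩ then 1 else 0 := by
      intro i
      by_cases hi : i.1 = j
      · subst hi; simp [ee, hσ2]
      · have : i ≠ ⟨j, by omega⟩ := fun h => hi (by rw [h])
        simp [ee, hi, this]
    simp only [Set.mem_setOf_eq, e]
    refine ⟨by simp, fun i => by split_ifs <;> norm_num⟩
  · have hn : ∀ x ∈ l, ‖x‖ ≤ 1 := by
      intro x hx
      obtain ⟨j, hj, rfl⟩ := h x hx
      rw [pi_norm_le_iff_of_nonneg (by norm_num)]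
      intro i
      rcases hσ j with h | h <;> simp only [ee, h, Pi.smul_apply, smul_eq_mul] <;> split_ifs <;> simp
    intro x hx y hy
    rw [dist_eq_norm]
    linarith [norm_sub_le x y, hn x hx, hn y hy]

noncomputable def hN (n N k : ℕ) : Ch (Fin n → ℝ) := (sd (k+1))^[N] (hh n k)

lemma nu_hN (N k : ℕ) : nu (hN n N k) = (sd (k+1))^[N] (nu (hh n k)) := by
  induction N with
  | zero => rfl
  | succ N ih => 
    simp only [hN, Function.iterate_succ_apply'] at ih ⊢
    rw [nu_sd, ih]

lemma bd_hN (N k : ℕ) : bd (hN n N (k+1)) = hN n N k + nu (hN n N k) := by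
  rw [nu_hN]
  induction N with
  | zero => exact bd_hh k
  | succ N ih =>
    simp only [hN, Function.iterate_succ_apply'] at ih ⊢
    rw [bd_sd, ih, map_add]

lemma hN_SP (N k : ℕ) (hk : k < n) : hN n N k ∈ Sup (SP k ((n / (n+1) : ℝ)^N * 2)) := by
  induction N with
  | zero => simpa [hN] using Sup_mono (fun l => SG_SP hk) (hh_SG k)
  | succ N ih =>
    simp only [hN, Function.iterate_succ_apply'] at ih ⊢
    refine map_mem_Sup _ ?_ ih
    rintro l ⟨K, hK, hKT, hl⟩
    refine Sup_mono ?_ (sd_mem hK n (k+1) (by omega) _ (by positivity) l hl)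
    intro l' hl'
    refine ⟨_, hK.inter (convex_convexHull ℝ {x | x ∈ l}), fun x hx => hKT hx.1, ?_⟩
    rw [pow_succ', mul_assoc]
    exact hl'

def Odd2 (θ : (Fin n → ℝ) → ZMod 2) : Prop := ∀ x ∈ TT n, θ (-x) = θ x + 1

lemma cc_neg (Θ : List ((Fin n → ℝ) → ZMod 2)) (hΘ : ∀ θ ∈ Θ, Odd2 θ) (l : List (Fin n → ℝ))
    (hl : ∀ x ∈ l, x ∈ TT n) : cc Θ (l.map (fun x => -x)) = cc Θ l := by
  induction Θ generalizing l with
  | nil => match l with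
    | [] => rfl
    | [x] => rfl
    | x :: y :: l => rfl
  | cons θ Θ ih => match l with
    | [] => rfl
    | [x] => rfl
    | x :: y :: l =>
      have := ih (fun θ h => hΘ θ (by simp [h])) (y :: l) (fun z hz => hl z (by simp_all))
      have hθ := hΘ θ (by simp)
      simp only [List.map_cons, cc] at this ⊢
      rw [this, hθ x (hl x (by simp)), hθ y (hl y (by simp))]
      have : (1:ZMod 2) + 1 = 0 := by decide
      linear_combination this * cc Θ (y :: l)

lemma cc_const (Θ : List ((Fin n → ℝ) → ZMod 2)) (θ) (hθ : θ ∈ Θ) (l : List (Fin n → ℝ))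
    (hl : ∀ x ∈ l, ∀ y ∈ l, θ x = θ y) : cc Θ l = 0 := by
  induction Θ generalizing l with
  | nil => simp at hθ
  | cons θ' Θ ih => match l with
    | [] => rfl
    | [x] => rfl
    | x :: y :: l =>
      simp only [cc]
      rcases List.mem_cons.1 hθ with rfl | h
      · rw [hl x (by simp) y (by simp), CharTwo.add_self_eq_zero, zero_mul]
      · rw [ih h (y :: l) (fun a ha b hb => hl a (by simp_all) b (by simp_all)), mul_zero]

lemma ccL_hN (N : ℕ) (Θ : List ((Fin n → ℝ) → ZMod 2)) (hn : Θ.length < n) (hΘ : ∀ θ ∈ Θ, Odd2 θ) :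
    ccL Θ (hN n N Θ.length) = 1 := by
  induction Θ with
  | nil =>
    have : hN n N 0 = Finsupp.single [ee n 0] 1 := by
      induction N with
      | zero => rfl
      | succ N ih =>
        simp only [hN, Function.iterate_succ_apply', List.length_nil] at ih ⊢
        rw [ih]
        simp [sd, bdl, bary]
    simp only [List.length_nil, this, ccL_single, cc]
  | cons θ Θ ih =>
    simp only [List.length_cons] at hn ⊢
    rw [← ih (by omega) (fun θ h => hΘ θ (by simp [h])), cc_step Θ (cc_cocycle Θ) θ, bd_hN]
    · refine eqOn_Sup (f := aaL θ Θ ∘ₗ (LinearMap.id + nu)) ?_ (hN_SP N Θ.length (by omega))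
      rintro l ⟨K, hK, hKT, hl⟩
      match l with
      | [] => simp [LP] at hl
      | x :: l =>
        have := cc_neg Θ (fun θ h => hΘ θ (by simp [h])) (x :: l) (fun y hy => hKT (hl.2.1 y hy))
        simp only [LinearMap.comp_apply, LinearMap.add_apply, LinearMap.id_apply, nu_single, map_add,
          aaL_single, ccL_single, List.map_cons, aa] at this ⊢
        rw [this, hΘ θ (by simp) x (hKT (hl.2.1 x (by simp)))]
        linear_combination CharTwo.add_self_eq_zero (θ x) * cc Θ (x :: l)
    · refine Sup_mono ?_ (hN_SP N (Θ.length+1) (by omega))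
      rintro l ⟨K, hK, hKT, hl⟩
      exact hl.1

open Classical in
lemma exists_odd2 : ∃ φ : (Fin n → ℝ) → ZMod 2, Odd2 φ := by
  refine ⟨fun x => if 0 < toLex x then 1 else 0, fun x hx => ?_⟩
  have hx0 : toLex x ≠ 0 := by
    intro h
    have : x = 0 := h
    simp [this] at hx
  rcases lt_or_gt_of_ne hx0 with h | h
  · have h2 : 0 < toLex (-x) := by
      have : toLex (-x) = - toLex x := rfl
      rw [this]; exact Left.neg_pos_iff.2 h
    have h3 : ¬ 0 < toLex x := lt_asymm h
    simp only [if_pos h2, if_neg h3, zero_add]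
  · have h2 : ¬ 0 < toLex (-x) := by
      have : toLex (-x) = - toLex x := rfl
      rw [this, Left.neg_pos_iff]; exact not_lt.2 h.le
    simp only [if_neg h2, if_pos (show 0 < toLex x from h)]; decide

theorem borsuk_ulam (m : ℕ) (g : (Fin (m+1) → ℝ) → Fin m → ℝ) (hg : Continuous g) (hodd : ∀ x, g (-x) = - g x) :
    ∃ x ∈ TT (m+1), g x = 0 := by
  by_contra! hne
  have hcl : IsClosed (TT (m+1)) := isClosed_eq (by fun_prop) (by fun_prop)
  have hcp : IsCompact (TT (m+1)) := by
    refine Metric.isCompact_of_isClosed_isBounded hcl ((Metric.isBounded_closedBall (x := 0) (r := 1)).subset ?_)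
    intro x hx
    rw [mem_closedBall_zero_iff, pi_norm_le_iff_of_nonneg (by norm_num)]
    intro i
    rw [← (show ∑ i, |x i| = 1 from hx)]
    exact Finset.single_le_sum (f := fun i => |x i|) (fun _ _ => abs_nonneg _) (Finset.mem_univ i)
  have hTne : (TT (m+1)).Nonempty := ⟨Pi.single 0 1, by
    simp only [Set.mem_setOf_eq]
    rw [Fin.sum_univ_succ]; simp⟩
  obtain ⟨x0, hx0, hmin⟩ := hcp.exists_isMinOn hTne hg.norm.continuousOn
  have hc : 0 < ‖g x0‖ := norm_pos_iff.2 (hne x0 hx0)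
  obtain ⟨δ, hδ, hu⟩ := Metric.uniformContinuousOn_iff.1 (hcp.uniformContinuousOn_of_continuous hg.continuousOn) _ hc
  obtain ⟨N, hNN⟩ : ∃ N : ℕ, (((m+1:ℕ):ℝ) / ((m+1:ℕ)+1))^N * 2 < δ := by
    obtain ⟨N, h⟩ := exists_pow_lt_of_lt_one (half_pos hδ) (show (((m+1:ℕ):ℝ) / ((m+1:ℕ)+1)) < 1 by
      rw [div_lt_one (by positivity)]; linarith)
    exact ⟨N, by linarith⟩
  obtain ⟨φ, hφ⟩ := exists_odd2 (n := m+1)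
  let θ : Fin m → (Fin (m+1) → ℝ) → ZMod 2 := fun i x => if 0 < g x i then 1 else if g x i < 0 then 0 else φ x
  have hθ : ∀ i, Odd2 (θ i) := by
    intro i x hx
    have : g (-x) i = - g x i := by rw [hodd]; rfl
    simp only [θ, this]
    rcases lt_trichotomy (g x i) 0 with h | h | h
    · simp [h, not_lt.2 h.le]
    · simp [h, hφ x hx]
    · simp [h, not_lt.2 h.le]; decide
  have h1 := ccL_hN (n := m+1) N (List.ofFn θ) (by simp) (by simp [List.mem_ofFn]; exact hθ)
  have h0 : ccL (List.ofFn θ) (hN (m+1) N m) = 0 := by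
    refine eqOn_Sup (g := 0) ?_ (hN_SP N m (by omega))
    rintro l ⟨K, hK, hKT, hl⟩
    rw [ccL_single, LinearMap.zero_apply]
    match l with
    | [] => simp [LP] at hl
    | x :: l =>
      have hxT := hKT (hl.2.1 x (by simp))
      obtain ⟨i, hi⟩ : ∃ i, ‖g x0‖ ≤ |g x i| := by
        by_contra! h
        have := (pi_norm_lt_iff (x := g x) hc).2 (by simpa using h)
        exact absurd (hmin hxT) (not_le.2 this)
      refine cc_const _ (θ i) (by simp [List.mem_ofFn]) _ ?_
      have key : ∀ y ∈ x :: l, θ i y = θ i x := by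
        intro y hy
        have := hu y (hKT (hl.2.1 y hy)) x hxT ((hl.2.2 y hy x (by simp)).trans_lt hNN)
        have h3 := ((dist_pi_lt_iff hc).1 this i).trans_le hi
        rw [Real.dist_eq] at h3
        simp only [θ]
        rcases lt_or_ge 0 (g x i) with h | h
        · rw [abs_of_pos h] at h3
          have := abs_lt.1 h3
          rw [if_pos h, if_pos (by linarith)]
        · rw [abs_of_nonpos h] at h3
          have := abs_lt.1 h3
          rw [if_neg (by linarith), if_pos (by linarith), if_neg (by linarith), if_pos (by linarith)]
      intro a ha b hb
      rw [key a ha, key b hb]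
  simp only [List.length_ofFn] at h1
  rw [h0] at h1
  exact absurd h1 (by decide)
end BU2
end GK

namespace GK
section HS
open Finset

noncomputable def clamp (t : ℝ) : ℝ := max (-1) (min 1 t)

lemma clamp_neg (t : ℝ) : clamp (-t) = - clamp t := by
  simp only [clamp]
  rcases le_total t (-1) with h | h <;> rcases le_total t 1 with h' | h' <;>
    simp [min_def, max_def] <;> split_ifs <;> linarith

lemma hs_aux {α : Type*} (m : ℕ) (b : Fin (m+1) → α → ℝ) (S : Fin m → Finset α) :
    ∃ c : Fin (m+1) → ℝ, c ≠ 0 ∧ ∀ i, 2 * #{p ∈ S i | 0 < ∑ j, c j * b j p} ≤ #(S i) ∧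
      2 * #{p ∈ S i | ∑ j, c j * b j p < 0} ≤ #(S i) := by
  classical
  set ev : (Fin (m+1) → ℝ) → α → ℝ := fun c p => ∑ j, c j * b j p with hev
  have hevn : ∀ c p, ev (-c) p = - ev c p := fun c p => by simp [hev]
  have hevc : ∀ p, Continuous fun c => ev c p := fun p => by simp only [hev]; fun_prop
  have h1 : ∀ k : ℕ, ∃ x ∈ TT (m+1), ∀ i, ∑ p ∈ S i, clamp (k * ev x p) = 0 := by
    intro k
    obtain ⟨x, hx, h⟩ := borsuk_ulam m (fun x i => ∑ p ∈ S i, clamp (k * ev x p))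
      (by
        refine continuous_pi fun i => continuous_finsetSum _ fun p _ => ?_
        simp only [clamp]
        have := hevc p
        fun_prop)
      (by
        intro x; ext i
        simp only [hevn, mul_neg, clamp_neg, sum_neg_distrib, Pi.neg_apply])
    exact ⟨x, hx, fun i => congrFun h i⟩
  choose x hxT hx using h1
  have hcl : IsClosed (TT (m+1)) := isClosed_eq (by fun_prop) (by fun_prop)
  have hcp : IsCompact (TT (m+1)) := by
    refine Metric.isCompact_of_isClosed_isBounded hcl ((Metric.isBounded_closedBall (x := 0) (r := 1)).subset ?_)
    intro x hx
    rw [mem_closedBall_zero_iff, pi_norm_le_iff_of_nonneg (by norm_num)]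
    intro i
    rw [← (show ∑ i, |x i| = 1 from hx)]
    exact Finset.single_le_sum (f := fun i => |x i|) (fun _ _ => abs_nonneg _) (Finset.mem_univ i)
  obtain ⟨c, hcT, φ, hφ, hlim⟩ := hcp.tendsto_subseq hxT
  have hlarge : ∀ p, 0 < ev c p → ∀ᶠ k in Filter.atTop, 1 ≤ (φ k : ℝ) * ev (x (φ k)) p := by
    intro p hp
    have ht : Filter.Tendsto (fun k => ev (x (φ k)) p) Filter.atTop (nhds (ev c p)) :=
      ((hevc p).tendsto c).comp hlim
    have h2 := (tendsto_natCast_atTop_atTop (R := ℝ)).comp hφ.tendsto_atTop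
    exact (h2.atTop_mul_pos hp ht).eventually_ge_atTop 1
  have hsmall : ∀ p, ev c p < 0 → ∀ᶠ k in Filter.atTop, (φ k : ℝ) * ev (x (φ k)) p ≤ -1 := by
    intro p hp
    have ht : Filter.Tendsto (fun k => ev (x (φ k)) p) Filter.atTop (nhds (ev c p)) :=
      ((hevc p).tendsto c).comp hlim
    have h2 := (tendsto_natCast_atTop_atTop (R := ℝ)).comp hφ.tendsto_atTop
    exact (h2.atTop_mul_neg hp ht).eventually_le_atBot (-1)
  have bd1 : ∀ t, clamp t ≤ 1 := fun t => max_le (by norm_num) (min_le_left _ _)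
  have bd2 : ∀ t, -1 ≤ clamp t := fun t => le_max_left _ _
  refine ⟨c, ?_, fun i => ⟨?_, ?_⟩⟩
  · rintro rfl
    simp at hcT
  · obtain ⟨k, hk⟩ := ((Filter.eventually_all_finset (S i)).2 fun p _ => 
      (Filter.eventually_imp_distrib_left (p := 0 < ev c p)).2 (hlarge p)).exists
    have h0 := hx (φ k) i
    rw [← sum_filter_add_sum_filter_not (S i) (fun p => 0 < ev c p)] at h0
    have a1 : (#{p ∈ S i | 0 < ev c p} : ℝ) ≤ ∑ p ∈ S i with 0 < ev c p, clamp (φ k * ev (x (φ k)) p) := by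
      rw [← nsmul_one, ← sum_const]
      refine sum_le_sum fun p hp => ?_
      rw [mem_filter] at hp
      have := hk p hp.1 hp.2
      simp [clamp, this]
    have a2 : -(#{p ∈ S i | ¬ 0 < ev c p} : ℝ) ≤ ∑ p ∈ S i with ¬ 0 < ev c p, clamp (φ k * ev (x (φ k)) p) := by
      rw [← nsmul_one, ← smul_neg, ← sum_const]
      exact sum_le_sum fun p hp => bd2 _
    have a3 := card_filter_add_card_filter_not (s := S i) (fun p => 0 < ev c p)
    have : (#{p ∈ S i | 0 < ev c p} : ℝ) ≤ #{p ∈ S i | ¬ 0 < ev c p} := by linarith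
    norm_cast at this
    change 2 * #{p ∈ S i | 0 < ev c p} ≤ _
    omega
  · obtain ⟨k, hk⟩ := ((Filter.eventually_all_finset (S i)).2 fun p _ => 
      (Filter.eventually_imp_distrib_left (p := ev c p < 0)).2 (hsmall p)).exists
    have h0 := hx (φ k) i
    rw [← sum_filter_add_sum_filter_not (S i) (fun p => ev c p < 0)] at h0
    have a1 : ∑ p ∈ S i with ev c p < 0, clamp (φ k * ev (x (φ k)) p) ≤ -(#{p ∈ S i | ev c p < 0} : ℝ) := by
      rw [show -(#{p ∈ S i | ev c p < 0} : ℝ) = ∑ p ∈ S i with ev c p < 0, (-1:ℝ) by simp]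
      refine sum_le_sum fun p hp => ?_
      rw [mem_filter] at hp
      have := hk p hp.1 hp.2
      simp only [clamp]
      exact max_le le_rfl ((min_le_right _ _).trans this)
    have a2 : ∑ p ∈ S i with ¬ ev c p < 0, clamp (φ k * ev (x (φ k)) p) ≤ (#{p ∈ S i | ¬ ev c p < 0} : ℝ) := by
      rw [show (#{p ∈ S i | ¬ ev c p < 0} : ℝ) = ∑ p ∈ S i with ¬ ev c p < 0, (1:ℝ) by simp]
      exact sum_le_sum fun p hp => bd1 _
    have a3 := card_filter_add_card_filter_not (s := S i) (fun p => ev c p < 0)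
    have : (#{p ∈ S i | ev c p < 0} : ℝ) ≤ #{p ∈ S i | ¬ ev c p < 0} := by linarith
    norm_cast at this
    change 2 * #{p ∈ S i | ev c p < 0} ≤ _
    omega

lemma hs {α ι κ : Type*} [Fintype ι] [Fintype κ] (h : Fintype.card ι < Fintype.card κ) (b : κ → α → ℝ)
    (S : ι → Finset α) :
    ∃ c : κ → ℝ, c ≠ 0 ∧ ∀ i, 2 * #{p ∈ S i | 0 < ∑ j, c j * b j p} ≤ #(S i) ∧
      2 * #{p ∈ S i | ∑ j, c j * b j p < 0} ≤ #(S i) := by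
  classical
  obtain ⟨e⟩ : Nonempty (Fin (Fintype.card ι + 1) ↪ κ) := 
    Function.Embedding.nonempty_of_card_le (by simpa using h)
  obtain ⟨c, hc, hS⟩ := hs_aux (Fintype.card ι) (fun j => b (e j)) (fun i => S ((Fintype.equivFin ι).symm i))
  have key : ∀ p, ∑ j, (Function.extend e c 0) j * b j p = ∑ j, c j * b (e j) p := by
    intro p
    have h2 : ∀ j ∉ univ.map e, (Function.extend e c 0) j * b j p = 0 := by
      intro j hj
      rw [Function.extend_apply' _ _ _ (by simpa using hj)]; simp
    rw [← sum_subset (subset_univ (univ.map e)) (fun j _ hj => h2 j hj), sum_map]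
    simp [e.injective.extend_apply]
  refine ⟨Function.extend e c 0, ?_, fun i => ?_⟩
  · obtain ⟨j, hj⟩ := Function.ne_iff.1 hc
    refine Function.ne_iff.2 ⟨e j, ?_⟩
    rw [e.injective.extend_apply]; exact hj
  · simpa [key] using hS (Fintype.equivFin ι i)

abbrev MP := MvPolynomial (Fin 3) ℝ
abbrev V3 := Fin 3 → ℝ

lemma hs_poly {ι : Type*} [Fintype ι] (n : ℕ) (h : Fintype.card ι < (n+1)^3) (S : ι → Finset V3) :
    ∃ P : MP, P ≠ 0 ∧ P.totalDegree ≤ 3 * n ∧ ∀ i, 2 * #{p ∈ S i | 0 < P.eval p} ≤ #(S i) ∧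
      2 * #{p ∈ S i | P.eval p < 0} ≤ #(S i) := by
  classical
  obtain ⟨c, hc, hS⟩ := hs (κ := Fin 3 → Fin (n+1)) (by simpa using h)
    (fun e (p : V3) => ∏ i, p i ^ (e i).1) S
  let q : (Fin 3 → Fin (n+1)) → (Fin 3 →₀ ℕ) := fun e => Finsupp.equivFunOnFinite.symm fun i => (e i).1
  have hq : Function.Injective q := by
    intro e e' h
    have := Finsupp.equivFunOnFinite.symm.injective h
    ext i; exact congrFun this i
  have hev : ∀ p : V3, MvPolynomial.eval p (∑ e, MvPolynomial.monomial (q e) (c e)) = ∑ e, c e * ∏ i, p i ^ (e i).1 := by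
    intro p
    simp [q, MvPolynomial.eval_monomial, Finsupp.prod_fintype]
  refine ⟨∑ e, MvPolynomial.monomial (q e) (c e), ?_, ?_, fun i => by simpa only [hev] using hS i⟩
  · obtain ⟨e, he⟩ := Function.ne_iff.1 hc
    intro h0
    have := congrArg (MvPolynomial.coeff (q e)) h0
    simp only [MvPolynomial.coeff_sum, MvPolynomial.coeff_monomial, hq.eq_iff, MvPolynomial.coeff_zero] at this
    simp at this
    exact he this
  · refine MvPolynomial.totalDegree_finsetSum_le fun e _ => (MvPolynomial.totalDegree_monomial_le _ _).trans ?_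
    rw [Finsupp.sum_fintype _ _ (by simp)]
    simp only [q, Fin.sum_univ_three]
    have := fun i => (e i).is_le
    have h0 := this 0; have h1 := this 1; have h2 := this 2
    simp; omega

lemma part_aux (S : Finset V3) (J : ℕ) : ∃ P : ℕ → MP, (∀ k, P k ≠ 0) ∧
    (∀ k, (P k).totalDegree ≤ 3 * 2^(k/3+1)) ∧ 
    ∀ σ : ℕ → SignType, (∀ k, σ k ≠ 0) → #{x ∈ S | ∀ k < J, SignType.sign ((P k).eval x) = σ k} * 2^J ≤ #S := by
  classical
  induction J with
  | zero => exact ⟨fun _ => 1, by simp, by simp, fun σ _ => by simp⟩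
  | succ J ih =>
    obtain ⟨P, h1, h2, h3⟩ := ih
    let T : (Fin J → Bool) → ℕ → SignType := fun τ k => if h : k < J then (if τ ⟨k, h⟩ then 1 else -1) else 1
    obtain ⟨Q, hQ0, hQd, hQ⟩ := hs_poly (ι := Fin J → Bool) (2^(J/3+1)) (by
      have : 2^J ≤ 2^((J/3+1)*3) := Nat.pow_le_pow_right (by norm_num) (by omega)
      rw [pow_mul] at this
      have h4 : (2^(J/3+1))^3 < (2^(J/3+1)+1)^3 := Nat.pow_lt_pow_left (by omega) (by norm_num)
      simp; omega) (fun τ => {x ∈ S | ∀ k < J, SignType.sign ((P k).eval x) = T τ k})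
    refine ⟨Function.update P J Q, fun k => ?_, fun k => ?_, fun σ hσ => ?_⟩
    · rcases eq_or_ne k J with rfl | h <;> simp [*]
    · rcases eq_or_ne k J with rfl | h <;> simp [*]
    · have hs : ∀ k, σ k = 1 ∨ σ k = -1 := by
        intro k
        have := hσ k
        revert this
        generalize σ k = s
        revert s; decide
      let τ : Fin J → Bool := fun k => σ k = 1
      have hT : ∀ k < J, T τ k = σ k := by
        intro k hk
        simp only [T, hk, dif_pos, τ]
        rcases hs k with h | h <;> simp [h]
      have hT0 : ∀ k, T τ k ≠ 0 := by
        intro k; simp only [T]; split_ifs <;> decide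
      have h4 := h3 (T τ) hT0
      have h5 := hQ τ
      have sub : 2 * #{x ∈ S | ∀ k < J + 1, SignType.sign ((Function.update P J Q k).eval x) = σ k} ≤
        #{x ∈ S | ∀ k < J, SignType.sign ((P k).eval x) = T τ k} := by
        have hup : ∀ k < J, Function.update P J Q k = P k := fun k hk => Function.update_of_ne (by omega) _ _
        rcases hs J with hs | hs
        · refine le_trans ?_ h5.1
          refine Nat.mul_le_mul_left _ (card_le_card fun x hx => ?_)
          simp only [mem_filter] at hx ⊢
          refine ⟨⟨hx.1, fun k hk => ?_⟩, ?_⟩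
          · rw [hT k hk, ← hx.2 k (by omega), hup k hk]
          · have := hx.2 J (by omega)
            rw [Function.update_self, hs] at this
            exact sign_eq_one_iff.1 this
        · refine le_trans ?_ h5.2
          refine Nat.mul_le_mul_left _ (card_le_card fun x hx => ?_)
          simp only [mem_filter] at hx ⊢
          refine ⟨⟨hx.1, fun k hk => ?_⟩, ?_⟩
          · rw [hT k hk, ← hx.2 k (by omega), hup k hk]
          · have := hx.2 J (by omega)
            rw [Function.update_self, hs] at this
            exact sign_eq_neg_one_iff.1 this
      calc _ = 2 * #{x ∈ S | ∀ k < J + 1, SignType.sign ((Function.update P J Q k).eval x) = σ k} * 2^J := by ring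
        _ ≤ _ := (Nat.mul_le_mul_right _ sub).trans h4

theorem partition (S : Finset V3) (I : ℕ) : ∃ P : Fin (3*I) → MP, (∀ k, P k ≠ 0) ∧
    ∑ k, (P k).totalDegree ≤ 18 * 2^I ∧ 
    ∀ σ : Fin (3*I) → SignType, (∀ k, σ k ≠ 0) → #{x ∈ S | ∀ k, SignType.sign ((P k).eval x) = σ k} * 8^I ≤ #S := by
  classical
  obtain ⟨P, h1, h2, h3⟩ := part_aux S (3*I)
  refine ⟨fun k => P k, fun k => h1 k, ?_, fun σ hσ => ?_⟩
  · rw [Fin.sum_univ_eq_sum_range (fun k => (P k).totalDegree)]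
    clear h3
    have : ∀ I, ∑ k ∈ range (3*I), (P k).totalDegree + 18 ≤ 18 * 2^I := by
      intro I
      induction I with
      | zero => simp
      | succ I ih =>
        rw [show 3*(I+1) = 3*I+2+1 by ring, sum_range_succ, show 3*I+2 = 3*I+1+1 by ring, sum_range_succ, sum_range_succ]
        have a := h2 (3*I); have b := h2 (3*I+1); have c := h2 (3*I+2)
        rw [show 3*I/3 = I by omega] at a
        rw [show (3*I+1)/3 = I by omega] at b
        rw [show (3*I+2)/3 = I by omega] at c
        rw [show 3*I+1+1 = 3*I+2 by ring]
        rw [pow_succ] at *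
        omega
    have := this I; omega
  · have := h3 (fun k => if h : k < 3*I then σ ⟨k, h⟩ else 1) (by
      intro k; split_ifs
      · exact hσ _
      · decide)
    rw [pow_mul] at this
    refine le_trans (Nat.mul_le_mul_right _ (card_le_card fun x hx => ?_)) this
    simp only [mem_filter] at hx ⊢
    exact ⟨hx.1, fun k hk => by simpa [hk] using hx.2 ⟨k, hk⟩⟩
end HS
end GK

namespace GK
section LN
open Finset Polynomial

abbrev Ln := V3 × V3
def pt (l : Ln) (t : ℝ) : V3 := l.1 + t • l.2
def On (x : V3) (l : Ln) : Prop := ∃ t, x = pt l t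
noncomputable def restr (l : Ln) : MP →ₐ[ℝ] ℝ[X] := MvPolynomial.aeval (fun i => C (l.1 i) + C (l.2 i) * X)

@[simp] lemma eval_restr (l : Ln) (t : ℝ) (P : MP) : (restr l P).eval t = MvPolynomial.eval (pt l t) P := by
  have : (Polynomial.aeval t).comp (restr l) = MvPolynomial.aeval (pt l t) := by
    apply MvPolynomial.algHom_ext
    intro i
    simp [restr, pt]; ring
  have := DFunLike.congr_fun this P
  simpa [MvPolynomial.aeval_eq_eval, Polynomial.coe_aeval_eq_eval] using this

lemma natDegree_restr (l : Ln) (P : MP) : (restr l P).natDegree ≤ P.totalDegree := by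
  have := MvPolynomial.aeval_natDegree_le (m := P.totalDegree) P le_rfl (fun i => C (l.1 i) + C (l.2 i) * X) (n := 1)
    (fun i => by compute_degree)
  simpa [restr] using this

lemma restr_zero_iff {l : Ln} {P : MP} : restr l P = 0 ↔ ∀ x, On x l → P.eval x = 0 := by
  constructor
  · rintro h _ ⟨t, rfl⟩
    rw [← eval_restr, h, eval_zero]
  · intro h
    refine Polynomial.funext fun t => ?_
    rw [eval_restr, eval_zero]; exact h _ ⟨t, rfl⟩

lemma pt_inj {l : Ln} (hl : l.2 ≠ 0) {s t : ℝ} (h : pt l s = pt l t) : s = t := by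
  simp only [pt, add_right_inj] at h
  by_contra hne
  have : (s - t) • l.2 = 0 := by rw [sub_smul, h, sub_self]
  exact (smul_ne_zero (sub_ne_zero.2 hne) hl) this

lemma restr_zero_of_card {l : Ln} {P : MP} (X : Finset V3) (hX : ∀ x ∈ X, On x l ∧ P.eval x = 0)
    (hc : P.totalDegree < #X) : restr l P = 0 := by
  classical
  by_contra hne
  have h1 : ∀ x : X, ∃ t, x.1 = pt l t := fun x => (hX x x.2).1
  choose f hf using h1
  have h2 : univ.image f ⊆ (restr l P).roots.toFinset := by
    intro t ht
    obtain ⟨x, -, rfl⟩ := mem_image.1 ht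
    rw [Multiset.mem_toFinset, mem_roots hne, IsRoot, eval_restr, ← hf]
    exact (hX x x.2).2
  have h3 := card_le_card h2
  rw [card_image_of_injective _ (fun x y h => Subtype.ext (by rw [hf x, hf y, h]))] at h3
  have h4 := (Multiset.toFinset_card_le _).trans ((card_roots' (restr l P)).trans (natDegree_restr l P))
  simp at h3
  omega

open Classical in
lemma cells_le {J : ℕ} (P : Fin J → MP) (l : Ln) :
    #{σ : Fin J → SignType | (∀ k, σ k ≠ 0) ∧ ∃ x, On x l ∧ ∀ k, SignType.sign ((P k).eval x) = σ k} ≤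
      ∑ k, (P k).totalDegree + 1 := by
  set A := {σ : Fin J → SignType | (∀ k, σ k ≠ 0) ∧ ∃ x, On x l ∧ ∀ k, SignType.sign ((P k).eval x) = σ k}.toFinset with hA
  have h1 : ∀ σ : A, ∃ t, ∀ k, SignType.sign ((P k).eval (pt l t)) = σ.1 k := by
    rintro ⟨σ, hσ⟩
    simp only [hA, Set.mem_toFinset, Set.mem_setOf_eq] at hσ
    obtain ⟨-, x, ⟨t, rfl⟩, h⟩ := hσ
    exact ⟨t, h⟩
  have h0 : ∀ σ : A, ∀ k, σ.1 k ≠ 0 := by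
    rintro ⟨σ, hσ⟩
    simp only [hA, Set.mem_toFinset, Set.mem_setOf_eq] at hσ
    exact hσ.1
  choose f hf using h1
  let R : Finset ℝ := univ.biUnion fun k => (restr l (P k)).roots.toFinset
  have hR : #R ≤ ∑ k, (P k).totalDegree := card_biUnion_le.trans (sum_le_sum fun k _ =>
    (Multiset.toFinset_card_le _).trans ((card_roots' _).trans (natDegree_restr l _)))
  have inj : ∀ σ τ : A, f σ ≤ f τ → #{r ∈ R | r < f σ} = #{r ∈ R | r < f τ} → σ = τ := by
    intro σ τ hle hc
    ext1; funext k
    rw [← hf σ k, ← hf τ k]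
    by_contra hne
    have hs := h0 σ k; rw [← hf σ k] at hs
    have ht := h0 τ k; rw [← hf τ k] at ht
    rw [← eval_restr, ← eval_restr] at hne
    rw [← eval_restr, sign_ne_zero] at hs ht
    obtain ⟨r, hr1, hr2⟩ : ∃ r ∈ Set.Icc (f σ) (f τ), (restr l (P k)).eval r = 0 := by
      have hcont : ContinuousOn (fun t => (restr l (P k)).eval t) (Set.Icc (f σ) (f τ)) := by fun_prop
      rcases lt_or_gt_of_ne hs with hs | hs <;> rcases lt_or_gt_of_ne ht with ht | ht
      · exact absurd ((sign_neg hs).trans (sign_neg ht).symm) hne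
      · exact intermediate_value_Icc hle hcont ⟨hs.le, ht.le⟩
      · exact intermediate_value_Icc' hle hcont ⟨ht.le, hs.le⟩
      · exact absurd ((sign_pos hs).trans (sign_pos ht).symm) hne
    have hrR : r ∈ R := by
      simp only [R, mem_biUnion, mem_univ, true_and, Multiset.mem_toFinset]
      refine ⟨k, (mem_roots ?_).2 hr2⟩
      rintro h; rw [h] at hs; simp at hs
    have hlt : r < f τ := lt_of_le_of_ne hr1.2 (by rintro rfl; exact ht hr2)
    have hsub : {r ∈ R | r < f σ} ⊂ {r ∈ R | r < f τ} := by
      refine Finset.ssubset_iff_subset_ne.2 ⟨fun x hx => ?_, fun h => ?_⟩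
      · rw [mem_filter] at hx ⊢; exact ⟨hx.1, hx.2.trans_le hle⟩
      · have : r ∈ ({r ∈ R | r < f τ}) := mem_filter.2 ⟨hrR, hlt⟩
        rw [← h, mem_filter] at this
        exact absurd this.2 (not_lt.2 hr1.1)
    exact absurd hc (card_lt_card hsub).ne
  have hcard : #A ≤ #(range (#R + 1)) := by
    rw [← Fintype.card_coe A, ← card_univ]
    refine card_le_card_of_injOn (fun σ => #{r ∈ R | r < f σ}) (fun σ _ => ?_) ?_
    · simp only [coe_range, Set.mem_Iio]; exact Nat.lt_succ_of_le (card_le_card (filter_subset _ _))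
    · intro σ _ τ _ h
      rcases le_total (f σ) (f τ) with hle | hle
      · exact inj σ τ hle h
      · exact (inj τ σ hle h.symm).symm
  rw [card_range] at hcard
  have : #{σ : Fin J → SignType | (∀ k, σ k ≠ 0) ∧ ∃ x, On x l ∧ ∀ k, SignType.sign ((P k).eval x) = σ k} = #A := by
    congr 1; ext σ; simp [hA]
  omega
end LN
end GK

namespace GK
section BZ
open Finset Polynomial

noncomputable def BX (c : Fin 3 → ℕ) : Submodule ℝ MP := MvPolynomial.restrictSupport ℝ {m | ∀ i, m i < c i}

lemma mem_BX {c : Fin 3 → ℕ} {P : MP} (hP : P ≠ 0) : P ∈ BX c ↔ ∀ i, P.degreeOf i < c i := by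
  rw [BX, MvPolynomial.mem_restrictSupport_iff]
  constructor
  · intro h i
    obtain ⟨m, hm⟩ := MvPolynomial.support_nonempty.2 hP
    rw [MvPolynomial.degreeOf_lt_iff ((Nat.zero_le _).trans_lt (h hm i))]
    exact fun m hm => h hm i
  · intro h m hm i
    exact (MvPolynomial.degreeOf_lt_iff ((Nat.zero_le _).trans_lt (h i))).1 (h i) m hm

lemma bxEquiv (c : Fin 3 → ℕ) : Nonempty ({m : Fin 3 →₀ ℕ | ∀ i, m i < c i} ≃ ∀ i, Fin (c i)) :=
  ⟨{ toFun := fun m i => ⟨m.1 i, m.2 i⟩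
     invFun := fun f => ⟨Finsupp.equivFunOnFinite.symm fun i => (f i).1, fun i => (f i).2⟩
     left_inv := fun m => by ext i; rfl
     right_inv := fun f => by ext i; rfl }⟩

instance (c : Fin 3 → ℕ) : Module.Finite ℝ (BX c) := by
  obtain ⟨e⟩ := bxEquiv c
  have : Finite {m : Fin 3 →₀ ℕ | ∀ i, m i < c i} := Finite.of_equiv _ e.symm
  exact Module.Finite.of_basis (MvPolynomial.basisRestrictSupport ℝ _)

lemma finrank_BX (c : Fin 3 → ℕ) : Module.finrank ℝ (BX c) = c 0 * c 1 * c 2 := by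
  obtain ⟨e⟩ := bxEquiv c
  rw [BX, Module.finrank_eq_nat_card_basis (MvPolynomial.basisRestrictSupport ℝ {m | ∀ i, m i < c i}), Nat.card_congr e]
  simp [Fin.prod_univ_three]

def Lines (Ls : Finset Ln) : Prop := (∀ l ∈ Ls, l.2 ≠ 0) ∧ ∀ l ∈ Ls, ∀ l' ∈ Ls, l ≠ l' →
  ∀ x y, On x l → On x l' → On y l → On y l' → x = y

lemma Lines.mono {A B : Finset Ln} (h : Lines B) (hAB : A ⊆ B) : Lines A :=
  ⟨fun l hl => h.1 l (hAB hl), fun l hl l' hl' => h.2 l (hAB hl) l' (hAB hl')⟩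

/-- affine linear polynomial `⟨x - p, w⟩` -/
noncomputable def lin (p w : V3) : MP := ∑ i, (MvPolynomial.X i - MvPolynomial.C (p i)) * MvPolynomial.C (w i)

lemma eval_lin (p w x : V3) : (lin p w).eval x = ∑ i, (x i - p i) * w i := by simp [lin]

lemma lin_deg (p w : V3) : (lin p w).totalDegree ≤ 1 := by
  refine MvPolynomial.totalDegree_finsetSum_le fun i _ => (MvPolynomial.totalDegree_mul _ _).trans ?_
  rw [MvPolynomial.totalDegree_C, add_zero]
  refine (MvPolynomial.totalDegree_sub _ _).trans ?_
  simp [MvPolynomial.totalDegree_X]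

lemma exists_sep {Ls : Finset Ln} (h : Lines Ls) {l l' : Ln} (hl : l ∈ Ls) (hl' : l' ∈ Ls) (hne : l ≠ l') :
    ∃ P : MP, P.totalDegree ≤ 1 ∧ restr l' P = 0 ∧ restr l P ≠ 0 := by
  obtain ⟨t, ht⟩ : ∃ t, ¬ On (pt l t) l' := by
    by_contra! hc
    have := h.2 l hl l' hl' hne (pt l 0) (pt l 1) ⟨_, rfl⟩ (hc 0) ⟨_, rfl⟩ (hc 1)
    exact zero_ne_one (pt_inj (h.1 l hl) this)
  obtain ⟨p, d⟩ := l'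
  have hd : d ≠ 0 := h.1 _ hl'
  set y := pt l t
  have hdd : 0 < ∑ i, d i * d i := by
    obtain ⟨i, hi⟩ := Function.ne_iff.1 hd
    exact sum_pos' (fun i _ => mul_self_nonneg _) ⟨i, mem_univ _, mul_self_pos.2 hi⟩
  set N := ∑ i, d i * d i
  set s := (∑ i, (y i - p i) * d i) / N
  let w : V3 := fun i => y i - p i - s * d i
  have hwd : ∑ i, d i * w i = 0 := by
    have e : ∑ i, d i * w i = ∑ i, (y i - p i) * d i - s * N := by
      simp only [w, N, mul_sum, ← sum_sub_distrib]
      exact sum_congr rfl fun i _ => by ring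
    rw [e, div_mul_cancel₀ _ hdd.ne', sub_self]
  refine ⟨lin p w, lin_deg _ _, ?_, fun h0 => ?_⟩
  · rw [restr_zero_iff]
    rintro _ ⟨r, rfl⟩
    rw [eval_lin]
    have : ∑ i, (pt (p, d) r i - p i) * w i = r * ∑ i, d i * w i := by
      rw [mul_sum]; exact sum_congr rfl fun i _ => by simp [pt]; ring
    rw [this, hwd, mul_zero]
  · have h1 := restr_zero_iff.1 h0 y ⟨t, rfl⟩
    rw [eval_lin] at h1
    have h2 : ∑ i, w i * w i = 0 := by
      have : ∑ i, w i * w i = ∑ i, (y i - p i) * w i - s * ∑ i, d i * w i := by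
        rw [mul_sum, ← sum_sub_distrib]
        exact sum_congr rfl fun i _ => by simp only [w]; ring
      rw [this, h1, hwd]; simp
    rw [sum_eq_zero_iff_of_nonneg (fun i _ => mul_self_nonneg _)] at h2
    refine ht ⟨s, ?_⟩
    ext i
    have := mul_self_eq_zero.1 (h2 i (mem_univ _))
    simp only [w, pt, Pi.add_apply, Pi.smul_apply, smul_eq_mul] at this ⊢
    linarith

lemma exists_param (l : Ln) (hd : l.2 ≠ 0) : ∃ P : MP, P.totalDegree ≤ 1 ∧ restr l P = X := by
  obtain ⟨i, hi⟩ := Function.ne_iff.1 hd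
  refine ⟨(MvPolynomial.X i - MvPolynomial.C (l.1 i)) * MvPolynomial.C (l.2 i)⁻¹, ?_, ?_⟩
  · refine (MvPolynomial.totalDegree_mul _ _).trans ?_
    rw [MvPolynomial.totalDegree_C, add_zero]
    refine (MvPolynomial.totalDegree_sub _ _).trans ?_
    simp [MvPolynomial.totalDegree_X]
  · refine Polynomial.funext fun t => ?_
    simp only [Pi.zero_apply] at hi
    simp [pt]; field_simp

lemma totalDegree_aeval (P : MP) (hP : P.totalDegree ≤ 1) (q : ℝ[X]) (m : ℕ) (hq : q ∈ degreeLT ℝ m) (hm : 0 < m) :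
    (Polynomial.aeval P q).totalDegree + 1 ≤ m := by
  have hq' : q.natDegree < m := by
    rw [mem_degreeLT] at hq
    rcases eq_or_ne q 0 with rfl | h
    · simpa
    · exact (natDegree_lt_iff_degree_lt h).2 hq
  rw [Polynomial.aeval_eq_sum_range' hq']
  have : (∑ i ∈ range m, q.coeff i • P ^ i).totalDegree ≤ m - 1 := by
    refine MvPolynomial.totalDegree_finsetSum_le fun i hi => ?_
    refine (MvPolynomial.totalDegree_smul_le _ _).trans ((MvPolynomial.totalDegree_pow _ _).trans ?_)
    have := mem_range.1 hi
    calc _ ≤ i * 1 := Nat.mul_le_mul_left _ hP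
      _ ≤ _ := by omega
  omega

open Classical in
lemma bezout_aux (F G : MP) (hF : Irreducible F) (hFG : ¬ F ∣ G) (Ls : Finset Ln) (hL : Lines Ls)
    (hZ : ∀ l ∈ Ls, restr l F = 0 ∧ restr l G = 0) (E m : ℕ) (hE : F.totalDegree + G.totalDegree ≤ E)
    (hm : m + #Ls ≤ E + 1) (hm0 : 0 < m) : #Ls * m ≤ 6 * F.totalDegree * G.totalDegree * E := by
  have hG0 : G ≠ 0 := by rintro rfl; exact hFG (dvd_zero _)
  have hF0 := hF.ne_zero
  have hsep : ∀ l l' : Ls, ∃ P : MP, l ≠ l' → P.totalDegree ≤ 1 ∧ restr l'.1 P = 0 ∧ restr l.1 P ≠ 0 := by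
    intro l l'
    by_cases h : l = l'
    · exact ⟨0, fun h' => absurd h h'⟩
    · obtain ⟨P, hP⟩ := exists_sep hL l.2 l'.2 (fun h' => h (Subtype.ext h'))
      exact ⟨P, fun _ => hP⟩
  choose S hS using hsep
  have hpar : ∀ l : Ls, ∃ P : MP, P.totalDegree ≤ 1 ∧ restr l.1 P = X := fun l => exists_param l.1 (hL.1 _ l.2)
  choose lam hlam1 hlam2 using hpar
  let H : Ls → MP := fun l => ∏ l' ∈ univ.erase l, S l l'
  have hH1 : ∀ l, (H l).totalDegree + 1 ≤ #Ls := by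
    intro l
    have h1 : (H l).totalDegree ≤ ∑ l' ∈ univ.erase l, 1 := (MvPolynomial.totalDegree_finset_prod _ _).trans
      (sum_le_sum fun l' hl' => (hS l l' (ne_of_mem_erase hl').symm).1)
    rw [sum_const, card_erase_of_mem (mem_univ _), card_univ, Fintype.card_coe, smul_eq_mul, mul_one] at h1
    have : 0 < #Ls := card_pos.2 ⟨_, l.2⟩
    omega
  have hH2 : ∀ l l', l ≠ l' → restr l'.1 (H l) = 0 := by
    intro l l' h
    rw [map_prod]
    exact prod_eq_zero (mem_erase.2 ⟨h.symm, mem_univ l'⟩) (hS l l' h).2.1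
  have hH3 : ∀ l, restr l.1 (H l) ≠ 0 := by
    intro l
    rw [map_prod]
    exact prod_ne_zero_iff.2 fun l' hl' => (hS l l' (ne_of_mem_erase hl').symm).2.2
  set a : Fin 3 → ℕ := fun i => F.degreeOf i with ha
  set b : Fin 3 → ℕ := fun i => G.degreeOf i with hb
  have hale : ∀ i, a i ≤ F.totalDegree := fun i => MvPolynomial.degreeOf_le_totalDegree _ _
  have hble : ∀ i, b i ≤ G.totalDegree := fun i => MvPolynomial.degreeOf_le_totalDegree _ _
  let Φ : (BX (fun i => E - a i) × BX (fun i => E - b i)) × (Ls → degreeLT ℝ m) →ₗ[ℝ] MP :=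
    ((LinearMap.mulRight ℝ F ∘ₗ Submodule.subtype _).coprod (LinearMap.mulRight ℝ G ∘ₗ Submodule.subtype _)).coprod
      (∑ l, LinearMap.mulLeft ℝ (H l) ∘ₗ (Polynomial.aeval (lam l)).toLinearMap ∘ₗ Submodule.subtype _ ∘ₗ LinearMap.proj l)
  have hΦ : ∀ A B q, Φ ((A, B), q) = A.1 * F + B.1 * G + ∑ l, H l * Polynomial.aeval (lam l) (q l).1 := by
    intro A B q; simp [Φ]
  have hmulmem : ∀ (A K : MP), K ≠ 0 → A ∈ BX (fun i => E - K.degreeOf i) → A * K ∈ BX (fun _ => E) := by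
    intro A K hK hA
    by_cases hA0 : A = 0
    · simp [hA0]
    rw [mem_BX (mul_ne_zero hA0 hK)]
    rw [mem_BX hA0] at hA
    intro i
    have := hA i
    have h2 := MvPolynomial.degreeOf_mul_le i A K
    omega
  have hrange : Module.finrank ℝ (LinearMap.range Φ) ≤ E * E * E := by
    rw [← finrank_BX (fun _ => E)]
    refine Submodule.finrank_mono ?_
    rintro _ ⟨⟨⟨A, B⟩, q⟩, rfl⟩
    rw [hΦ]
    refine Submodule.add_mem _ (Submodule.add_mem _ (hmulmem _ _ hF0 A.2) (hmulmem _ _ hG0 B.2)) ?_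
    refine Submodule.sum_mem _ fun l _ => ?_
    by_cases h0 : H l * Polynomial.aeval (lam l) (q l).1 = 0
    · rw [h0]; exact Submodule.zero_mem _
    rw [mem_BX h0]
    intro i
    refine (MvPolynomial.degreeOf_le_totalDegree _ _).trans_lt ((MvPolynomial.totalDegree_mul _ _).trans_lt ?_)
    have := totalDegree_aeval (lam l) (hlam1 l) (q l).1 m (q l).2 hm0
    have := hH1 l
    omega
  let Ψ : BX (fun i => E - a i - b i) →ₗ[ℝ] MP := LinearMap.mulRight ℝ F ∘ₗ Submodule.subtype _
  have hkerq : ∀ A B q, Φ ((A, B), q) = 0 → q = 0 := by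
    intro A B q h
    funext l
    have h1 := congrArg (restr l.1) h
    rw [hΦ, map_add, map_add, map_mul, map_mul, (hZ l l.2).1, (hZ l l.2).2, map_sum, sum_eq_single l] at h1
    · rw [map_mul, ← Polynomial.aeval_algHom_apply, hlam2, Polynomial.aeval_X_left_apply, mul_zero, mul_zero, zero_add, zero_add, map_zero] at h1
      exact Subtype.ext ((mul_eq_zero.1 h1).resolve_left (hH3 l))
    · intro l' _ hne
      rw [map_mul, hH2 l' l hne, zero_mul]
    · simp
  have hker : Module.finrank ℝ (LinearMap.ker Φ) ≤ (E - a 0 - b 0) * (E - a 1 - b 1) * (E - a 2 - b 2) := by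
    rw [← finrank_BX (fun i => E - a i - b i)]
    let ρ : LinearMap.ker Φ →ₗ[ℝ] MP := Submodule.subtype _ ∘ₗ LinearMap.snd ℝ _ _ ∘ₗ LinearMap.fst ℝ _ _ ∘ₗ Submodule.subtype _
    have hρ : Function.Injective ρ := by
      rintro ⟨⟨⟨A, B⟩, q⟩, hk⟩ ⟨⟨⟨A', B'⟩, q'⟩, hk'⟩ h0
      have hB : B = B' := Subtype.ext h0
      subst hB
      obtain rfl := hkerq A B q hk
      obtain rfl := hkerq A' B q' hk'
      have h1 : Φ ((A, B), 0) = Φ ((A', B), 0) := hk.trans hk'.symm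
      rw [hΦ, hΦ, add_left_inj, add_left_inj] at h1
      have hA : A = A' := Subtype.ext (mul_right_cancel₀ hF0 h1)
      subst hA; rfl
    rw [← LinearMap.finrank_range_of_inj hρ]
    refine le_trans (Submodule.finrank_mono (t := LinearMap.range Ψ) ?_) (LinearMap.finrank_range_le Ψ)
    rintro _ ⟨⟨⟨⟨A, B⟩, q⟩, hk⟩, rfl⟩
    change B.1 ∈ LinearMap.range Ψ
    have hq := hkerq A B q hk
    have h1 : Φ ((A, B), q) = 0 := hk
    rw [hΦ, hq] at h1
    simp only [Pi.zero_apply, Submodule.coe_zero, map_zero, mul_zero, sum_const_zero, add_zero] at h1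
    have hdvd : F ∣ B.1 * G := ⟨-A.1, by linear_combination h1⟩
    obtain ⟨K, hK⟩ := (hF.prime.dvd_or_dvd hdvd).resolve_right hFG
    refine ⟨⟨K, ?_⟩, by simp [Ψ, hK, mul_comm]⟩
    by_cases hK0 : K = 0
    · rw [hK0]; exact Submodule.zero_mem _
    rw [mem_BX hK0]
    have hB := B.2
    rw [hK, mem_BX (mul_ne_zero hF0 hK0)] at hB
    intro i
    have := hB i
    rw [MvPolynomial.degreeOf_mul_eq hF0 hK0] at this
    simp only [ha, hb] at *
    omega
  have hrn := LinearMap.finrank_range_add_finrank_ker Φ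
  rw [Module.finrank_prod, Module.finrank_prod, finrank_BX, finrank_BX, Module.finrank_pi_fintype] at hrn
  have hdl : Module.finrank ℝ (degreeLT ℝ m) = m := by
    rw [(degreeLTEquiv ℝ m).finrank_eq]; simp
  simp only [hdl, sum_const, card_univ, Fintype.card_coe, smul_eq_mul] at hrn
  obtain ⟨e0, he0⟩ := Nat.exists_eq_add_of_le (show a 0 + b 0 ≤ E from (add_le_add (hale 0) (hble 0)).trans hE)
  obtain ⟨e1, he1⟩ := Nat.exists_eq_add_of_le (show a 1 + b 1 ≤ E from (add_le_add (hale 1) (hble 1)).trans hE)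
  obtain ⟨e2, he2⟩ := Nat.exists_eq_add_of_le (show a 2 + b 2 ≤ E from (add_le_add (hale 2) (hble 2)).trans hE)
  have key : #Ls * m + (E - a 0) * (E - a 1) * (E - a 2) + (E - b 0) * (E - b 1) * (E - b 2) ≤ 
    E * E * E + (E - a 0 - b 0) * (E - a 1 - b 1) * (E - a 2 - b 2) := by omega
  have hab : ∀ i j, a i * b j ≤ F.totalDegree * G.totalDegree := fun i j => Nat.mul_le_mul (hale i) (hble j)
  have h01 := hab 0 1; have h02 := hab 0 2; have h10 := hab 1 0; have h12 := hab 1 2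
  have h20 := hab 2 0; have h21 := hab 2 1
  have hsum : (a 0 * b 1 + a 0 * b 2 + a 1 * b 0 + a 1 * b 2 + a 2 * b 0 + a 2 * b 1) * E ≤ 6 * F.totalDegree * G.totalDegree * E :=
    Nat.mul_le_mul_right _ (by nlinarith)
  refine le_trans ?_ hsum
  have k0 : a 0 ≤ E := by omega
  have k1 : a 1 ≤ E := by omega
  have k2 : a 2 ≤ E := by omega
  have r : ∀ i, a i + b i ≤ E := fun i => (add_le_add (hale i) (hble i)).trans hE
  have r0 := r 0; have r1 := r 1; have r2 := r 2
  generalize a 0 = a0 at *; generalize a 1 = a1 at *; generalize a 2 = a2 at *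
  generalize b 0 = b0 at *; generalize b 1 = b1 at *; generalize b 2 = b2 at *
  zify [k0, k1, k2, show b0 ≤ E by omega, show b1 ≤ E by omega, show b2 ≤ E by omega,
    show b0 ≤ E - a0 by omega, show b1 ≤ E - a1 by omega, show b2 ≤ E - a2 by omega] at key ⊢
  have p : ∀ x y z : ℕ, (0:ℤ) ≤ x * y * z := fun x y z => by positivity
  linarith [p a0 a1 b2, p a0 b1 a2, p b0 a1 a2, p b0 b1 a2, p b0 a1 b2, p a0 b1 b2]

theorem bezout_lines (F G : MP) (hF : Irreducible F) (hFG : ¬ F ∣ G) (Ls : Finset Ln) (hL : Lines Ls)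
    (hZ : ∀ l ∈ Ls, restr l F = 0 ∧ restr l G = 0) : #Ls ≤ 6 * F.totalDegree * G.totalDegree := by
  by_contra! h
  obtain ⟨T, hT, hc⟩ := exists_subset_card_eq (Nat.succ_le_of_lt h)
  set n := 6 * F.totalDegree * G.totalDegree with hn
  have := bezout_aux F G hF hFG T (hL.mono hT) (fun l hl => hZ l (hT hl)) 
    ((n+1)*(n+1) + F.totalDegree + G.totalDegree) ((n+1)*n + F.totalDegree + G.totalDegree + 1) (by omega) (by rw [hc]; ring_nf; omega) (by omega)
  rw [← hn, hc] at this
  nlinarith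
end BZ
end GK

namespace GK
section AL
open Finset

section Rg
variable {R S : Type*} [CommRing R] [CommRing S]
def q1 (n u : Fin 3 → R) : R := n 0 * u 0 + n 1 * u 1 + n 2 * u 2
def q2 (H : Fin 3 → Fin 3 → R) (u w : Fin 3 → R) : R := ∑ i, ∑ j, H i j * u i * w j
def q3 (T : Fin 3 → Fin 3 → Fin 3 → R) (u w y : Fin 3 → R) : R := ∑ i, ∑ j, ∑ k, T i j k * u i * w j * y k
def cr (u w : Fin 3 → R) : Fin 3 → R := ![u 1 * w 2 - u 2 * w 1, u 2 * w 0 - u 0 * w 2, u 0 * w 1 - u 1 * w 0]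
@[simp] lemma cr0 (u w : Fin 3 → R) : cr u w 0 = u 1 * w 2 - u 2 * w 1 := rfl
@[simp] lemma cr1 (u w : Fin 3 → R) : cr u w 1 = u 2 * w 0 - u 0 * w 2 := rfl
@[simp] lemma cr2 (u w : Fin 3 → R) : cr u w 2 = u 0 * w 1 - u 1 * w 0 := rfl
def E1 (v n : Fin 3 → R) := cr v n
def E2 (v n : Fin 3 → R) := cr n (cr v n)
def M1 (v n : Fin 3 → R) : R := q1 (E1 v n) (E1 v n) * q1 n n
def fA (v n) (H : Fin 3 → Fin 3 → R) := q2 H (E1 v n) (E1 v n)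
def fB (v n) (H : Fin 3 → Fin 3 → R) := q2 H (E1 v n) (E2 v n)
def fC (v n) (H : Fin 3 → Fin 3 → R) := q2 H (E2 v n) (E2 v n)
def k0 (v n) (T : Fin 3 → Fin 3 → Fin 3 → R) := q3 T (E1 v n) (E1 v n) (E1 v n)
def k1 (v n) (T : Fin 3 → Fin 3 → Fin 3 → R) := q3 T (E1 v n) (E1 v n) (E2 v n)
def k2 (v n) (T : Fin 3 → Fin 3 → Fin 3 → R) := q3 T (E1 v n) (E2 v n) (E2 v n)
def k3 (v n) (T : Fin 3 → Fin 3 → Fin 3 → R) := q3 T (E2 v n) (E2 v n) (E2 v n)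
def R1 (v n : Fin 3 → R) (H : Fin 3 → Fin 3 → R) (T : Fin 3 → Fin 3 → Fin 3 → R) : R :=
  3 * k2 v n T * fA v n H ^ 2 - fC v n H * fA v n H * k0 v n T - 6 * fA v n H * fB v n H * k1 v n T + 4 * fB v n H ^ 2 * k0 v n T
def R2 (v n : Fin 3 → R) (H : Fin 3 → Fin 3 → R) (T : Fin 3 → Fin 3 → Fin 3 → R) : R :=
  k3 v n T * fA v n H ^ 2 - 3 * fA v n H * fC v n H * k1 v n T + 2 * fB v n H * fC v n H * k0 v n T
def Dl (v n : Fin 3 → R) (H : Fin 3 → Fin 3 → R) : R := fB v n H ^ 2 - fA v n H * fC v n H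

section
variable (f : R →+* S)
lemma map_q1 (n u : Fin 3 → R) : f (q1 n u) = q1 (fun i => f (n i)) (fun i => f (u i)) := by simp [q1]
lemma map_q2 (H : Fin 3 → Fin 3 → R) (u w : Fin 3 → R) : f (q2 H u w) = q2 (fun i j => f (H i j)) (fun i => f (u i)) (fun i => f (w i)) := by simp [q2]
lemma map_q3 (T : Fin 3 → Fin 3 → Fin 3 → R) (u w y : Fin 3 → R) : f (q3 T u w y) = q3 (fun i j k => f (T i j k)) (fun i => f (u i)) (fun i => f (w i)) (fun i => f (y i)) := by simp [q3]
lemma map_cr (u w : Fin 3 → R) : (fun i => f (cr u w i)) = cr (fun i => f (u i)) (fun i => f (w i)) := by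
  funext i; fin_cases i <;> simp
lemma map_E1 (u w : Fin 3 → R) : (fun i => f (E1 u w i)) = E1 (fun i => f (u i)) (fun i => f (w i)) := map_cr f _ _
lemma map_E2 (u w : Fin 3 → R) : (fun i => f (E2 u w i)) = E2 (fun i => f (u i)) (fun i => f (w i)) := by
  simp only [E2, map_cr]
lemma map_M1 (v n : Fin 3 → R) : f (M1 v n) = M1 (fun i => f (v i)) (fun i => f (n i)) := by
  simp only [M1, map_mul, map_q1, map_E1]
lemma map_fA (v n) (H : Fin 3 → Fin 3 → R) : f (fA v n H) = fA (fun i => f (v i)) (fun i => f (n i)) (fun i j => f (H i j)) := by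
  simp only [fA, map_q2, map_E1]
lemma map_fB (v n) (H : Fin 3 → Fin 3 → R) : f (fB v n H) = fB (fun i => f (v i)) (fun i => f (n i)) (fun i j => f (H i j)) := by
  simp only [fB, map_q2, map_E1, map_E2]
lemma map_fC (v n) (H : Fin 3 → Fin 3 → R) : f (fC v n H) = fC (fun i => f (v i)) (fun i => f (n i)) (fun i j => f (H i j)) := by
  simp only [fC, map_q2, map_E2]
lemma map_Dl (v n) (H : Fin 3 → Fin 3 → R) : f (Dl v n H) = Dl (fun i => f (v i)) (fun i => f (n i)) (fun i j => f (H i j)) := by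
  simp only [Dl, map_sub, map_pow, map_mul, map_fA, map_fB, map_fC]
lemma map_R1 (v n) (H : Fin 3 → Fin 3 → R) (T) : f (R1 v n H T) = R1 (fun i => f (v i)) (fun i => f (n i)) (fun i j => f (H i j)) (fun i j k => f (T i j k)) := by
  simp only [R1, k0, k1, k2, map_add, map_sub, map_pow, map_mul, map_fA, map_fB, map_fC, map_q3, map_E1, map_E2, map_ofNat]
lemma map_R2 (v n) (H : Fin 3 → Fin 3 → R) (T) : f (R2 v n H T) = R2 (fun i => f (v i)) (fun i => f (n i)) (fun i j => f (H i j)) (fun i j k => f (T i j k)) := by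
  simp only [R2, k0, k1, k3, map_add, map_sub, map_pow, map_mul, map_fA, map_fB, map_fC, map_q3, map_E1, map_E2, map_ofNat]
end

lemma frame (v n u : Fin 3 → R) (h : q1 n u = 0) :
    M1 v n • u = (q1 u (E1 v n) * q1 n n) • E1 v n + q1 u (E2 v n) • E2 v n := by
  simp only [M1, E1, E2, q1] at h ⊢
  funext i
  fin_cases i <;> simp
  · linear_combination (exp := 1) ((v 1 * n 2 - v 2 * n 1)^2 + (v 2 * n 0 - v 0 * n 2)^2 + (v 0 * n 1 - v 1 * n 0)^2) * n 0 * h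
  · linear_combination (exp := 1) ((v 1 * n 2 - v 2 * n 1)^2 + (v 2 * n 0 - v 0 * n 2)^2 + (v 0 * n 1 - v 1 * n 0)^2) * n 1 * h
  · linear_combination (exp := 1) ((v 1 * n 2 - v 2 * n 1)^2 + (v 2 * n 0 - v 0 * n 2)^2 + (v 0 * n 1 - v 1 * n 0)^2) * n 2 * h

lemma q2_comb {H : Fin 3 → Fin 3 → R} (hH : ∀ i j, H i j = H j i) (e f : Fin 3 → R) (s t : R) :
    q2 H (s • e + t • f) (s • e + t • f) = q2 H e e * s ^ 2 + 2 * q2 H e f * s * t + q2 H f f * t ^ 2 := by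
  simp only [q2, Fin.sum_univ_three, hH 1 0, hH 2 0, hH 2 1, Pi.add_apply, Pi.smul_apply, smul_eq_mul]
  ring

lemma q3_comb {T : Fin 3 → Fin 3 → Fin 3 → R} (h1 : ∀ i j k, T i j k = T j i k) (h2 : ∀ i j k, T i j k = T i k j)
    (e f : Fin 3 → R) (s t : R) :
    q3 T (s • e + t • f) (s • e + t • f) (s • e + t • f) = q3 T e e e * s ^ 3 + 3 * q3 T e e f * s ^ 2 * t
      + 3 * q3 T e f f * s * t ^ 2 + q3 T f f f * t ^ 3 := by
  simp only [q3, Fin.sum_univ_three, h1 1 0, h1 2 0, h1 2 1, h2 _ 1 0, h2 _ 2 0, h2 _ 2 1, Pi.add_apply, Pi.smul_apply, smul_eq_mul]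
  ring

lemma q2_smul (H : Fin 3 → Fin 3 → R) (c : R) (u : Fin 3 → R) : q2 H (c • u) (c • u) = c ^ 2 * q2 H u u := by
  simp only [q2, Fin.sum_univ_three, Pi.smul_apply, smul_eq_mul]; ring
lemma q3_smul (T : Fin 3 → Fin 3 → Fin 3 → R) (c : R) (u : Fin 3 → R) : q3 T (c • u) (c • u) (c • u) = c ^ 3 * q3 T u u u := by
  simp only [q3, Fin.sum_univ_three, Pi.smul_apply, smul_eq_mul]; ring

/-- master identity -/
lemma master {v n u : Fin 3 → R} {H : Fin 3 → Fin 3 → R} {T : Fin 3 → Fin 3 → Fin 3 → R} (hH : ∀ i j, H i j = H j i)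
    (h1 : ∀ i j k, T i j k = T j i k) (h2 : ∀ i j k, T i j k = T i k j) (hn : q1 n u = 0) (hu : q2 H u u = 0) :
    fA v n H ^ 2 * M1 v n ^ 3 * q3 T u u u = q1 u (E2 v n) ^ 2 * (q1 u (E1 v n) * q1 n n * R1 v n H T + q1 u (E2 v n) * R2 v n H T) := by
  have f := frame v n u hn
  have e2 := q2_smul H (M1 v n) u
  have e3 := q3_smul T (M1 v n) u
  rw [f, q2_comb hH, hu] at e2
  rw [f, q3_comb h1 h2] at e3
  rw [mul_assoc, ← e3]
  generalize q1 u (E1 v n) * q1 n n = s at *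
  generalize q1 u (E2 v n) = t at *
  simp only [R1, R2, fA, fB, fC, k0, k1, k2, k3]
  generalize q2 H (E1 v n) (E1 v n) = A at *
  generalize q2 H (E1 v n) (E2 v n) = B at *
  generalize q2 H (E2 v n) (E2 v n) = C at *
  generalize q3 T (E1 v n) (E1 v n) (E1 v n) = c0 at *
  generalize q3 T (E1 v n) (E1 v n) (E2 v n) = c1 at *
  generalize q3 T (E1 v n) (E2 v n) (E2 v n) = c2 at *
  generalize q3 T (E2 v n) (E2 v n) (E2 v n) = c3 at *
  linear_combination (A * c0 * s + (3 * A * c1 - 2 * B * c0) * t) * e2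
end Rg
end AL
end GK

namespace GK
section NL
open Finset
open MvPolynomial (pderiv)

lemma pderiv_comm (i j : Fin 3) (F : MP) : pderiv i (pderiv j F) = pderiv j (pderiv i F) := by
  have : ⁅(pderiv i : Derivation ℝ MP MP), (pderiv j : Derivation ℝ MP MP)⁆ = 0 := by
    apply MvPolynomial.derivation_ext
    intro k
    rw [Derivation.commutator_apply]
    by_cases h1 : k = i <;> by_cases h2 : k = j <;> simp [MvPolynomial.pderiv_X, Pi.single_apply, h1, h2] <;> split_ifs <;> simp
  have := DFunLike.congr_fun this F
  rw [Derivation.commutator_apply] at this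
  simpa [sub_eq_zero] using this

lemma deg_pderiv' (i : Fin 3) (F : MP) : (pderiv i F).totalDegree ≤ F.totalDegree - 1 := by
  refine Finset.sup_le fun m hm => ?_
  rw [MvPolynomial.mem_support_iff, MvPolynomial.coeff_pderiv] at hm
  have h : m + Finsupp.single i 1 ∈ F.support := by
    rw [MvPolynomial.mem_support_iff]; intro h; simp [h] at hm
  have := MvPolynomial.le_totalDegree h
  rw [Finsupp.sum_add_index' (by simp) (by simp), Finsupp.sum_single_index (by simp)] at this
  omega

lemma deg_pderiv (i : Fin 3) (F : MP) : (pderiv i F).totalDegree ≤ F.totalDegree :=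
  (deg_pderiv' i F).trans (Nat.sub_le _ _)

lemma const_of_pderiv (F : MP) (h : ∀ i, pderiv i F = 0) : F.totalDegree = 0 := by
  rw [← Nat.le_zero]
  refine Finset.sup_le fun m hm => ?_
  by_contra hne
  have : m ≠ 0 := by rintro rfl; simp at hne
  obtain ⟨i, hi⟩ : ∃ i, m i ≠ 0 := by
    by_contra hc; push Not at hc; exact this (Finsupp.ext hc)
  have h2 := congrArg (MvPolynomial.coeff (m - Finsupp.single i 1)) (h i)
  rw [MvPolynomial.coeff_pderiv] at h2
  have h3 : m - Finsupp.single i 1 + Finsupp.single i 1 = m := by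
    ext j; by_cases hj : i = j
    · subst hj; simp; omega
    · simp [Finsupp.single_apply, hj]
  rw [h3] at h2
  simp at h2
  rcases h2 with h2 | h2
  · exact (MvPolynomial.mem_support_iff.1 hm) h2
  · norm_cast at h2

lemma chain {σ B : Type*} [Fintype σ] [DecidableEq σ] [CommRing B] [Algebra ℝ B] (ρ : MvPolynomial σ ℝ →ₐ[ℝ] B) (d : Derivation ℝ B B)
    (f : MvPolynomial σ ℝ) : d (ρ f) = ∑ i, ρ (pderiv i f) * d (ρ (MvPolynomial.X i)) := by
  induction f using MvPolynomial.induction_on with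
  | C a => simp [← MvPolynomial.algebraMap_eq]
  | add p q hp hq => simp only [map_add, hp, hq, add_mul, sum_add_distrib]
  | mul_X p j hp =>
    simp only [map_mul, Derivation.leibniz, hp, smul_eq_mul, MvPolynomial.pderiv_X, map_add, add_mul, sum_add_distrib, mul_sum]
    congr 1
    · rw [Finset.sum_eq_single j]
      · simp
      · intro b _ hb; simp [Pi.single_apply, hb.symm]
      · simp
    · exact sum_congr rfl fun i _ => by ring

noncomputable def gr (F : MP) (i : Fin 3) : MP := pderiv i F
noncomputable def he (F : MP) (i j : Fin 3) : MP := pderiv j (pderiv i F)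
noncomputable def th (F : MP) (i j k : Fin 3) : MP := pderiv k (pderiv j (pderiv i F))
noncomputable def cv (v : V3) (i : Fin 3) : MP := MvPolynomial.C (v i)

lemma he_symm (F : MP) (i j) : he F i j = he F j i := pderiv_comm _ _ _
lemma th_symm1 (F : MP) (i j k) : th F i j k = th F j i k := by simp only [th, pderiv_comm j i]
lemma th_symm2 (F : MP) (i j k) : th F i j k = th F i k j := pderiv_comm _ _ _

section deg
variable {n u w y : Fin 3 → MP} {H : Fin 3 → Fin 3 → MP} {T : Fin 3 → Fin 3 → Fin 3 → MP} {a b c e : ℕ}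
lemma dmul {p q : MP} (hp : p.totalDegree ≤ a) (hq : q.totalDegree ≤ b) : (p * q).totalDegree ≤ a + b :=
  (MvPolynomial.totalDegree_mul _ _).trans (add_le_add hp hq)
lemma dadd {p q : MP} (hp : p.totalDegree ≤ a) (hq : q.totalDegree ≤ a) : (p + q).totalDegree ≤ a :=
  (MvPolynomial.totalDegree_add _ _).trans (max_le hp hq)
lemma dsub {p q : MP} (hp : p.totalDegree ≤ a) (hq : q.totalDegree ≤ a) : (p - q).totalDegree ≤ a :=
  (MvPolynomial.totalDegree_sub _ _).trans (max_le hp hq)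
lemma dq1 (hn : ∀ i, (n i).totalDegree ≤ a) (hu : ∀ i, (u i).totalDegree ≤ b) : (q1 n u).totalDegree ≤ a + b :=
  dadd (dadd (dmul (hn _) (hu _)) (dmul (hn _) (hu _))) (dmul (hn _) (hu _))
lemma dq2 (hH : ∀ i j, (H i j).totalDegree ≤ a) (hu : ∀ i, (u i).totalDegree ≤ b) (hw : ∀ i, (w i).totalDegree ≤ c) :
    (q2 H u w).totalDegree ≤ a + b + c :=
  MvPolynomial.totalDegree_finsetSum_le fun i _ => MvPolynomial.totalDegree_finsetSum_le fun j _ =>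
    dmul (dmul (hH _ _) (hu _)) (hw _)
lemma dq3 (hT : ∀ i j k, (T i j k).totalDegree ≤ a) (hu : ∀ i, (u i).totalDegree ≤ b) (hw : ∀ i, (w i).totalDegree ≤ c)
    (hy : ∀ i, (y i).totalDegree ≤ e) : (q3 T u w y).totalDegree ≤ a + b + c + e :=
  MvPolynomial.totalDegree_finsetSum_le fun i _ => MvPolynomial.totalDegree_finsetSum_le fun j _ =>
    MvPolynomial.totalDegree_finsetSum_le fun k _ => dmul (dmul (dmul (hT _ _ _) (hu _)) (hw _)) (hy _)
lemma dcr (hu : ∀ i, (u i).totalDegree ≤ a) (hw : ∀ i, (w i).totalDegree ≤ b) (i) : (cr u w i).totalDegree ≤ a + b := by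
  fin_cases i <;> exact dsub (dmul (hu _) (hw _)) (dmul (hu _) (hw _))
end deg

noncomputable def pA (v : V3) (F : MP) : MP := fA (cv v) (gr F) (he F)
noncomputable def pD (v : V3) (F : MP) : MP := Dl (cv v) (gr F) (he F)
noncomputable def pR1 (v : V3) (F : MP) : MP := R1 (cv v) (gr F) (he F) (th F)
noncomputable def pR2 (v : V3) (F : MP) : MP := R2 (cv v) (gr F) (he F) (th F)
noncomputable def gx (F : MP) (x : V3) (i : Fin 3) : ℝ := (gr F i).eval x
noncomputable def hx (F : MP) (x : V3) (i j : Fin 3) : ℝ := (he F i j).eval x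
noncomputable def tx (F : MP) (x : V3) (i j k : Fin 3) : ℝ := (th F i j k).eval x

lemma eval_pA (v F x) : (pA v F).eval x = fA v (gx F x) (hx F x) := by
  rw [pA, map_fA]; simp [cv]; rfl
lemma eval_pD (v F x) : (pD v F).eval x = Dl v (gx F x) (hx F x) := by
  rw [pD, map_Dl]; simp [cv]; rfl
lemma eval_pR1 (v F x) : (pR1 v F).eval x = R1 v (gx F x) (hx F x) (tx F x) := by
  rw [pR1, map_R1]; simp [cv]; rfl
lemma eval_pR2 (v F x) : (pR2 v F).eval x = R2 v (gx F x) (hx F x) (tx F x) := by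
  rw [pR2, map_R2]; simp [cv]; rfl

section degs
variable (v : V3) (F : MP)
lemma dv (i) : (cv v i).totalDegree ≤ 0 := by simp [cv]
lemma dgr (i) : (gr F i).totalDegree ≤ F.totalDegree := deg_pderiv _ _
lemma dhe (i j) : (he F i j).totalDegree ≤ F.totalDegree := (deg_pderiv _ _).trans (deg_pderiv _ _)
lemma dth (i j k) : (th F i j k).totalDegree ≤ F.totalDegree := (deg_pderiv _ _).trans ((deg_pderiv _ _).trans (deg_pderiv _ _))
lemma dE1 (i) : (E1 (cv v) (gr F) i).totalDegree ≤ F.totalDegree := (dcr (dv v) (dgr F) i).trans (by omega)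
lemma dE2 (i) : (E2 (cv v) (gr F) i).totalDegree ≤ 2 * F.totalDegree := (dcr (dgr F) (dE1 v F) i).trans (by omega)
lemma dA : (pA v F).totalDegree ≤ 3 * F.totalDegree := (dq2 (dhe F) (dE1 v F) (dE1 v F)).trans (by omega)
lemma dB : (fB (cv v) (gr F) (he F)).totalDegree ≤ 4 * F.totalDegree := (dq2 (dhe F) (dE1 v F) (dE2 v F)).trans (by omega)
lemma dC : (fC (cv v) (gr F) (he F)).totalDegree ≤ 5 * F.totalDegree := (dq2 (dhe F) (dE2 v F) (dE2 v F)).trans (by omega)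
lemma dk0 : (k0 (cv v) (gr F) (th F)).totalDegree ≤ 4 * F.totalDegree := (dq3 (dth F) (dE1 v F) (dE1 v F) (dE1 v F)).trans (by omega)
lemma dk1 : (k1 (cv v) (gr F) (th F)).totalDegree ≤ 5 * F.totalDegree := (dq3 (dth F) (dE1 v F) (dE1 v F) (dE2 v F)).trans (by omega)
lemma dk2 : (k2 (cv v) (gr F) (th F)).totalDegree ≤ 6 * F.totalDegree := (dq3 (dth F) (dE1 v F) (dE2 v F) (dE2 v F)).trans (by omega)
lemma dk3 : (k3 (cv v) (gr F) (th F)).totalDegree ≤ 7 * F.totalDegree := (dq3 (dth F) (dE2 v F) (dE2 v F) (dE2 v F)).trans (by omega)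
lemma dnum (k : ℕ) [k.AtLeastTwo] : (OfNat.ofNat k : MP).totalDegree ≤ 0 := by
  have : (OfNat.ofNat k : MP) = MvPolynomial.C (OfNat.ofNat k : ℝ) := (map_ofNat MvPolynomial.C k).symm
  rw [this]; simp
lemma dD : (pD v F).totalDegree ≤ 8 * F.totalDegree := by
  rw [pD, Dl, sq]
  exact dsub ((dmul (dB v F) (dB v F)).trans (by omega)) ((dmul (dA v F) (dC v F)).trans (by omega))
lemma dR1 : (pR1 v F).totalDegree ≤ 13 * F.totalDegree := by
  rw [pR1, R1, sq, sq]
  refine dadd (dsub (dsub ?_ ?_) ?_) ?_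
  · exact (dmul (dmul (dnum 3) (dk2 v F)) (dmul (dA v F) (dA v F))).trans (by omega)
  · exact (dmul (dmul (dC v F) (dA v F)) (dk0 v F)).trans (by omega)
  · exact (dmul (dmul (dmul (dnum 6) (dA v F)) (dB v F)) (dk1 v F)).trans (by omega)
  · exact (dmul (dmul (dnum 4) (dmul (dB v F) (dB v F))) (dk0 v F)).trans (by omega)
lemma dR2 : (pR2 v F).totalDegree ≤ 13 * F.totalDegree := by
  rw [pR2, R2, sq]
  refine dadd (dsub ?_ ?_) ?_
  · exact (dmul (dk3 v F) (dmul (dA v F) (dA v F))).trans (by omega)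
  · exact (dmul (dmul (dmul (dnum 3) (dA v F)) (dC v F)) (dk1 v F)).trans (by omega)
  · exact (dmul (dmul (dmul (dnum 2) (dB v F)) (dC v F)) (dk0 v F)).trans (by omega)
end degs

end NL
end GK

namespace GK
section NL
open Finset
open MvPolynomial (pderiv)

abbrev S6 := MvPolynomial (Fin 3 ⊕ Fin 3) ℝ
noncomputable def emb : MP →ₐ[ℝ] S6 := MvPolynomial.rename Sum.inl
noncomputable def uu (i : Fin 3) : S6 := MvPolynomial.X (Sum.inr i)
noncomputable def DD : Derivation ℝ S6 S6 := MvPolynomial.mkDerivation ℝ (Sum.elim uu 0)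
noncomputable def rho (x u : V3) : S6 →ₐ[ℝ] Polynomial ℝ := MvPolynomial.aeval (Sum.elim
  (fun i => Polynomial.C (x i) + Polynomial.C (u i) * Polynomial.X) (fun i => Polynomial.C (u i)))
noncomputable def es (x u : V3) : S6 →+* ℝ := MvPolynomial.eval (Sum.elim x u)

lemma DD_uu (i) : DD (uu i) = 0 := by simp [DD, uu]
lemma DD_emb (G : MP) : DD (emb G) = ∑ i, emb (pderiv i G) * uu i := by
  rw [chain]; simp [emb, DD]
lemma rho_DD (x u : V3) (f : S6) : Polynomial.derivative (rho x u f) = rho x u (DD f) := by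
  induction f using MvPolynomial.induction_on with
  | C a => simp [← MvPolynomial.algebraMap_eq]
  | add p q hp hq => simp [hp, hq]
  | mul_X p j hp =>
    simp only [map_mul, Derivation.leibniz, smul_eq_mul, map_add, Polynomial.derivative_mul, hp]
    rcases j with j | j <;> simp [rho, DD, uu] <;> ring
lemma rho_emb (x u : V3) (F : MP) : rho x u (emb F) = restr (x, u) F := by
  have : (rho x u).comp emb = restr (x, u) := by
    apply MvPolynomial.algHom_ext
    intro i; simp [rho, emb, restr]
  exact DFunLike.congr_fun this F
lemma rho_eval (x u : V3) (f : S6) : (rho x u f).eval 0 = es x u f := by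
  have : (Polynomial.evalRingHom 0).comp (rho x u : S6 →+* Polynomial ℝ) = es x u := by
    apply MvPolynomial.ringHom_ext
    · intro r; simp [rho, es]
    · rintro (i | i) <;> simp [rho, es]
  exact DFunLike.congr_fun this f
lemma es_emb (x u : V3) (F : MP) : es x u (emb F) = F.eval x := by
  simp [es, emb, MvPolynomial.eval_rename]
lemma es_uu (x u : V3) (i) : es x u (uu i) = u i := by simp [es, uu]

lemma stable (s : Set S6) (M : S6) (hs : ∀ g ∈ s, ∃ k, M ^ k * DD g ∈ Ideal.span s) (f : S6)
    (hf : ∃ k, M ^ k * f ∈ Ideal.span s) : ∃ k, M ^ k * DD f ∈ Ideal.span s := by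
  have mono : ∀ {k k' : ℕ} {g : S6}, M ^ k * g ∈ Ideal.span s → M ^ (k + k') * g ∈ Ideal.span s := by
    intro k k' g h
    have := (Ideal.span s).mul_mem_left (M ^ k') h
    convert this using 1; ring
  have h1 : ∀ g ∈ Ideal.span s, ∃ k, M ^ k * DD g ∈ Ideal.span s := by
    intro g hg
    induction hg using Submodule.span_induction with
    | mem x h => exact hs x h
    | zero => exact ⟨0, by simp⟩
    | add x y _ _ hx hy =>
      obtain ⟨k, hk⟩ := hx
      obtain ⟨k', hk'⟩ := hy
      refine ⟨k + k', ?_⟩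
      rw [map_add, mul_add]
      refine add_mem (mono hk) ?_
      rw [add_comm]; exact mono hk'
    | smul a x hx' hx =>
      obtain ⟨k, hk⟩ := hx
      refine ⟨k, ?_⟩
      have : M ^ k * DD (a • x) = a * (M ^ k * DD x) + (M ^ k * DD a) * x := by
        rw [smul_eq_mul, Derivation.leibniz]; simp only [smul_eq_mul]; ring
      rw [this]
      exact add_mem (Ideal.mul_mem_left _ _ hk) (Ideal.mul_mem_left _ _ hx')
  obtain ⟨k, hk⟩ := hf
  obtain ⟨K, hK⟩ := h1 _ hk
  refine ⟨K + 1 + k, ?_⟩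
  have : M ^ (K + 1 + k) * DD f = M * (M ^ K * DD (M ^ k * f)) - (k : S6) * M ^ K * DD M * (M ^ k * f) := by
    rw [Derivation.leibniz, Derivation.leibniz_pow]
    simp only [smul_eq_mul, nsmul_eq_mul]
    rcases k with _ | k
    · simp; ring
    · simp only [Nat.add_sub_cancel]; ring
  rw [this]
  exact sub_mem (Ideal.mul_mem_left _ _ hK) (Ideal.mul_mem_left _ _ hk)

lemma line_of_stable (s : Set S6) (M : S6) (hs : ∀ g ∈ s, ∃ k, M ^ k * DD g ∈ Ideal.span s) (F : MP)
    (hF : emb F ∈ s) (x u : V3) (hx : ∀ g ∈ s, es x u g = 0) (hM : es x u M ≠ 0) : restr (x, u) F = 0 := by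
  have h1 : ∀ n, ∃ k, M ^ k * (DD^[n] (emb F)) ∈ Ideal.span s := by
    intro n
    induction n with
    | zero => exact ⟨0, by simpa using Ideal.subset_span hF⟩
    | succ n ih => rw [Function.iterate_succ_apply']; exact stable s M hs _ ih
  have h2 : ∀ n, es x u (DD^[n] (emb F)) = 0 := by
    intro n
    obtain ⟨k, hk⟩ := h1 n
    have : Ideal.span s ≤ RingHom.ker (es x u) := Ideal.span_le.2 hx
    have := this hk
    rw [RingHom.mem_ker, map_mul, map_pow] at this
    exact (mul_eq_zero.1 this).resolve_left (pow_ne_zero _ hM)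
  have h3 : ∀ n, Polynomial.derivative^[n] (restr (x, u) F) = rho x u (DD^[n] (emb F)) := by
    intro n
    induction n with
    | zero => simp [rho_emb]
    | succ n ih => rw [Function.iterate_succ_apply', Function.iterate_succ_apply', ih, rho_DD]
  ext n
  have h4 := h2 n
  rw [← rho_eval, ← h3, ← Polynomial.coeff_zero_eq_eval_zero, Polynomial.coeff_iterate_derivative] at h4
  simpa [Nat.descFactorial_self, Nat.factorial_ne_zero] using h4

lemma DD_q0 (F : MP) : DD (emb F) = q1 (fun i => emb (gr F i)) uu := by
  rw [DD_emb]; simp [q1, Fin.sum_univ_three, gr]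
lemma DD_q1 (F : MP) : DD (q1 (fun i => emb (gr F i)) uu) = q2 (fun i j => emb (he F i j)) uu uu := by
  simp only [q1, q2, map_add, Derivation.leibniz, DD_uu, DD_emb, smul_eq_mul, Fin.sum_univ_three, gr, he]
  ring
lemma DD_q2 (F : MP) : DD (q2 (fun i j => emb (he F i j)) uu uu) = q3 (fun i j k => emb (th F i j k)) uu uu uu := by
  simp only [q2, q3, map_add, Derivation.leibniz, DD_uu, DD_emb, smul_eq_mul, Fin.sum_univ_three, he, th]
  ring

lemma es_q1 (x u : V3) (F : MP) : es x u (q1 (fun i => emb (gr F i)) uu) = q1 (gx F x) u := by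
  rw [map_q1]; simp only [es_emb, es_uu]; rfl
lemma es_q2 (x u : V3) (F : MP) : es x u (q2 (fun i j => emb (he F i j)) uu uu) = q2 (hx F x) u u := by
  rw [map_q2]; simp only [es_emb, es_uu]; rfl
lemma es_q3 (x u : V3) (F : MP) : es x u (q3 (fun i j k => emb (th F i j k)) uu uu uu) = q3 (tx F x) u u u := by
  rw [map_q3]; simp only [es_emb, es_uu]; rfl

/-- derivatives vanish along lines -/
lemma line_null {x u : V3} {F : MP} (h : restr (x, u) F = 0) :
    F.eval x = 0 ∧ q1 (gx F x) u = 0 ∧ q2 (hx F x) u u = 0 ∧ q3 (tx F x) u u u = 0 := by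
  have h0 : rho x u (emb F) = 0 := by rw [rho_emb, h]
  have h1 := rho_DD x u (emb F)
  rw [h0, DD_q0, Polynomial.derivative_zero] at h1
  have h2 := rho_DD x u (q1 (fun i => emb (gr F i)) uu)
  rw [← h1, DD_q1, Polynomial.derivative_zero] at h2
  have h3 := rho_DD x u (q2 (fun i j => emb (he F i j)) uu uu)
  rw [← h2, DD_q2, Polynomial.derivative_zero] at h3
  refine ⟨?_, ?_, ?_, ?_⟩
  · rw [← es_emb x u, ← rho_eval, h0, Polynomial.eval_zero]
  · rw [← es_q1, ← rho_eval, ← h1, Polynomial.eval_zero]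
  · rw [← es_q2, ← rho_eval, ← h2, Polynomial.eval_zero]
  · rw [← es_q3, ← rho_eval, ← h3, Polynomial.eval_zero]

lemma null_line {v : V3} {F : MP} (h1 : F ∣ pR1 v F) (h2 : F ∣ pR2 v F) {x u : V3} (hx0 : F.eval x = 0)
    (hA : (pA v F).eval x ≠ 0) (hM : M1 v (gx F x) ≠ 0) (hu1 : q1 (gx F x) u = 0) (hu2 : q2 (hx F x) u u = 0) :
    restr (x, u) F = 0 := by
  set n : Fin 3 → S6 := fun i => emb (gr F i) with hn
  set H : Fin 3 → Fin 3 → S6 := fun i j => emb (he F i j) with hH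
  set T : Fin 3 → Fin 3 → Fin 3 → S6 := fun i j k => emb (th F i j k) with hT
  set s : Set S6 := {emb F, q1 n uu, q2 H uu uu} with hs
  set V : Fin 3 → S6 := fun i => emb (cv v i) with hV
  refine line_of_stable s (emb (pA v F) * M1 V n) ?_ F (by simp [hs]) x u ?_ ?_
  · have m0 : emb F ∈ Ideal.span s := Ideal.subset_span (by simp [hs])
    have m1 : q1 n uu ∈ Ideal.span s := Ideal.subset_span (by simp [hs])
    have m2 : q2 H uu uu ∈ Ideal.span s := Ideal.subset_span (by simp [hs])
    rintro g (rfl | rfl | rfl)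
    · exact ⟨0, by rw [DD_q0, pow_zero, one_mul]; exact m1⟩
    · exact ⟨0, by rw [DD_q1, pow_zero, one_mul]; exact m2⟩
    · refine ⟨3, ?_⟩
      rw [DD_q2]
      set π := Ideal.Quotient.mk (Ideal.span s) with hπ
      have z : ∀ {G : MP}, F ∣ G → π (emb G) = 0 := by
        rintro _ ⟨g, rfl⟩
        rw [Ideal.Quotient.eq_zero_iff_mem, map_mul]
        exact Ideal.mul_mem_right _ _ m0
      have e1 := Ideal.Quotient.eq_zero_iff_mem.2 m1
      have e2 := Ideal.Quotient.eq_zero_iff_mem.2 m2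
      have r1 := z h1
      have r2 := z h2
      rw [← hπ, map_q1] at e1
      rw [← hπ, map_q2] at e2
      have a0 : emb (pA v F) = fA V n H := map_fA (emb : MP →+* S6) _ _ _
      have a1 : emb (pR1 v F) = R1 V n H T := map_R1 (emb : MP →+* S6) _ _ _ _
      have a2 : emb (pR2 v F) = R2 V n H T := map_R2 (emb : MP →+* S6) _ _ _ _
      rw [a1, map_R1] at r1
      rw [a2, map_R2] at r2
      have := master (v := fun i => π (V i)) (T := fun i j k => π (T i j k)) (fun i j => by simp only [hH, he_symm F i j]) (fun i j k => by simp only [hT, th_symm1 F i j k])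
        (fun i j k => by simp only [hT, th_symm2 F i j k]) e1 e2
      rw [r1, r2] at this
      rw [← Ideal.Quotient.eq_zero_iff_mem, ← hπ, a0, map_mul, map_pow, map_mul, map_fA, map_M1, map_q3]
      linear_combination fA (fun i => π (V i)) (fun i => π (n i)) (fun i j => π (H i j)) * this
  · rintro g (rfl | rfl | rfl)
    · rw [es_emb, hx0]
    · rw [es_q1, hu1]
    · rw [es_q2, hu2]
  · rw [map_mul, es_emb, map_M1]
    refine mul_ne_zero hA ?_
    simp only [hV, hn, es_emb]
    simp only [cv, MvPolynomial.eval_C]; exact hM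

lemma cross_alg {A B C c0 c1 c2 c3 s t s' t' : ℝ} (e2 : A * s ^ 2 + 2 * B * s * t + C * t ^ 2 = 0)
    (e3 : c0 * s ^ 3 + 3 * c1 * s ^ 2 * t + 3 * c2 * s * t ^ 2 + c3 * t ^ 3 = 0)
    (e2' : A * s' ^ 2 + 2 * B * s' * t' + C * t' ^ 2 = 0)
    (e3' : c0 * s' ^ 3 + 3 * c1 * s' ^ 2 * t' + 3 * c2 * s' * t' ^ 2 + c3 * t' ^ 3 = 0) (hdet : s * t' - s' * t ≠ 0) :
    3 * c2 * A ^ 2 - C * A * c0 - 6 * A * B * c1 + 4 * B ^ 2 * c0 = 0 ∧ c3 * A ^ 2 - 3 * A * C * c1 + 2 * B * C * c0 = 0 ∧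
    (A ≠ 0 → B ^ 2 - A * C ≠ 0) := by
  have Z : ∀ {s t : ℝ}, A * s ^ 2 + 2 * B * s * t + C * t ^ 2 = 0 →
      c0 * s ^ 3 + 3 * c1 * s ^ 2 * t + 3 * c2 * s * t ^ 2 + c3 * t ^ 3 = 0 → t = 0 → s ≠ 0 → A = 0 ∧ c0 = 0 := by
    rintro s t h2 h3 rfl hs
    constructor
    · have : A * s ^ 2 = 0 := by linarith
      exact (mul_eq_zero.1 this).resolve_right (pow_ne_zero _ hs)
    · have : c0 * s ^ 3 = 0 := by linarith
      exact (mul_eq_zero.1 this).resolve_right (pow_ne_zero _ hs)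
  by_cases ht : t = 0
  · obtain ⟨rfl, rfl⟩ := Z e2 e3 ht (by rintro rfl; apply hdet; rw [ht]; ring)
    simp
  by_cases ht' : t' = 0
  · obtain ⟨rfl, rfl⟩ := Z e2' e3' ht' (by rintro rfl; apply hdet; rw [ht']; ring)
    simp
  have L : ∀ {s t : ℝ}, A * s ^ 2 + 2 * B * s * t + C * t ^ 2 = 0 →
      c0 * s ^ 3 + 3 * c1 * s ^ 2 * t + 3 * c2 * s * t ^ 2 + c3 * t ^ 3 = 0 → t ≠ 0 →
      s * (3 * c2 * A ^ 2 - C * A * c0 - 6 * A * B * c1 + 4 * B ^ 2 * c0) + t * (c3 * A ^ 2 - 3 * A * C * c1 + 2 * B * C * c0) = 0 := by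
    intro s t h2 h3 ht
    have : t ^ 2 * (s * (3 * c2 * A ^ 2 - C * A * c0 - 6 * A * B * c1 + 4 * B ^ 2 * c0) + t * (c3 * A ^ 2 - 3 * A * C * c1 + 2 * B * C * c0)) = 0 := by
      linear_combination A ^ 2 * h3 - (A * c0 * s + (3 * A * c1 - 2 * B * c0) * t) * h2
    exact (mul_eq_zero.1 this).resolve_left (pow_ne_zero _ ht)
  have l1 := L e2 e3 ht
  have l2 := L e2' e3' ht'
  generalize 3 * c2 * A ^ 2 - C * A * c0 - 6 * A * B * c1 + 4 * B ^ 2 * c0 = P at *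
  generalize c3 * A ^ 2 - 3 * A * C * c1 + 2 * B * C * c0 = Q at *
  refine ⟨?_, ?_, ?_⟩
  · refine (mul_eq_zero.1 ?_).resolve_left hdet
    linear_combination t' * l1 - t * l2
  · refine (mul_eq_zero.1 ?_).resolve_left hdet
    linear_combination s * l2 - s' * l1
  · intro hA hD
    have g1 : (A * s + B * t) ^ 2 = 0 := by linear_combination A * e2 + t ^ 2 * hD
    have g2 : (A * s' + B * t') ^ 2 = 0 := by linear_combination A * e2' + t' ^ 2 * hD
    have g1 := pow_eq_zero_iff (two_ne_zero) |>.1 g1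
    have g2 := pow_eq_zero_iff (two_ne_zero) |>.1 g2
    apply hdet
    refine (mul_eq_zero.1 ?_).resolve_left hA
    linear_combination t' * g1 - t * g2

set_option maxHeartbeats 1000000 in
lemma cross_R (v : V3) {F : MP} {x d d' : V3} (h : restr (x, d) F = 0) (h' : restr (x, d') F = 0) (hdd : cr d d' ≠ 0) :
    (pR1 v F).eval x = 0 ∧ (pR2 v F).eval x = 0 ∧ ((pA v F).eval x ≠ 0 → (pD v F).eval x ≠ 0) := by
  obtain ⟨-, n1, n2, n3⟩ := line_null h
  obtain ⟨-, n1', n2', n3'⟩ := line_null h'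
  rw [eval_pR1, eval_pR2, eval_pA, eval_pD]
  have hH : ∀ i j, hx F x i j = hx F x j i := fun i j => by simp only [hx, he_symm F i j]
  have hT1 : ∀ i j k, tx F x i j k = tx F x j i k := fun i j k => by simp only [tx, th_symm1 F i j k]
  have hT2 : ∀ i j k, tx F x i j k = tx F x i k j := fun i j k => by simp only [tx, th_symm2 F i j k]
  have f := frame v _ d n1
  have f' := frame v _ d' n1'
  generalize gx F x = n at *
  generalize hx F x = H at *
  generalize tx F x = T at *
  have e2 := q2_smul H (M1 v n) d
  have e3 := q3_smul T (M1 v n) d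
  rw [f, q2_comb hH, n2] at e2
  rw [f, q3_comb hT1 hT2, n3] at e3
  have e2' := q2_smul H (M1 v n) d'
  have e3' := q3_smul T (M1 v n) d'
  rw [f', q2_comb hH, n2'] at e2'
  rw [f', q3_comb hT1 hT2, n3'] at e3'
  by_cases hM : M1 v n = 0
  · have : E1 v n = 0 ∨ n = 0 := by
      have z : ∀ w : V3, q1 w w = 0 → w = 0 := by
        intro w hw
        simp only [q1] at hw
        funext i; fin_cases i <;> simp <;> nlinarith [sq_nonneg (w 0), sq_nonneg (w 1), sq_nonneg (w 2)]
      exact (mul_eq_zero.1 hM).imp (z _) (z _)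
    have e1 : E1 v n = 0 := by
      rcases this with h | h
      · exact h
      · rw [h]; funext i; fin_cases i <;> simp [E1]
    simp [R1, R2, fA, fB, k0, k1, k2, k3, e1, q2, q3]
  have hdet : q1 d (E1 v n) * q1 n n * q1 d' (E2 v n) - q1 d' (E1 v n) * q1 n n * q1 d (E2 v n) ≠ 0 := by
    intro h0
    apply hdd
    have : M1 v n ^ 2 • cr d d' = cr (M1 v n • d) (M1 v n • d') := by
      funext i; fin_cases i <;> simp <;> ring
    rw [f, f'] at this
    generalize q1 d (E1 v n) * q1 n n = s at *
    generalize q1 d (E2 v n) = t at *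
    generalize q1 d' (E1 v n) * q1 n n = s' at *
    generalize q1 d' (E2 v n) = t' at *
    have h3 : cr (s • E1 v n + t • E2 v n) (s' • E1 v n + t' • E2 v n) = (s * t' - s' * t) • cr (E1 v n) (E2 v n) := by
      funext i; fin_cases i <;> simp <;> ring
    rw [h3, h0, zero_smul] at this
    exact (smul_eq_zero.1 this).resolve_left (pow_ne_zero _ hM)
  exact cross_alg (e2.trans (mul_zero _)) (e3.trans (mul_zero _)) (e2'.trans (mul_zero _)) (e3'.trans (mul_zero _)) hdet

end NL
end GK

namespace GK
section FLs
open Finset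
open MvPolynomial (pderiv)

lemma not_dvd_of_deg {F G : MP} (hG : G ≠ 0) (h : G.totalDegree < F.totalDegree) : ¬ F ∣ G := by
  rintro ⟨K, rfl⟩
  have hF : F ≠ 0 := left_ne_zero_of_mul hG
  have hK : K ≠ 0 := right_ne_zero_of_mul hG
  rw [MvPolynomial.totalDegree_mul_of_isDomain hF hK] at h
  omega

lemma dvd_of_inf {F G : MP} (hF : Irreducible F) (s : Set ℝ) (hs : s.Infinite) (f : ℝ → Ln) (hd : ∀ t ∈ s, (f t).2 ≠ 0)
    (hp : ∀ t ∈ s, ∀ t' ∈ s, t ≠ t' → ∀ x y, On x (f t) → On x (f t') → On y (f t) → On y (f t') → x = y)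
    (hZ : ∀ t ∈ s, restr (f t) F = 0 ∧ restr (f t) G = 0) : F ∣ G := by
  classical
  by_contra hFG
  obtain ⟨T, hT, hc⟩ := hs.exists_subset_card_eq (6 * F.totalDegree * G.totalDegree + 1)
  have inj : Set.InjOn f (T : Set ℝ) := by
    intro t ht t' ht' h
    by_contra hne
    have := hp t (hT ht) t' (hT ht') hne (pt (f t) 0) (pt (f t) 1) ⟨0, rfl⟩ (h ▸ ⟨0, rfl⟩) ⟨1, rfl⟩ (h ▸ ⟨1, rfl⟩)
    have := pt_inj (hd t (hT ht)) this
    norm_num at this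
  have := bezout_lines F G hF hFG (T.image f) ⟨?_, ?_⟩ ?_
  · rw [card_image_of_injOn inj] at this; omega
  · intro l hl; obtain ⟨t, ht, rfl⟩ := mem_image.1 hl; exact hd t (hT ht)
  · intro l hl l' hl' hne; obtain ⟨t, ht, rfl⟩ := mem_image.1 hl
    obtain ⟨t', ht', rfl⟩ := mem_image.1 hl'
    exact hp t (hT ht) t' (hT ht') (by rintro rfl; exact hne rfl)
  · intro l hl; obtain ⟨t, ht, rfl⟩ := mem_image.1 hl; exact hZ t (hT ht)

lemma q1_self {w : V3} (hw : q1 w w = 0) : w = 0 := by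
  simp only [q1] at hw
  funext i; fin_cases i <;> simp <;> nlinarith [sq_nonneg (w 0), sq_nonneg (w 1), sq_nonneg (w 2)]

lemma eval_lin' (p w x : V3) : (lin p w).eval x = q1 (x - p) w := by
  rw [eval_lin]; simp [q1, Fin.sum_univ_three]

lemma lin_ne {w : V3} (hw : w ≠ 0) (p : V3) : lin p w ≠ 0 := by
  intro h
  have := eval_lin' p w (p + w)
  rw [h, map_zero, add_sub_cancel_left] at this
  exact hw (q1_self this.symm)

lemma cross_pair {p d o o' : V3} {t t' : ℝ} (hne : t ≠ t') (h' : cr d o' ≠ 0) {x y : V3}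
    (h1 : On x (pt (p, d) t, o)) (h2 : On x (pt (p, d) t', o')) (h3 : On y (pt (p, d) t, o)) (h4 : On y (pt (p, d) t', o')) :
    x = y := by
  obtain ⟨α, rfl⟩ := h1
  obtain ⟨β, e1⟩ := h2
  obtain ⟨α', rfl⟩ := h3
  obtain ⟨β', e2⟩ := h4
  by_cases hα : α = α'
  · rw [hα]
  exfalso
  simp only [pt] at e1 e2
  have E := fun i => congrFun e1 i
  have E' := fun i => congrFun e2 i
  simp at E E'
  have hc : cr o o' = 0 := by
    have : (α - α') • cr o o' = 0 := by
      funext i; fin_cases i <;> simp [-mul_eq_zero]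
      · linear_combination (E 1 - E' 1) * o' 2 - (E 2 - E' 2) * o' 1
      · linear_combination (E 2 - E' 2) * o' 0 - (E 0 - E' 0) * o' 2
      · linear_combination (E 0 - E' 0) * o' 1 - (E 1 - E' 1) * o' 0
    exact (smul_eq_zero.1 this).resolve_left (sub_ne_zero.2 hα)
  apply h'
  have : (t - t') • cr d o' = 0 := by
    have c0 := congrFun hc 0
    have c1 := congrFun hc 1
    have c2 := congrFun hc 2
    simp at c0 c1 c2
    funext i; fin_cases i <;> simp [-mul_eq_zero]
    · linear_combination (E 1) * o' 2 - (E 2) * o' 1 - α * c0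
    · linear_combination (E 2) * o' 0 - (E 0) * o' 2 - α * c1
    · linear_combination (E 0) * o' 1 - (E 1) * o' 0 - α * c2
  exact (smul_eq_zero.1 this).resolve_left (sub_ne_zero.2 hne)

lemma meet {u o z : V3} (h : cr u o ≠ 0) (h2 : q1 u (cr z o) = 0) : ∃ α β : ℝ, z = α • u + β • o := by
  have hN : q1 (cr u o) (cr u o) ≠ 0 := fun h0 => h (q1_self h0)
  set N := cr u o with hNdef
  refine ⟨q1 z (cr o N) / q1 N N, q1 z (cr N u) / q1 N N, ?_⟩
  have key : q1 N N • z = q1 z (cr o N) • u + q1 z (cr N u) • o := by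
    simp only [q1, hNdef] at h2 ⊢
    funext i
    fin_cases i <;> simp at h2 ⊢
    · linear_combination (-(u 1 * o 2 - u 2 * o 1)) * h2
    · linear_combination (-(u 2 * o 0 - u 0 * o 2)) * h2
    · linear_combination (-(u 0 * o 1 - u 1 * o 0)) * h2
  have : z = (q1 N N)⁻¹ • (q1 N N • z) := by rw [smul_smul, inv_mul_cancel₀ hN, one_smul]
  rw [key, smul_add, smul_smul, smul_smul] at this
  rw [div_eq_inv_mul, div_eq_inv_mul]; exact this

lemma quadric (f : Fin 3 × Fin 3 → V3) : ∃ Q : MP, Q ≠ 0 ∧ Q.totalDegree ≤ 2 ∧ ∀ i, Q.eval (f i) = 0 := by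
  let m : V3 → Fin 10 → ℝ := fun x => ![1, x 0, x 1, x 2, x 0 * x 0, x 1 * x 1, x 2 * x 2, x 0 * x 1, x 0 * x 2, x 1 * x 2]
  let φ : (Fin 10 → ℝ) →ₗ[ℝ] (Fin 3 × Fin 3 → ℝ) := Matrix.mulVecLin (Matrix.of fun i j => m (f i) j)
  obtain ⟨c, hc, hc0⟩ := Submodule.exists_mem_ne_zero_of_ne_bot (LinearMap.ker_ne_bot_of_finrank_lt (f := φ) (by simp))
  let X : Fin 3 → MP := MvPolynomial.X
  let Q : MP := ∑ k, MvPolynomial.C (c k) * (![1, X 0, X 1, X 2, X 0 * X 0, X 1 * X 1, X 2 * X 2, X 0 * X 1, X 0 * X 2, X 1 * X 2] : Fin 10 → MP) k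
  have hev : ∀ x, Q.eval x = ∑ k, c k * m x k := by
    intro x
    simp only [Q, map_sum, map_mul, MvPolynomial.eval_C]
    refine sum_congr rfl fun k _ => ?_
    congr 1
    fin_cases k <;> simp [m, X]
  refine ⟨Q, ?_, ?_, ?_⟩
  · intro h0
    apply hc0
    have E : ∀ x, ∑ k, c k * m x k = 0 := fun x => by rw [← hev, h0, map_zero]
    have e0 := E ![0,0,0]
    have e1 := E ![1,0,0]
    have e1' := E ![-1,0,0]
    have e2 := E ![0,1,0]
    have e2' := E ![0,-1,0]
    have e3 := E ![0,0,1]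
    have e3' := E ![0,0,-1]
    have e4 := E ![1,1,0]
    have e5 := E ![1,0,1]
    have e6 := E ![0,1,1]
    simp [Fin.sum_univ_succ, m] at e0 e1 e1' e2 e2' e3 e3' e4 e5 e6
    funext k
    fin_cases k <;> simp <;> linarith
  · refine MvPolynomial.totalDegree_finsetSum_le fun k _ => ?_
    refine (dmul (a := 0) (b := 2) (by simp) ?_).trans (by norm_num)
    fin_cases k <;> simp [X] <;> exact (MvPolynomial.totalDegree_mul _ _).trans (by simp)
  · intro i
    rw [hev]
    have := congrFun (LinearMap.mem_ker.1 hc) i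
    simp [φ, Matrix.mulVec, dotProduct] at this
    rw [← this]
    exact sum_congr rfl fun k _ => mul_comm _ _

lemma quadric_lines (l : Fin 3 → Ln) (hl : ∀ i, (l i).2 ≠ 0) : ∃ Q : MP, Q ≠ 0 ∧ Q.totalDegree ≤ 2 ∧ ∀ i, restr (l i) Q = 0 := by
  classical
  obtain ⟨Q, h0, h2, h⟩ := quadric (fun k => pt (l k.1) (k.2 : ℕ))
  refine ⟨Q, h0, h2, fun i => restr_zero_of_card (univ.image fun j : Fin 3 => pt (l i) (j : ℕ)) ?_ ?_⟩
  · intro x hx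
    obtain ⟨j, -, rfl⟩ := mem_image.1 hx
    refine ⟨⟨_, rfl⟩, ?_⟩
    have := h (i, j)
    simpa using this
  · rw [card_image_of_injective]
    · simp; omega
    · intro j j' h
      have := pt_inj (hl i) h
      exact Fin.ext (by exact_mod_cast this)

lemma rebase {l : Ln} {F : MP} {x : V3} (hx : On x l) (h : restr l F = 0) : restr (x, l.2) F = 0 := by
  rw [restr_zero_iff] at h ⊢
  rintro _ ⟨t, rfl⟩
  obtain ⟨s, rfl⟩ := hx
  exact h _ ⟨s + t, by simp [pt]; module⟩

end FLs
end GK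

namespace GK
section FL2
open Finset
open MvPolynomial (pderiv)

lemma hx_symm (F : MP) (x : V3) : ∀ i j, hx F x i j = hx F x j i := fun i j => by simp only [hx, he_symm F i j]

lemma fA_ne {v n : V3} {H : Fin 3 → Fin 3 → ℝ} (h : fA v n H ≠ 0) : E1 v n ≠ 0 ∧ n ≠ 0 ∧ M1 v n ≠ 0 := by
  have h1 : E1 v n ≠ 0 := by
    intro h0; apply h; simp [fA, h0, q2]
  have h2 : n ≠ 0 := by
    rintro rfl; apply h1; funext i; fin_cases i <;> simp [E1]
  exact ⟨h1, h2, mul_ne_zero (fun h => h1 (q1_self h)) (fun h => h2 (q1_self h))⟩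

lemma cr_comb (e f : V3) (s t s' t' : ℝ) : cr (s • e + t • f) (s' • e + t' • f) = (s * t' - s' * t) • cr e f := by
  funext i; fin_cases i <;> simp <;> ring

lemma cr_smul2 (c : ℝ) (d d' : V3) : cr (c • d) (c • d') = c ^ 2 • cr d d' := by
  funext i; fin_cases i <;> simp <;> ring

lemma two_dir {v n : V3} {H : Fin 3 → Fin 3 → ℝ} (hH : ∀ i j, H i j = H j i) (hA : fA v n H ≠ 0) (hD : Dl v n H ≠ 0)
    {d : V3} (hd : d ≠ 0) (h1 : q1 n d = 0) (h2 : q2 H d d = 0) : ∃ d', cr d d' ≠ 0 ∧ q1 n d' = 0 ∧ q2 H d' d' = 0 := by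
  obtain ⟨he, hn, hM⟩ := fA_ne hA
  have f := frame v n d h1
  have e2 := q2_smul H (M1 v n) d
  rw [f, q2_comb hH, h2, mul_zero] at e2
  set s := q1 d (E1 v n) * q1 n n
  set t := q1 d (E2 v n)
  have ht : t ≠ 0 := by
    intro ht
    rw [ht] at e2 f
    have : fA v n H * s ^ 2 = 0 := by rw [fA]; linarith
    have hs : s = 0 := by simpa [hA] using this
    rw [hs] at f
    simp at f
    exact f.elim hM hd
  refine ⟨(-2 * fB v n H * t - fA v n H * s) • E1 v n + (fA v n H * t) • E2 v n, ?_, ?_, ?_⟩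
  · intro h0
    have : cr (M1 v n • d) (M1 v n • ((-2 * fB v n H * t - fA v n H * s) • E1 v n + (fA v n H * t) • E2 v n)) = 0 := by
      rw [cr_smul2, h0, smul_zero]
    rw [f, smul_add, smul_smul, smul_smul, cr_comb] at this
    have c : cr (E1 v n) (E2 v n) ≠ 0 := by
      have : cr (E1 v n) (E2 v n) = q1 (E1 v n) (E1 v n) • n := by
        funext i; fin_cases i <;> simp [E1, E2, q1] <;> ring
      rw [this]
      exact smul_ne_zero (fun h => he (q1_self h)) hn
    have h3 := (smul_eq_zero.1 this).resolve_right c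
    have h4 : (2 * M1 v n * t) * (fA v n H * s + fB v n H * t) = 0 := by linear_combination h3
    have h5 := (mul_eq_zero.1 h4).resolve_left (by positivity)
    have h6 : Dl v n H * t ^ 2 = 0 := by
      rw [Dl]
      change fA v n H * s ^ 2 + 2 * fB v n H * s * t + fC v n H * t ^ 2 = 0 at e2
      linear_combination (fA v n H * s + fB v n H * t) * h5 - fA v n H * e2
    exact (mul_ne_zero hD (pow_ne_zero _ ht)) h6
  · simp [q1, E1, E2]; ring
  · rw [q2_comb hH]
    change fA v n H * s ^ 2 + 2 * fB v n H * s * t + fC v n H * t ^ 2 = 0 at e2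
    change fA v n H * _ ^ 2 + 2 * fB v n H * _ * _ + fC v n H * _ ^ 2 = 0
    linear_combination (fA v n H) ^ 2 * e2

lemma only_two {v n : V3} {H : Fin 3 → Fin 3 → ℝ} (hH : ∀ i j, H i j = H j i) (hA : fA v n H ≠ 0)
    {d d' w : V3} (hdd : cr d d' ≠ 0) (h1 : q1 n d = 0) (h2 : q2 H d d = 0) (h1' : q1 n d' = 0) (h2' : q2 H d' d' = 0)
    (hw1 : q1 n w = 0) (hw2 : q2 H w w = 0) : cr w d = 0 ∨ cr w d' = 0 := by
  obtain ⟨he, hn, hM⟩ := fA_ne hA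
  have key : ∀ u, q1 n u = 0 → q2 H u u = 0 → ∃ s t, M1 v n • u = s • E1 v n + t • E2 v n ∧
      fA v n H * s ^ 2 + 2 * fB v n H * s * t + fC v n H * t ^ 2 = 0 := by
    intro u h1 h2
    have f := frame v n u h1
    have e2 := q2_smul H (M1 v n) u
    rw [f, q2_comb hH, h2, mul_zero] at e2
    exact ⟨_, _, f, e2⟩
  have key2 : ∀ {u u' : V3} {s t s' t' : ℝ}, M1 v n • u = s • E1 v n + t • E2 v n → M1 v n • u' = s' • E1 v n + t' • E2 v n →
      s * t' - s' * t = 0 → cr u u' = 0 := by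
    intro u u' s t s' t' hu hu' h0
    have := cr_smul2 (M1 v n) u u'
    rw [hu, hu', cr_comb, h0, zero_smul] at this
    exact (smul_eq_zero.1 this.symm).resolve_left (pow_ne_zero _ hM)
  obtain ⟨s, t, f, e⟩ := key d h1 h2
  obtain ⟨s', t', f', e'⟩ := key d' h1' h2'
  obtain ⟨r, q, g, k⟩ := key w hw1 hw2
  have hdet : s * t' - s' * t ≠ 0 := fun h => hdd (key2 f f' h)
  have : fA v n H * (s * t' - s' * t) * ((r * t - s * q) * (r * t' - s' * q)) = 0 := by
    generalize fA v n H = A at *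
    generalize fB v n H = B at *
    generalize fC v n H = C at *
    linear_combination (t ^ 2 * q * r) * e' * 0 + (s * t' - s' * t) * t * t' * k + (q^2 * t' * s' - q * t'^2 * r) * e - (q ^ 2 * t * s - q * t^2 * r) * e'
  rcases mul_eq_zero.1 ((mul_eq_zero.1 this).resolve_left (mul_ne_zero hA hdet)) with h | h
  · exact Or.inl (key2 g f h)
  · exact Or.inr (key2 g f' h)

end FL2
end GK

namespace GK
section FL3
open Finset
open MvPolynomial (pderiv)

noncomputable def pW (p d : V3) (F : MP) : Fin 3 → MP := cr (gr F) (cr (fun i => MvPolynomial.X i - MvPolynomial.C (p i)) (cv d))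
noncomputable def pG (p d : V3) (F : MP) : MP := q2 (he F) (pW p d F) (pW p d F)
lemma eval_pG (p d x : V3) (F : MP) : (pG p d F).eval x =
    q2 (hx F x) (cr (gx F x) (cr (x - p) d)) (cr (gx F x) (cr (x - p) d)) := by
  rw [pG, map_q2]
  simp only [pW]
  rw [map_cr, map_cr]
  simp only [cv, map_sub, MvPolynomial.eval_X, MvPolynomial.eval_C]; rfl

structure Ctx (F : MP) (v : V3) : Prop where
  irr : Irreducible F
  deg : 3 ≤ F.totalDegree
  r1 : F ∣ pR1 v F
  r2 : F ∣ pR2 v F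

def Good (F : MP) (v x : V3) : Prop := F.eval x = 0 ∧ (pA v F * pD v F).eval x ≠ 0
def Nice (F : MP) (v : V3) (l : Ln) : Prop := l.2 ≠ 0 ∧ restr l F = 0 ∧ restr l (pA v F * pD v F) ≠ 0

variable {F : MP} {v : V3}

lemma Good.A {x : V3} (h : Good F v x) : fA v (gx F x) (hx F x) ≠ 0 := by
  have := h.2; rw [map_mul, eval_pA] at this; exact left_ne_zero_of_mul this
lemma Good.D {x : V3} (h : Good F v x) : Dl v (gx F x) (hx F x) ≠ 0 := by
  have := h.2; rw [map_mul, eval_pD] at this; exact right_ne_zero_of_mul this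

lemma cr_ne_right {d d' : V3} (h : cr d d' ≠ 0) : d' ≠ 0 := by
  rintro rfl; apply h; funext i; fin_cases i <;> simp
lemma cr_ne_left {d d' : V3} (h : cr d d' ≠ 0) : d ≠ 0 := by
  rintro rfl; apply h; funext i; fin_cases i <;> simp

lemma Good.other (c : Ctx F v) {x d : V3} (h : Good F v x) (hd : d ≠ 0) (hl : restr (x, d) F = 0) :
    ∃ d', cr d d' ≠ 0 ∧ restr (x, d') F = 0 := by
  obtain ⟨-, n1, n2, -⟩ := line_null hl
  obtain ⟨d', h1, h2, h3⟩ := two_dir (hx_symm F x) h.A h.D hd n1 n2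
  refine ⟨d', h1, null_line c.r1 c.r2 h.1 ?_ (fA_ne h.A).2.2 h2 h3⟩
  rw [eval_pA]; exact h.A

lemma Good.nice {x d : V3} (h : Good F v x) (hd : d ≠ 0) (hl : restr (x, d) F = 0) : Nice F v (x, d) := by
  refine ⟨hd, hl, fun h0 => h.2 ?_⟩
  rw [restr_zero_iff] at h0
  exact h0 x ⟨0, by simp [pt]⟩

lemma Nice.inf {l : Ln} (h : Nice F v l) : {t | Good F v (pt l t)}.Infinite := by
  have : {t | Good F v (pt l t)} = {t | (restr l (pA v F * pD v F)).IsRoot t}ᶜ := by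
    ext t
    simp only [Set.mem_setOf_eq, Good, Set.mem_compl_iff, Polynomial.IsRoot, eval_restr]
    exact and_iff_right ((restr_zero_iff.1 h.2.1) _ ⟨t, rfl⟩)
  rw [this]
  exact (Polynomial.finite_setOf_isRoot h.2.2).infinite_compl

lemma Nice.choose (c : Ctx F v) {l : Ln} (h : Nice F v l) : ∃ o : ℝ → V3, ∀ t, Good F v (pt l t) → cr l.2 (o t) ≠ 0 ∧ restr (pt l t, o t) F = 0 := by
  classical
  have : ∀ t, ∃ o, Good F v (pt l t) → cr l.2 o ≠ 0 ∧ restr (pt l t, o) F = 0 := by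
    intro t
    by_cases hg : Good F v (pt l t)
    · obtain ⟨o, ho⟩ := hg.other c h.1 (rebase ⟨t, rfl⟩ h.2.1)
      exact ⟨o, fun _ => ho⟩
    · exact ⟨0, fun h => absurd h hg⟩
  choose o ho using this
  exact ⟨o, ho⟩

/-- families of lines crossing a nice line -/
lemma dvd_cross (c : Ctx F v) {l : Ln} {o : ℝ → V3} (s : Set ℝ) (hs : s.Infinite)
    (ho : ∀ t ∈ s, cr l.2 (o t) ≠ 0 ∧ restr (pt l t, o t) F = 0) {G : MP} (hG : ∀ t ∈ s, restr (pt l t, o t) G = 0) : F ∣ G :=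
  dvd_of_inf c.irr s hs (fun t => (pt l t, o t)) (fun t ht => cr_ne_right (ho t ht).1)
    (fun t ht t' ht' hne x y h1 h2 h3 h4 => cross_pair (p := l.1) (d := l.2) hne (ho t' ht').1 h1 h2 h3 h4)
    (fun t ht => ⟨(ho t ht).2, hG t ht⟩)

lemma coplanar (c : Ctx F v) {l : Ln} (h : Nice F v l) {z d1 d2 : V3} (hz : Good F v z) (h1 : restr (z, d1) F = 0)
    (h2 : restr (z, d2) F = 0) (h12 : cr d1 d2 ≠ 0) : q1 d1 (cr (z - l.1) l.2) = 0 ∨ q1 d2 (cr (z - l.1) l.2) = 0 := by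
  obtain ⟨o, ho⟩ := h.choose c
  have hG : F ∣ pG l.1 l.2 F := by
    refine dvd_cross c _ h.inf (o := o) (fun t ht => ho t ht) ?_
    intro t ht
    rw [restr_zero_iff]
    rintro _ ⟨τ, rfl⟩
    have hl := rebase (l := (pt l t, o t)) ⟨τ, rfl⟩ (ho t ht).2
    obtain ⟨-, n1, n2, -⟩ := line_null hl
    rw [eval_pG]
    generalize gx F (pt (pt l t, o t) τ) = n at *
    generalize hx F (pt (pt l t, o t) τ) = H at *
    simp only at n1 n2
    have : cr n (cr (pt (pt l t, o t) τ - l.1) l.2) = (τ * q1 n l.2) • o t := by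
      simp only [q1] at n1 ⊢
      funext i; fin_cases i <;> simp [pt]
      · linear_combination (-τ * l.2 0) * n1
      · linear_combination (-τ * l.2 1) * n1
      · linear_combination (-τ * l.2 2) * n1
    rw [this, q2_smul, n2, mul_zero]
  obtain ⟨K, hK⟩ := hG
  have e := eval_pG l.1 l.2 z F
  rw [hK, map_mul, hz.1, zero_mul] at e
  obtain ⟨-, n1, n2, -⟩ := line_null h1
  obtain ⟨-, n1', n2', -⟩ := line_null h2
  set y := cr (z - l.1) l.2
  set n := gx F z
  have t1 : q1 n (cr n y) = 0 := by simp [q1]; ring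
  have t2 : q1 (cr n y) y = 0 := by simp [q1]; ring
  have hn := (fA_ne hz.A).2.1
  by_cases hw : cr n y = 0
  · left
    have : q1 n n • y = q1 n y • n := by
      have w0 := congrFun hw 0
      have w1 := congrFun hw 1
      have w2 := congrFun hw 2
      simp at w0 w1 w2
      funext i; fin_cases i <;> simp [q1]
      · linear_combination n 2 * w1 - n 1 * w2
      · linear_combination n 0 * w2 - n 2 * w0
      · linear_combination n 1 * w0 - n 0 * w1
    have h3 : q1 n n * q1 d1 y = q1 n y * q1 n d1 := by
      have e0 := congrFun this 0
      have e1 := congrFun this 1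
      have e2 := congrFun this 2
      simp at e0 e1 e2
      simp only [q1] at *
      linear_combination d1 0 * e0 + d1 1 * e1 + d1 2 * e2
    rw [n1, mul_zero] at h3
    exact (mul_eq_zero.1 h3).resolve_left (fun h => hn (q1_self h))
  · have par : ∀ {d : V3}, cr (cr n y) d = 0 → q1 d y = 0 := by
      intro d hd
      have w0 := congrFun hd 0
      have w1 := congrFun hd 1
      have w2 := congrFun hd 2
      have hq : q1 (cr n y) (cr n y) * q1 d y = q1 (cr n y) d * q1 (cr n y) y := by
        generalize cr n y = w at *
        simp at w0 w1 w2
        simp only [q1]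
        linear_combination y 0 * (w 1 * w2 - w 2 * w1) * (-1) + y 1 * (w 0 * w2 - w 2 * w0) + y 2 * (w 1 * w0 - w 0 * w1)
      rw [t2, mul_zero] at hq
      exact (mul_eq_zero.1 hq).resolve_left (fun h => hw (q1_self h))
    exact (only_two (hx_symm F z) hz.A h12 n1 n2 n1' n2' t1 e.symm).imp par par

lemma fin_plane (c : Ctx F v) {l : Ln} {o : ℝ → V3} (s : Set ℝ)
    (ho : ∀ t ∈ s, cr l.2 (o t) ≠ 0 ∧ restr (pt l t, o t) F = 0) {e : V3} (he : cr l.2 e ≠ 0) :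
    {t ∈ s | q1 (o t) (cr l.2 e) = 0}.Finite := by
  by_contra hinf
  refine not_dvd_of_deg (lin_ne he l.1) ?_ (dvd_cross c (G := lin l.1 (cr l.2 e)) _ hinf (o := o) (fun t ht => ho t ht.1) ?_)
  · have := lin_deg l.1 (cr l.2 e); have := c.deg; omega
  · rintro t ⟨-, ht⟩
    rw [restr_zero_iff]
    rintro _ ⟨τ, rfl⟩
    rw [eval_lin']
    simp [q1, pt] at ht ⊢
    linear_combination τ * ht

lemma skew {p d o o' : V3} {t t' : ℝ} (hne : t ≠ t') (h : q1 o' (cr d o) ≠ 0) {x : V3} (h1 : On x (pt (p, d) t, o))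
    (h2 : On x (pt (p, d) t', o')) : False := by
  obtain ⟨α, rfl⟩ := h1
  obtain ⟨β, e⟩ := h2
  have e0 := congrFun e 0
  have e1 := congrFun e 1
  have e2 := congrFun e 2
  simp [pt] at e0 e1 e2
  apply h
  have : (t - t') * q1 o' (cr d o) = 0 := by
    simp [q1, -mul_eq_zero]
    linear_combination e0 * (o 1 * o' 2 - o 2 * o' 1) + e1 * (o 2 * o' 0 - o 0 * o' 2) + e2 * (o 0 * o' 1 - o 1 * o' 0)
  exact (mul_eq_zero.1 this).resolve_left (sub_ne_zero.2 hne)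

lemma no_nice (c : Ctx F v) {l : Ln} (h : Nice F v l) : False := by
  classical
  obtain ⟨p, d⟩ := l
  obtain ⟨o, ho⟩ := h.choose c
  set s := {t | Good F v (pt (p, d) t)} with hs
  have hinf : s.Infinite := h.inf
  have P := fun e (he : cr d e ≠ 0) => fin_plane c (l := (p, d)) s (fun t ht => ho t ht) he
  obtain ⟨t0, ht0⟩ := hinf.nonempty
  obtain ⟨t1, ht1, h01⟩ := (hinf.diff (P _ (ho t0 ht0).1)).nonempty
  obtain ⟨t2, ⟨ht2, h02⟩, h12⟩ := ((hinf.diff (P _ (ho t0 ht0).1)).diff (P _ (ho t1 ht1).1)).nonempty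
  have D01 : q1 (o t1) (cr d (o t0)) ≠ 0 := fun h => h01 ⟨ht1, h⟩
  have D02 : q1 (o t2) (cr d (o t0)) ≠ 0 := fun h => h02 ⟨ht2, h⟩
  have D12 : q1 (o t2) (cr d (o t1)) ≠ 0 := fun h => h12 ⟨ht2, h⟩
  have slf : ∀ e : V3, q1 e (cr d e) = 0 := fun e => by simp [q1]; ring
  have n01 : t0 ≠ t1 := by rintro rfl; exact D01 (slf _)
  have n02 : t0 ≠ t2 := by rintro rfl; exact D02 (slf _)
  have n12 : t1 ≠ t2 := by rintro rfl; exact D12 (slf _)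
  set x0 := pt (p, d) t0 with hx0
  set x1 := pt (p, d) t1 with hx1
  set x2 := pt (p, d) t2 with hx2
  have N0 : Nice F v (x0, o t0) := Good.nice ht0 (cr_ne_right (ho t0 ht0).1) (ho t0 ht0).2
  have N1 : Nice F v (x1, o t1) := Good.nice ht1 (cr_ne_right (ho t1 ht1).1) (ho t1 ht1).2
  have N2 : Nice F v (x2, o t2) := Good.nice ht2 (cr_ne_right (ho t2 ht2).1) (ho t2 ht2).2
  obtain ⟨k, hk⟩ := N0.choose c
  set s1 := {t | Good F v (pt (x0, o t0) t)} with hs1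
  have hinf1 : s1.Infinite := N0.inf
  have crne : ∀ {a b : V3}, q1 b (cr d a) ≠ 0 → cr a b ≠ 0 := by
    intro a b h h0; apply h
    have w0 := congrFun h0 0
    have w1 := congrFun h0 1
    have w2 := congrFun h0 2
    simp [q1] at w0 w1 w2 ⊢
    linear_combination d 0 * w0 + d 1 * w1 + d 2 * w2
  have par : ∀ {a b e : V3}, cr e b = 0 → b ≠ 0 → q1 e (cr a b) = 0 := by
    intro a b e h0 _
    have w0 := congrFun h0 0
    have w1 := congrFun h0 1
    have w2 := congrFun h0 2
    simp [q1] at w0 w1 w2 ⊢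
    linear_combination - a 0 * w0 - a 1 * w1 - a 2 * w2
  have P1 := fun e (he : cr (o t0) e ≠ 0) => fin_plane c (l := (x0, o t0)) s1 (fun t ht => hk t ht) he
  set s2 := (s1 \ {t ∈ s1 | q1 (k t) (cr (o t0) (o t1)) = 0}) \ {t ∈ s1 | q1 (k t) (cr (o t0) (o t2)) = 0} with hs2
  have hinf2 : s2.Infinite := (hinf1.diff (P1 _ (crne D01))).diff (P1 _ (crne D02))
  obtain ⟨Q, hQ0, hQ2, hQ⟩ := quadric_lines ![(x0, o t0), (x1, o t1), (x2, o t2)] (by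
    intro i; fin_cases i
    · exact N0.1
    · exact N1.1
    · exact N2.1)
  have q0 := hQ 0
  have q1' := hQ 1
  have q2' := hQ 2
  simp at q0 q1' q2'
  refine not_dvd_of_deg hQ0 (by have := c.deg; omega) (dvd_cross c (l := (x0, o t0)) s2 hinf2 (o := k) (fun t ht => hk t ht.1.1) ?_)
  rintro r ⟨⟨hr, hr1⟩, hr2⟩
  have hr1 : cr (k r) (o t1) ≠ 0 := fun h => hr1 ⟨hr, par h N1.1⟩
  have hr2 : cr (k r) (o t2) ≠ 0 := fun h => hr2 ⟨hr, par h N2.1⟩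
  set w := pt (x0, o t0) r with hw
  have hitg : ∀ t, t0 ≠ t → q1 (o t) (cr d (o t0)) ≠ 0 → Nice F v (pt (p, d) t, o t) → cr (k r) (o t) ≠ 0 →
      ∃ y, On y (w, k r) ∧ On y (pt (p, d) t, o t) := by
    intro t hne hD N hc
    rcases coplanar c N hr (rebase ⟨r, rfl⟩ N0.2.1) (hk r hr).2 (hk r hr).1 with hc1 | hc1
    · exfalso
      have : (t0 - t) * q1 (o t) (cr d (o t0)) = 0 := by
        simp [q1, pt, hx0, -mul_eq_zero] at hc1 ⊢
        linear_combination -hc1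
      exact hD ((mul_eq_zero.1 this).resolve_left (sub_ne_zero.2 hne))
    · obtain ⟨α, β, hab⟩ := meet hc hc1
      refine ⟨w + (-α) • k r, ⟨-α, rfl⟩, β, ?_⟩
      simp only at hab
      have : w = pt (p, d) t + (α • k r + β • o t) := by rw [← hab]; simp [hw]
      rw [this]; simp [pt]; module
  obtain ⟨y1, a1, b1⟩ := hitg t1 n01 D01 N1 hr1
  obtain ⟨y2, a2, b2⟩ := hitg t2 n02 D02 N2 hr2
  have w0 : On w (x0, o t0) := ⟨r, rfl⟩
  refine restr_zero_of_card {w, y1, y2} ?_ ?_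
  · intro x hx
    simp only [mem_insert, mem_singleton] at hx
    rcases hx with rfl | rfl | rfl
    · exact ⟨⟨0, by simp [pt]⟩, restr_zero_iff.1 q0 _ w0⟩
    · exact ⟨a1, restr_zero_iff.1 q1' _ b1⟩
    · exact ⟨a2, restr_zero_iff.1 q2' _ b2⟩
  · rw [card_eq_three.2 ⟨w, y1, y2, ?_, ?_, ?_, rfl⟩]
    · omega
    · rintro e; rw [e] at w0; exact skew n01 D01 w0 b1
    · rintro e; rw [e] at w0; exact skew n02 D02 w0 b2
    · rintro rfl; exact skew n12 D12 b1 b2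

end FL3
end GK

namespace GK
section FL4
open Finset
open MvPolynomial (pderiv)

lemma flat_id {R : Type*} [CommRing R] {H : Fin 3 → Fin 3 → R} (hH : ∀ i j, H i j = H j i) (w n : Fin 3 → R) :
    q2 H (cr w n) (cr w n) = w 0 ^ 2 * fA ![1,0,0] n H + w 1 ^ 2 * fA ![0,1,0] n H + w 2 ^ 2 * fA ![0,0,1] n H
      + w 0 * w 1 * (fA ![1,1,0] n H - fA ![1,0,0] n H - fA ![0,1,0] n H)
      + w 0 * w 2 * (fA ![1,0,1] n H - fA ![1,0,0] n H - fA ![0,0,1] n H)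
      + w 1 * w 2 * (fA ![0,1,1] n H - fA ![0,1,0] n H - fA ![0,0,1] n H) := by
  simp [fA, E1, q2, Fin.sum_univ_three, hH 1 0, hH 2 0, hH 2 1]
  ring

lemma flat_line {F : MP} (h : ∀ v, F ∣ pA v F) {x u : V3} (hx0 : F.eval x = 0) (hn : gx F x ≠ 0) (hu : q1 (gx F x) u = 0) :
    restr (x, u) F = 0 := by
  set n : Fin 3 → S6 := fun i => emb (gr F i) with hndef
  set H : Fin 3 → Fin 3 → S6 := fun i j => emb (he F i j) with hH
  set s : Set S6 := {emb F, q1 n uu} with hs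
  refine line_of_stable s (q1 n n) ?_ F (by simp [hs]) x u ?_ ?_
  · have m0 : emb F ∈ Ideal.span s := Ideal.subset_span (by simp [hs])
    have m1 : q1 n uu ∈ Ideal.span s := Ideal.subset_span (by simp [hs])
    rintro g (rfl | rfl)
    · exact ⟨0, by rw [DD_q0, pow_zero, one_mul]; exact m1⟩
    · refine ⟨2, ?_⟩
      rw [DD_q1]
      set π := Ideal.Quotient.mk (Ideal.span s) with hπ
      have z : ∀ w : V3, ∀ w' : Fin 3 → S6 ⧸ Ideal.span s, (∀ i, π (emb (cv w i)) = w' i) → fA w' (fun i => π (n i)) (fun i j => π (H i j)) = 0 := by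
        intro w w' hw
        have : π (emb (pA w F)) = 0 := by
          obtain ⟨g, hg⟩ := h w
          rw [hg, Ideal.Quotient.eq_zero_iff_mem, map_mul]
          exact Ideal.mul_mem_right _ _ m0
        have a0 : emb (pA w F) = fA (fun i => emb (cv w i)) n H := map_fA (emb : MP →+* S6) _ _ _
        rw [a0, map_fA] at this
        simp only [hw] at this
        exact this
      have e1 := Ideal.Quotient.eq_zero_iff_mem.2 m1
      rw [← hπ, map_q1] at e1
      rw [← Ideal.Quotient.eq_zero_iff_mem, ← hπ, map_mul, map_pow, map_q1, map_q2]
      rw [← q2_smul]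
      have key : q1 (fun i => π (n i)) (fun i => π (n i)) • (fun i => π (uu i)) =
          cr (cr (fun i => π (n i)) (fun i => π (uu i))) (fun i => π (n i)) := by
        simp only [q1] at e1 ⊢
        funext i; fin_cases i <;> simp
        · linear_combination π (n 0) * e1
        · linear_combination π (n 1) * e1
        · linear_combination π (n 2) * e1
      rw [key, flat_id (fun i j => by simp only [hH, he_symm F i j])]
      rw [z ![1,0,0] ![1,0,0] (by intro i; fin_cases i <;> simp [cv]),
        z ![0,1,0] ![0,1,0] (by intro i; fin_cases i <;> simp [cv]),
        z ![0,0,1] ![0,0,1] (by intro i; fin_cases i <;> simp [cv]),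
        z ![1,1,0] ![1,1,0] (by intro i; fin_cases i <;> simp [cv]),
        z ![1,0,1] ![1,0,1] (by intro i; fin_cases i <;> simp [cv]),
        z ![0,1,1] ![0,1,1] (by intro i; fin_cases i <;> simp [cv])]
      ring
  · rintro g (rfl | rfl)
    · rw [es_emb, hx0]
    · rw [es_q1, hu]
  · rw [map_q1]
    simp only [hndef, es_emb]
    exact fun h => hn (q1_self h)

lemma exists_v {F : MP} (hF : Irreducible F) (hdeg : 3 ≤ F.totalDegree) {x : V3} (hx0 : F.eval x = 0) (hn : gx F x ≠ 0) :
    ∃ v, ¬ F ∣ pA v F := by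
  by_contra! hall
  have fl := fun u hu => flat_line (u := u) hall hx0 hn hu
  set n := gx F x
  obtain ⟨e, he⟩ : ∃ e, cr n e ≠ 0 := by
    by_contra! h
    apply hn
    have a := h ![1,0,0]
    have b := h ![0,1,0]
    have a1 := congrFun a 1
    have a2 := congrFun a 2
    have b0 := congrFun b 0
    have b2 := congrFun b 2
    simp at a1 a2 b0 b2
    funext i; fin_cases i <;> simp [*]
  set p := cr n e
  set q := cr n p
  have hpq : cr p q ≠ 0 := by
    have : cr p q = q1 p p • n := by
      funext i; fin_cases i <;> simp [p, q, q1] <;> ring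
    rw [this]; exact smul_ne_zero (fun h => he (q1_self h)) hn
  have hc : ∀ t : ℝ, cr p (p + t • q) = t • cr p q := fun t => by
    funext i; fin_cases i <;> simp <;> ring
  have hp : p ≠ 0 := he
  refine not_dvd_of_deg (lin_ne hn x) ?_ (dvd_of_inf (G := lin x n) hF (Set.Ioi 0) (Set.Ioi_infinite 0) (fun t => (x, p + t • q)) ?_ ?_ ?_)
  · have := lin_deg x n; omega
  · intro t ht
    exact cr_ne_right (d := p) (by rw [hc]; exact smul_ne_zero (ne_of_gt ht) hpq)
  · have key : ∀ t ∈ Set.Ioi (0:ℝ), ∀ t' ∈ Set.Ioi (0:ℝ), t ≠ t' → ∀ y, On y (x, p + t • q) → On y (x, p + t' • q) → y = x := by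
      rintro t ht t' ht' hne y ⟨α, rfl⟩ ⟨β, e⟩
      simp only [pt, add_right_inj] at e
      have h1 : α • cr (p + t • q) (p + t' • q) = 0 := by
        have : α • cr (p + t • q) (p + t' • q) = cr (α • (p + t • q)) (p + t' • q) := by
          funext i; fin_cases i <;> simp <;> ring
        rw [this, e]; funext i; fin_cases i <;> simp <;> ring
      have h2 : cr (p + t • q) (p + t' • q) = (t' - t) • cr p q := by
        funext i; fin_cases i <;> simp <;> ring
      rw [h2] at h1
      have : α = 0 := (smul_eq_zero.1 h1).resolve_right (smul_ne_zero (sub_ne_zero.2 hne.symm) hpq)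
      simp [pt, this]
    intro t ht t' ht' hne y y' h1 h2 h3 h4
    rw [key t ht t' ht' hne y h1 h2, key t ht t' ht' hne y' h3 h4]
  · intro t ht
    have h0 : q1 n (p + t • q) = 0 := by simp [q1, p, q]; ring
    refine ⟨fl _ h0, ?_⟩
    rw [restr_zero_iff]
    rintro _ ⟨τ, rfl⟩
    rw [eval_lin']
    simp [q1, pt] at h0 ⊢
    linear_combination τ * h0

theorem FL {F : MP} (hF : Irreducible F) (hdeg : 3 ≤ F.totalDegree) (Ls : Finset Ln) (hL : Lines Ls)
    (hZ : ∀ l ∈ Ls, restr l F = 0)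
    (hX : ∀ l ∈ Ls, ∃ X : Finset V3, 17 * F.totalDegree ≤ #X ∧ ∀ x ∈ X, On x l ∧ ∃ d', cr l.2 d' ≠ 0 ∧ restr (x, d') F = 0) :
    #Ls ≤ 100 * F.totalDegree ^ 2 := by
  classical
  by_contra! hcon
  set a := F.totalDegree with ha
  have find : ∀ G : MP, ¬ F ∣ G → G.totalDegree ≤ 13 * a → ∃ l ∈ Ls, restr l G ≠ 0 := by
    intro G hG hd
    by_contra! hall
    have := bezout_lines F G hF hG Ls hL (fun l hl => ⟨hZ l hl, hall l hl⟩)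
    have : 6 * a * G.totalDegree ≤ 6 * a * (13 * a) := Nat.mul_le_mul_left _ hd
    nlinarith
  have r1 : ∀ v, F ∣ pR1 v F := by
    intro v
    by_contra hn
    obtain ⟨l, hl, h⟩ := find _ hn (dR1 v F)
    obtain ⟨X, hc, hX⟩ := hX l hl
    refine h (restr_zero_of_card X (fun x hx => ?_) (by have := dR1 v F; omega))
    obtain ⟨h1, d', h2, h3⟩ := hX x hx
    exact ⟨h1, (cross_R v (rebase h1 (hZ l hl)) h3 h2).1⟩
  have r2 : ∀ v, F ∣ pR2 v F := by
    intro v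
    by_contra hn
    obtain ⟨l, hl, h⟩ := find _ hn (dR2 v F)
    obtain ⟨X, hc, hX⟩ := hX l hl
    refine h (restr_zero_of_card X (fun x hx => ?_) (by have := dR2 v F; omega))
    obtain ⟨h1, d', h2, h3⟩ := hX x hx
    exact ⟨h1, (cross_R v (rebase h1 (hZ l hl)) h3 h2).2.1⟩
  obtain ⟨i, hi⟩ : ∃ i, ¬ F ∣ pderiv i F := by
    by_contra! hall
    have : ∀ i, pderiv i F = 0 := by
      intro i
      by_contra h0
      exact not_dvd_of_deg h0 (by have := deg_pderiv' i F; omega) (hall i)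
    have := const_of_pderiv F this
    omega
  obtain ⟨l, hl, h⟩ := find _ hi ((deg_pderiv i F).trans (by omega))
  rw [Ne, restr_zero_iff] at h
  push Not at h
  obtain ⟨x, hxl, hx⟩ := h
  obtain ⟨v, hv⟩ := exists_v hF hdeg (restr_zero_iff.1 (hZ l hl) x hxl) (fun h => hx (congrFun h i))
  obtain ⟨l, hl, h⟩ := find _ hv ((dA v F).trans (by omega))
  obtain ⟨X, hc, hX⟩ := hX l hl
  have : ∃ x ∈ X, (pA v F).eval x ≠ 0 := by
    by_contra! hall
    refine h (restr_zero_of_card X (fun x hx => ⟨(hX x hx).1, hall x hx⟩) (by have := dA v F; omega))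
  obtain ⟨x, hxX, hxA⟩ := this
  obtain ⟨h1, d', h2, h3⟩ := hX x hxX
  have hD := (cross_R v (rebase h1 (hZ l hl)) h3 h2).2.2 hxA
  have c : Ctx F v := ⟨hF, hdeg, r1 v, r2 v⟩
  refine no_nice c (l := l) ⟨hL.1 l hl, hZ l hl, fun h0 => ?_⟩
  have := restr_zero_iff.1 h0 x h1
  rw [map_mul] at this
  exact mul_ne_zero hxA hD this

end FL4
end GK

namespace GK
section SF
open Finset

open Classical in
lemma pairs {A : Finset V3} {B : Finset Ln} (hB : Lines B) {k : ℕ} (hk : ∀ x ∈ A, k ≤ #{l ∈ B | On x l}) :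
    #A * (k * (k - 1)) ≤ #B ^ 2 := by
  have hdis : (A : Set V3).PairwiseDisjoint fun x => ({l ∈ B | On x l} : Finset Ln).offDiag := by
    intro x hx y hy hne
    rw [Function.onFun, Finset.disjoint_left]
    rintro ⟨l, l'⟩ h1 h2
    simp only [mem_offDiag, mem_filter] at h1 h2
    exact hne (hB.2 l h1.1.1 l' h1.2.1.1 h1.2.2 x y h1.1.2 h1.2.1.2 h2.1.2 h2.2.1.2)
  have h1 := card_biUnion hdis
  have h2 : A.biUnion (fun x => ({l ∈ B | On x l} : Finset Ln).offDiag) ⊆ B ×ˢ B := by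
    intro p hp
    simp only [mem_biUnion, mem_offDiag, mem_filter, mem_product] at hp ⊢
    obtain ⟨x, -, h1, h2, -⟩ := hp
    exact ⟨h1.1, h2.1⟩
  have h3 := card_le_card h2
  rw [h1, card_product, ← sq] at h3
  refine le_trans ?_ h3
  rw [← smul_eq_mul, ← Finset.sum_const]
  refine sum_le_sum fun x hx => ?_
  rw [offDiag_card, ← Nat.mul_sub_one]
  have := hk x hx
  exact Nat.mul_le_mul this (Nat.sub_le_sub_right this 1)

open Classical in
lemma few {A : Finset V3} {B : Finset Ln} (hB : Lines B) {k : ℕ} (hk : ∀ x ∈ A, k ≤ #{l ∈ B | On x l}) (hA : 2 * #A ≤ k) :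
    #A * k ≤ 2 * #B := by
  let f : V3 → Finset Ln := fun x => {l ∈ B | On x l ∧ ∀ y ∈ A, y ≠ x → ¬ On y l}
  have hdis : (A : Set V3).PairwiseDisjoint f := by
    intro x hx y hy hne
    rw [Function.onFun, Finset.disjoint_left]
    intro l h1 h2
    simp only [f, mem_filter] at h1 h2
    exact h2.2.2 x hx hne h1.2.1
  have h1 := card_biUnion hdis
  have h2 : A.biUnion f ⊆ B := by
    intro l hl
    simp only [mem_biUnion, f, mem_filter] at hl
    obtain ⟨x, -, h1, -⟩ := hl
    exact h1
  have h3 := card_le_card h2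
  rw [h1] at h3
  have h4 : ∀ x ∈ A, k ≤ 2 * #(f x) := by
    intro x hx
    have hsub : ({l ∈ B | On x l} : Finset Ln) ⊆ f x ∪ (A.erase x).biUnion fun y => {l ∈ B | On x l ∧ On y l} := by
      intro l hl
      simp only [mem_filter] at hl
      simp only [mem_union, mem_biUnion, f, mem_filter, mem_erase]
      by_cases h : ∀ y ∈ A, y ≠ x → ¬ On y l
      · exact Or.inl ⟨hl.1, hl.2, h⟩
      · push Not at h
        obtain ⟨y, hy, hne, ho⟩ := h
        exact Or.inr ⟨y, ⟨hne, hy⟩, hl.1, hl.2, ho⟩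
    have h5 := (hk x hx).trans ((card_le_card hsub).trans (card_union_le _ _))
    have h6 : #((A.erase x).biUnion fun y => ({l ∈ B | On x l ∧ On y l} : Finset Ln)) ≤ #(A.erase x) * 1 := by
      refine card_biUnion_le_card_mul _ _ _ fun y hy => ?_
      rw [card_le_one]
      intro l hl l' hl'
      simp only [mem_filter] at hl hl'
      by_contra hne
      exact (mem_erase.1 hy).1 (hB.2 l hl.1 l' hl'.1 hne x y hl.2.1 hl'.2.1 hl.2.2 hl'.2.2).symm
    have := card_erase_lt_of_mem hx
    omega
  calc #A * k ≤ ∑ x ∈ A, 2 * #(f x) := by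
        rw [← smul_eq_mul, ← Finset.sum_const]; exact sum_le_sum h4
    _ ≤ 2 * #B := by rw [← mul_sum]; omega

lemma facs (P : MP) (hP : P ≠ 0) : ∃ fac : Finset MP, (∀ F ∈ fac, Irreducible F ∧ 1 ≤ F.totalDegree) ∧
    (∀ x, P.eval x = 0 → ∃ F ∈ fac, F.eval x = 0) ∧ ∑ F ∈ fac, F.totalDegree ≤ P.totalDegree := by
  classical
  set m := UniqueFactorizationMonoid.factors P with hm
  have hirr : ∀ F ∈ m, Irreducible F := fun F hF => UniqueFactorizationMonoid.irreducible_of_factor F hF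
  obtain ⟨u, hu⟩ := UniqueFactorizationMonoid.factors_prod hP
  rw [← hm] at hu
  have hsum : ∀ m : Multiset MP, (∀ F ∈ m, Irreducible F) → (m.map MvPolynomial.totalDegree).sum ≤ m.prod.totalDegree := by
    intro m
    induction m using Multiset.induction_on with
    | empty => simp
    | cons F m ih =>
      intro h
      have h1 : m.prod ≠ 0 := by
        rw [Ne, Multiset.prod_eq_zero_iff]
        intro h0; exact (h 0 (Multiset.mem_cons_of_mem h0)).ne_zero rfl
      rw [Multiset.map_cons, Multiset.sum_cons, Multiset.prod_cons,
        MvPolynomial.totalDegree_mul_of_isDomain (h F (Multiset.mem_cons_self _ _)).ne_zero h1]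
      have := ih (fun G hG => h G (Multiset.mem_cons_of_mem hG))
      omega
  refine ⟨m.toFinset, ?_, ?_, ?_⟩
  · intro F hF
    rw [Multiset.mem_toFinset] at hF
    refine ⟨hirr F hF, ?_⟩
    by_contra h
    have h0 : F.totalDegree = 0 := by omega
    rw [MvPolynomial.totalDegree_eq_zero_iff_eq_C] at h0
    have hc : MvPolynomial.coeff 0 F ≠ 0 := by
      intro hc; rw [hc, map_zero] at h0; exact (hirr F hF).ne_zero h0
    apply (hirr F hF).not_isUnit
    rw [h0]
    exact (IsUnit.mk0 _ hc).map MvPolynomial.C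
  · intro x hx
    rw [← hu, map_mul] at hx
    have hun : (MvPolynomial.eval x) (u : MP) ≠ 0 := (u.isUnit.map (MvPolynomial.eval x)).ne_zero
    have := (mul_eq_zero.1 hx).resolve_right hun
    rw [map_multiset_prod, Multiset.prod_eq_zero_iff, Multiset.mem_map] at this
    obtain ⟨F, hF, h0⟩ := this
    exact ⟨F, Multiset.mem_toFinset.2 hF, h0⟩
  · have h1 := hsum m hirr
    have h2 : m.prod.totalDegree ≤ P.totalDegree := by
      have h0 := hP
      rw [← hu] at h0 ⊢
      rw [MvPolynomial.totalDegree_mul_of_isDomain (left_ne_zero_of_mul h0) (right_ne_zero_of_mul h0)]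
      omega
    refine le_trans ?_ (h1.trans h2)
    have : m.toFinset.val ≤ m := Multiset.dedup_le m
    obtain ⟨w, hw⟩ := Multiset.le_iff_exists_add.1 this
    have e : (m.map MvPolynomial.totalDegree).sum = (m.toFinset.val.map MvPolynomial.totalDegree).sum + (w.map MvPolynomial.totalDegree).sum := by
      conv_lhs => rw [hw]
      rw [Multiset.map_add, Multiset.sum_add]
    rw [e]
    exact Nat.le_add_right _ _

lemma indep {B : Finset Ln} (hB : Lines B) {l l' : Ln} (hl : l ∈ B) (hl' : l' ∈ B) (hne : l ≠ l') {x : V3} (h : On x l) (h' : On x l') :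
    cr l.2 l'.2 ≠ 0 := by
  intro h0
  obtain ⟨s, hs⟩ := h
  obtain ⟨s', hs'⟩ := h'
  have hd := hB.1 l hl
  have hd' := hB.1 l' hl'
  have key : q1 l'.2 l'.2 • l.2 = q1 l.2 l'.2 • l'.2 := by
    have w0 := congrFun h0 0
    have w1 := congrFun h0 1
    have w2 := congrFun h0 2
    simp at w0 w1 w2
    funext i; fin_cases i <;> simp [q1]
    · linear_combination l'.2 1 * w2 - l'.2 2 * w1
    · linear_combination l'.2 2 * w0 - l'.2 0 * w2
    · linear_combination l'.2 0 * w1 - l'.2 1 * w0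
  have hq : q1 l'.2 l'.2 ≠ 0 := fun h => hd' (q1_self h)
  have := hB.2 l hl l' hl' hne x (pt l (s + q1 l'.2 l'.2)) ⟨s, hs⟩ ⟨s', hs'⟩ ⟨_, rfl⟩ ⟨s' + q1 l.2 l'.2, by
    have e : pt l (s + q1 l'.2 l'.2) = pt l s + q1 l'.2 l'.2 • l.2 := by simp [pt]; module
    have e' : pt l' (s' + q1 l.2 l'.2) = pt l' s' + q1 l.2 l'.2 • l'.2 := by simp [pt]; module
    rw [e, e', ← hs, ← hs', key]⟩
  rw [hs] at this
  have := pt_inj hd this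
  apply hq; linarith

end SF
end GK

namespace GK
section SU
open Finset

open Classical in
lemma surface {P : MP} (hP : P ≠ 0) {Ls : Finset Ln} (hL : Lines Ls) {S1 : Finset V3} (hS : ∀ x ∈ S1, P.eval x = 0)
    {k k' M : ℕ} (hk : 2 ≤ k) (hk' : k' = max 2 ((k + 1) / 2)) (hrich : ∀ x ∈ S1, k ≤ #{l ∈ Ls | On x l})
    (hM : ∀ Q : MP, Q ≠ 0 → Q.totalDegree ≤ 2 → #{l ∈ Ls | restr l Q = 0} ≤ M) :
    ∃ E ⊆ Ls, #E ≤ 100 * P.totalDegree ^ 2 ∧ ∃ S3 ⊆ S1, (∀ x ∈ S3, k' ≤ #{l ∈ E | On x l}) ∧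
      #S1 * k ^ 2 ≤ #S3 * k ^ 2 + 36 * #Ls * P.totalDegree * k + 8 * P.totalDegree * M ^ 2 := by
  obtain ⟨fac, hf1, hf2, hf3⟩ := facs P hP
  set d := P.totalDegree with hd
  have hfd : ∀ F ∈ fac, F.totalDegree ≤ d := fun F hF =>
    (single_le_sum (f := fun F : MP => F.totalDegree) (fun _ _ => Nat.zero_le _) hF).trans hf3
  let Cx : MP → V3 → Ln → Prop := fun F x l => ∃ d', cr l.2 d' ≠ 0 ∧ restr (x, d') F = 0
  let EF : MP → Finset Ln := fun F => {l ∈ Ls | restr l F = 0 ∧ ∃ X : Finset V3, 17 * F.totalDegree ≤ #X ∧ ∀ x ∈ X, On x l ∧ Cx F x l}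
  let E : Finset Ln := (fac.filter (fun F => 3 ≤ F.totalDegree)).biUnion EF
  let Bad : V3 → Ln → Prop := fun x l => ∃ F ∈ fac, F.eval x = 0 ∧ (restr l F ≠ 0 ∨ (3 ≤ F.totalDegree ∧ restr l F = 0 ∧ l ∉ EF F ∧ Cx F x l))
  have hE : E ⊆ Ls := by
    intro l hl
    simp only [E, mem_biUnion] at hl
    obtain ⟨F, -, h⟩ := hl
    exact (mem_filter.1 h).1
  have hEc : #E ≤ 100 * d ^ 2 := by
    calc #E ≤ ∑ F ∈ fac.filter (fun F => 3 ≤ F.totalDegree), #(EF F) := card_biUnion_le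
      _ ≤ ∑ F ∈ fac.filter (fun F => 3 ≤ F.totalDegree), 100 * d * F.totalDegree := by
          refine sum_le_sum fun F hF => ?_
          obtain ⟨hF, h3⟩ := mem_filter.1 hF
          have := FL (hf1 F hF).1 h3 (EF F) (hL.mono (filter_subset _ _)) (fun l hl => (mem_filter.1 hl).2.1)
            (fun l hl => (mem_filter.1 hl).2.2)
          refine this.trans ?_
          rw [sq, mul_assoc]
          exact Nat.mul_le_mul_left _ (Nat.mul_le_mul_right _ (hfd F hF))
      _ ≤ ∑ F ∈ fac, 100 * d * F.totalDegree := sum_le_sum_of_subset (filter_subset _ _)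
      _ ≤ 100 * d ^ 2 := by
          rw [← mul_sum, sq, ← mul_assoc]
          exact Nat.mul_le_mul_left _ hf3
  have hbad : ∀ l ∈ Ls, #{x ∈ S1 | On x l ∧ Bad x l} ≤ 17 * d := by
    intro l hl
    let A : MP → Finset V3 := fun F => {x ∈ S1 | On x l ∧ F.eval x = 0 ∧ (restr l F ≠ 0 ∨ (3 ≤ F.totalDegree ∧ restr l F = 0 ∧ l ∉ EF F ∧ Cx F x l))}
    have hsub : ({x ∈ S1 | On x l ∧ Bad x l} : Finset V3) ⊆ fac.biUnion A := by
      intro x hx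
      obtain ⟨h1, h2, F, hF, h3, h4⟩ := mem_filter.1 hx
      exact mem_biUnion.2 ⟨F, hF, mem_filter.2 ⟨h1, h2, h3, h4⟩⟩
    refine (card_le_card hsub).trans (card_biUnion_le.trans ?_)
    calc ∑ F ∈ fac, #(A F) ≤ ∑ F ∈ fac, 17 * F.totalDegree := by
          refine sum_le_sum fun F hF => ?_
          by_cases h0 : restr l F = 0
          · by_contra! hc
            have hne : (A F).Nonempty := card_pos.1 (by omega)
            obtain ⟨x, hx⟩ := hne
            obtain ⟨-, -, -, h4⟩ := mem_filter.1 hx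
            have h5 := (h4.resolve_left (fun h => h h0)).2.2.1
            refine h5 (mem_filter.2 ⟨hl, h0, A F, hc.le, fun y hy => ?_⟩)
            obtain ⟨-, g1, -, g4⟩ := mem_filter.1 hy
            exact ⟨g1, (g4.resolve_left (fun h => h h0)).2.2.2⟩
          · by_contra! hc
            refine h0 (restr_zero_of_card (A F) (fun x hx => ?_) (by omega))
            obtain ⟨-, g1, g2, -⟩ := mem_filter.1 hx
            exact ⟨g1, g2⟩
      _ ≤ 17 * d := by rw [← mul_sum]; exact Nat.mul_le_mul_left _ hf3
  let cl : V3 → Finset Ln := fun x => {l ∈ Ls | On x l ∧ ¬ Bad x l}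
  let bd : V3 → Finset Ln := fun x => {l ∈ Ls | On x l ∧ Bad x l}
  let Di : Finset V3 := {x ∈ S1 | #(cl x) < k'}
  let G : Finset V3 := {x ∈ S1 | ¬ #(cl x) < k'}
  have hDi : #Di * k ≤ 34 * #Ls * d := by
    have h1 : ∀ x ∈ Di, k ≤ 2 * #(bd x) := by
      intro x hx
      obtain ⟨hx, hc⟩ := mem_filter.1 hx
      have h2 := hrich x hx
      have h3 : ({l ∈ Ls | On x l} : Finset Ln) ⊆ cl x ∪ bd x := by
        intro l hl
        obtain ⟨g1, g2⟩ := mem_filter.1 hl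
        by_cases hb : Bad x l
        · exact mem_union_right _ (mem_filter.2 ⟨g1, g2, hb⟩)
        · exact mem_union_left _ (mem_filter.2 ⟨g1, g2, hb⟩)
      have h4 := (card_le_card h3).trans (card_union_le _ _)
      omega
    have h2 : ∑ x ∈ Di, #(bd x) = ∑ l ∈ Ls, #{x ∈ Di | On x l ∧ Bad x l} :=
      sum_card_bipartiteAbove_eq_sum_card_bipartiteBelow (fun x l => On x l ∧ Bad x l)
    have h3 : ∑ l ∈ Ls, #{x ∈ Di | On x l ∧ Bad x l} ≤ ∑ l ∈ Ls, 17 * d := by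
      refine sum_le_sum fun l hl => (card_le_card ?_).trans (hbad l hl)
      exact filter_subset_filter _ (filter_subset _ _)
    rw [sum_const, smul_eq_mul] at h3
    have h4 : ∑ x ∈ Di, k ≤ ∑ x ∈ Di, 2 * #(bd x) := sum_le_sum h1
    rw [sum_const, smul_eq_mul, ← mul_sum, h2] at h4
    linarith
  let Lo : Finset V3 := {x ∈ G | ∃ F ∈ fac, F.eval x = 0 ∧ F.totalDegree ≤ 2}
  let S3 : Finset V3 := {x ∈ G | ¬ ∃ F ∈ fac, F.eval x = 0 ∧ F.totalDegree ≤ 2}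
  have hclean : ∀ x l F, l ∈ cl x → F ∈ fac → F.eval x = 0 → restr l F = 0 := by
    intro x l F hl hF h0
    by_contra h
    exact (mem_filter.1 hl).2.2 ⟨F, hF, h0, Or.inl h⟩
  have hfc : #fac ≤ d := by
    refine le_trans ?_ hf3
    rw [card_eq_sum_ones]
    exact sum_le_sum fun F hF => (hf1 F hF).2
  have hLo : #Lo * (k' * (k' - 1)) ≤ d * M ^ 2 := by
    let A : MP → Finset V3 := fun F => {x ∈ G | F.eval x = 0}
    have hsub : Lo ⊆ (fac.filter (fun F => F.totalDegree ≤ 2)).biUnion A := by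
      intro x hx
      obtain ⟨h1, F, h2, h3, h4⟩ := mem_filter.1 hx
      exact mem_biUnion.2 ⟨F, mem_filter.2 ⟨h2, h4⟩, mem_filter.2 ⟨h1, h3⟩⟩
    have h1 := (card_le_card hsub).trans card_biUnion_le
    calc #Lo * (k' * (k' - 1)) ≤ (∑ F ∈ fac.filter (fun F => F.totalDegree ≤ 2), #(A F)) * (k' * (k' - 1)) := Nat.mul_le_mul_right _ h1
      _ = ∑ F ∈ fac.filter (fun F => F.totalDegree ≤ 2), #(A F) * (k' * (k' - 1)) := sum_mul _ _ _
      _ ≤ ∑ F ∈ fac.filter (fun F => F.totalDegree ≤ 2), M ^ 2 := by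
          refine sum_le_sum fun F hF => ?_
          obtain ⟨hF, h2⟩ := mem_filter.1 hF
          refine (pairs (B := {l ∈ Ls | restr l F = 0}) (hL.mono (filter_subset _ _)) ?_).trans
            (Nat.pow_le_pow_left (hM F (hf1 F hF).1.ne_zero h2) 2)
          intro x hx
          obtain ⟨hx, h0⟩ := mem_filter.1 hx
          refine (not_lt.1 (mem_filter.1 hx).2).trans (card_le_card fun l hl => ?_)
          have := mem_filter.1 hl
          exact mem_filter.2 ⟨mem_filter.2 ⟨this.1, hclean x l F hl hF h0⟩, this.2.1⟩
      _ ≤ d * M ^ 2 := by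
          rw [sum_const, smul_eq_mul]
          exact Nat.mul_le_mul_right _ ((card_le_card (filter_subset _ _)).trans hfc)
  refine ⟨E, hE, hEc, S3, (filter_subset _ _).trans (filter_subset _ _), ?_, ?_⟩
  · intro x hx
    obtain ⟨hxG, hno⟩ := mem_filter.1 hx
    obtain ⟨hxS, hc⟩ := mem_filter.1 hxG
    obtain ⟨F, hF, h0⟩ := hf2 x (hS x hxS)
    have h3 : 3 ≤ F.totalDegree := by
      by_contra h
      exact hno ⟨F, hF, h0, by omega⟩
    refine (not_lt.1 hc).trans (card_le_card fun l hl => ?_)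
    have g := mem_filter.1 hl
    refine mem_filter.2 ⟨mem_biUnion.2 ⟨F, mem_filter.2 ⟨hF, h3⟩, ?_⟩, g.2.1⟩
    by_contra hn
    obtain ⟨l', hl', hne⟩ := exists_mem_ne (s := cl x) (by omega) l
    have g' := mem_filter.1 hl'
    exact g.2.2 ⟨F, hF, h0, Or.inr ⟨h3, hclean x l F hl hF h0, hn, l'.2,
      indep hL g.1 g'.1 hne.symm g.2.1 g'.2.1, rebase g'.2.1 (hclean x l' F hl' hF h0)⟩⟩
  · have e1 : #Di + #G = #S1 := card_filter_add_card_filter_not _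
    have e2 : #Lo + #S3 = #G := card_filter_add_card_filter_not _
    have hkk : k ^ 2 ≤ 8 * (k' * (k' - 1)) := by
      obtain ⟨j, rfl⟩ : ∃ j, k' = j + 2 := ⟨k' - 2, by omega⟩
      have : k ≤ 2 * j + 4 := by omega
      have h2 : k ≤ 3 ∨ k ≤ 2 * j + 4 ∧ 1 ≤ j ∨ k = 4:= by omega
      rcases h2 with h2 | h2 | h2
      · have : k ^ 2 ≤ 3 ^ 2 := Nat.pow_le_pow_left h2 2
        simp; nlinarith
      · have := Nat.pow_le_pow_left h2.1 2
        simp; nlinarith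
      · subst h2; simp; nlinarith
    have h1 : #Lo * k ^ 2 ≤ 8 * d * M ^ 2 := by
      calc #Lo * k ^ 2 ≤ #Lo * (8 * (k' * (k' - 1))) := Nat.mul_le_mul_left _ hkk
        _ = 8 * (#Lo * (k' * (k' - 1))) := by ring
        _ ≤ _ := by rw [mul_assoc]; exact Nat.mul_le_mul_left _ hLo
    have h2 : #Di * k ^ 2 ≤ 34 * #Ls * d * k := by
      rw [sq, ← mul_assoc]; exact Nat.mul_le_mul_right _ hDi
    rw [← e1, ← e2]
    have : 34 * #Ls * d * k ≤ 36 * #Ls * d * k := by gcongr; norm_num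
    nlinarith

end SU
end GK

namespace GK
section AR
open Finset

lemma arith {L s k M : ℝ} (hk : 2 ≤ k) (hkM : k ≤ M) (hL : L ≤ M ^ 2) (h1 : 10 ^ 8 * L * M < s * k ^ 2)
    (h2 : s * k ^ 2 ≤ 2 * 10 ^ 8 * L * M) (h3 : 10 ^ 8 * M < 2 * L) :
    ∃ I : ℕ, 32400 * (2:ℝ) ^ I * L ≤ s * k ∧ 453600 * ((2:ℝ) ^ I) ^ 2 ≤ L ∧ 1440 * (2:ℝ) ^ I * M ≤ 10 ^ 8 * L ∧
      (2888 * L ≤ 10 ^ 8 * M * (2:ℝ) ^ I ∨ 2 * s ≤ k * ((2:ℝ) ^ I) ^ 3) := by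
  have hM : 0 < M := by linarith
  have hk0 : 0 < k := by linarith
  have hL0 : 0 < L := by nlinarith
  have hs : 0 < s := by
    by_contra hs
    have : s * k ^ 2 ≤ 0 := mul_nonpos_of_nonpos_of_nonneg (not_lt.1 hs) (by positivity)
    have : 0 < 10 ^ 8 * L * M := by positivity
    linarith
  have hskL : 10 ^ 8 * L ≤ s * k := by
    by_contra! h
    have : s * k * k < 10 ^ 8 * L * k := by gcongr
    have : 10 ^ 8 * L * k ≤ 10 ^ 8 * L * M := by gcongr
    nlinarith
  by_cases hA : 187142400 * L * k ≤ 10 ^ 16 * M ^ 2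
  · obtain ⟨n, hn1, hn2⟩ := exists_nat_pow_near (x := 2888 * L / (10 ^ 8 * M)) (y := (2:ℝ))
      (by rw [le_div_iff₀ (by positivity)]; linarith) (by norm_num)
    rw [le_div_iff₀ (by positivity)] at hn1
    rw [div_lt_iff₀ (by positivity)] at hn2
    set D := (2:ℝ) ^ (n + 1) with hD
    have hD0 : 0 < D := by positivity
    have hDu : D * (10 ^ 8 * M) ≤ 5776 * L := by rw [hD, pow_succ]; linarith
    refine ⟨n + 1, ?_, ?_, ?_, Or.inl (by rw [← hD]; linarith)⟩
    · rw [← hD]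
      have a1 : 32400 * D * L * (10 ^ 8 * M) * k ≤ s * k * (10 ^ 8 * M) * k := by
        calc 32400 * D * L * (10 ^ 8 * M) * k = 32400 * L * k * (D * (10 ^ 8 * M)) := by ring
          _ ≤ 32400 * L * k * (5776 * L) := by gcongr
          _ = L * (187142400 * L * k) := by ring
          _ ≤ L * (10 ^ 16 * M ^ 2) := by gcongr
          _ = (10 ^ 8 * L * M) * (10 ^ 8 * M) := by ring
          _ ≤ (s * k ^ 2) * (10 ^ 8 * M) := by gcongr
          _ = _ := by ring
      exact le_of_mul_le_mul_right (by linarith : 32400 * D * L * (10 ^ 8 * M * k) ≤ s * k * (10 ^ 8 * M * k)) (by positivity)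
    · rw [← hD]
      have a1 : 453600 * D ^ 2 * (10 ^ 8 * M) ^ 2 ≤ L * (10 ^ 8 * M) ^ 2 := by
        calc 453600 * D ^ 2 * (10 ^ 8 * M) ^ 2 = 453600 * (D * (10 ^ 8 * M)) ^ 2 := by ring
          _ ≤ 453600 * (5776 * L) ^ 2 := by gcongr
          _ = L * (453600 * 5776 ^ 2 * L) := by ring
          _ ≤ L * (453600 * 5776 ^ 2 * M ^ 2) := by gcongr
          _ = L * (10 ^ 8 * M) ^ 2 * (453600 * 5776 ^ 2 / 10 ^ 16) := by ring
          _ ≤ L * (10 ^ 8 * M) ^ 2 * 1 := by gcongr; norm_num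
          _ = _ := by ring
      exact le_of_mul_le_mul_right a1 (by positivity)
    · rw [← hD]; linarith
  · push Not at hA
    have hk2 : 5 * 10 ^ 7 ≤ k := by
      by_contra! h
      have : 187142400 * L * k ≤ 187142400 * M ^ 2 * k := by gcongr
      have : M ^ 2 * k ≤ M ^ 2 * (5 * 10 ^ 7) := by gcongr
      nlinarith [sq_nonneg M]
    by_cases hsk : 2 * s ≤ k
    · exact ⟨0, by simp; linarith, by simp; linarith, by simp; linarith, Or.inr (by simpa using hsk)⟩
    push Not at hsk
    obtain ⟨n, hn1, hn2⟩ := exists_nat_pow_near (x := 2 * s / k) (y := (8:ℝ))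
      (by rw [le_div_iff₀ (by positivity)]; linarith) (by norm_num)
    rw [le_div_iff₀ (by positivity)] at hn1
    rw [div_lt_iff₀ (by positivity)] at hn2
    have e8 : (8:ℝ) ^ (n + 1) = ((2:ℝ) ^ (n + 1)) ^ 3 := by rw [← pow_mul, mul_comm, pow_mul]; norm_num
    set D := (2:ℝ) ^ (n + 1) with hD
    have hD0 : 0 < D := by positivity
    have hDu : D ^ 3 * k ≤ 16 * s := by rw [← e8, pow_succ]; linarith
    have hDu3 : D ^ 3 * k ^ 3 ≤ 32 * 10 ^ 8 * L * M := by
      calc D ^ 3 * k ^ 3 = D ^ 3 * k * k ^ 2 := by ring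
        _ ≤ 16 * s * k ^ 2 := by gcongr
        _ ≤ _ := by linarith
    refine ⟨n + 1, ?_, ?_, ?_, Or.inr (by rw [← hD, ← e8]; linarith)⟩
    · rw [← hD]
      refine le_of_pow_le_pow_left₀ (n := 3) (by norm_num) (by positivity) ?_
      have b : 10 ^ 16 * L ^ 3 ≤ (s * k ^ 2) ^ 2 := by
        calc 10 ^ 16 * L ^ 3 = 10 ^ 16 * L ^ 2 * L := by ring
          _ ≤ 10 ^ 16 * L ^ 2 * M ^ 2 := by gcongr
          _ = (10 ^ 8 * L * M) ^ 2 := by ring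
          _ ≤ _ := by gcongr
      have a1 : (32400 * D * L) ^ 3 * k ≤ (s * k) ^ 3 * k := by
        calc (32400 * D * L) ^ 3 * k = 32400 ^ 3 * L ^ 3 * (D ^ 3 * k) := by ring
          _ ≤ 32400 ^ 3 * L ^ 3 * (16 * s) := by gcongr
          _ = s * (10 ^ 16 * L ^ 3) * (16 * 32400 ^ 3 / 10 ^ 16) := by ring
          _ ≤ s * (10 ^ 16 * L ^ 3) * 1 := by gcongr; norm_num
          _ ≤ s * (s * k ^ 2) ^ 2 * 1 := by gcongr
          _ = _ := by ring
      exact le_of_mul_le_mul_right a1 hk0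
    · rw [← hD]
      refine le_of_pow_le_pow_left₀ (n := 3) (by norm_num) (by positivity) ?_
      have a1 : (453600 * D ^ 2) ^ 3 * k ^ 6 ≤ L ^ 3 * k ^ 6 := by
        calc (453600 * D ^ 2) ^ 3 * k ^ 6 = 453600 ^ 3 * (D ^ 3 * k ^ 3) ^ 2 := by ring
          _ ≤ 453600 ^ 3 * (32 * 10 ^ 8 * L * M) ^ 2 := by gcongr
          _ = 453600 ^ 3 * 1024 * L ^ 2 * (10 ^ 16 * M ^ 2) := by ring
          _ ≤ 453600 ^ 3 * 1024 * L ^ 2 * (187142400 * L * k) := by gcongr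
          _ = L ^ 3 * k * (453600 ^ 3 * 1024 * 187142400) := by ring
          _ ≤ L ^ 3 * k * (5 * 10 ^ 7) ^ 5 := by gcongr; norm_num
          _ ≤ L ^ 3 * k * k ^ 5 := by gcongr
          _ = _ := by ring
      exact le_of_mul_le_mul_right a1 (by positivity)
    · rw [← hD]
      refine le_of_pow_le_pow_left₀ (n := 3) (by norm_num) (by positivity) ?_
      have a1 : (1440 * D * M) ^ 3 * k ^ 3 ≤ (10 ^ 8 * L) ^ 3 * k ^ 3 := by
        calc (1440 * D * M) ^ 3 * k ^ 3 = 1440 ^ 3 * M ^ 3 * (D ^ 3 * k ^ 3) := by ring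
          _ ≤ 1440 ^ 3 * M ^ 3 * (32 * 10 ^ 8 * L * M) := by gcongr
          _ = 1440 ^ 3 * 32 * 10 ^ 8 * L * (10 ^ 16 * M ^ 2) ^ 2 / 10 ^ 32 := by ring
          _ ≤ 1440 ^ 3 * 32 * 10 ^ 8 * L * (187142400 * L * k) ^ 2 / 10 ^ 32 := by gcongr
          _ = L ^ 3 * k ^ 2 * (1440 ^ 3 * 32 * 10 ^ 8 * 187142400 ^ 2 / 10 ^ 32) := by ring
          _ ≤ L ^ 3 * k ^ 2 * (10 ^ 24 * (5 * 10 ^ 7)) := by gcongr; norm_num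
          _ ≤ L ^ 3 * k ^ 2 * (10 ^ 24 * k) := by gcongr
          _ = _ := by ring
      exact le_of_mul_le_mul_right a1 (by positivity)

end AR
end GK

namespace GK
section TT
open Finset

open Classical in
lemma cells (S : Finset V3) (Ls : Finset Ln) (I : ℕ) : ∃ P : MP, P ≠ 0 ∧ P.totalDegree ≤ 18 * 2 ^ I ∧
    ∃ (Sg : Finset (Fin (3 * I) → SignType)) (A : (Fin (3 * I) → SignType) → Finset V3) (B : (Fin (3 * I) → SignType) → Finset Ln),
      (∀ x ∈ S, P.eval x ≠ 0 → ∃ σ ∈ Sg, x ∈ A σ) ∧ (∀ σ ∈ Sg, A σ ⊆ S ∧ B σ ⊆ Ls ∧ #(A σ) * 8 ^ I ≤ #S ∧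
        ∀ x ∈ A σ, ∀ l ∈ Ls, On x l → l ∈ B σ) ∧ ∑ σ ∈ Sg, #(B σ) ≤ #Ls * (18 * 2 ^ I + 1) := by
  obtain ⟨P, h0, h1, h2⟩ := partition S I
  refine ⟨∏ k, P k, prod_ne_zero_iff.2 fun k _ => h0 k, (MvPolynomial.totalDegree_finsetProd _ _).trans h1,
    ({σ | ∀ k, σ k ≠ 0} : Finset (Fin (3 * I) → SignType)), fun σ => {x ∈ S | ∀ k, SignType.sign ((P k).eval x) = σ k},
    fun σ => {l ∈ Ls | ∃ x, On x l ∧ ∀ k, SignType.sign ((P k).eval x) = σ k}, ?_, ?_, ?_⟩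
  · intro x hx hne
    rw [map_prod, prod_ne_zero_iff] at hne
    refine ⟨fun k => SignType.sign ((P k).eval x), ?_, ?_⟩
    · simp only [mem_filter, mem_univ, true_and]
      intro k
      exact sign_ne_zero.2 (hne k (mem_univ k))
    · simp [hx]
  · intro σ hσ
    simp only [mem_filter, mem_univ, true_and] at hσ
    refine ⟨filter_subset _ _, filter_subset _ _, ?_, ?_⟩
    · have := h2 σ hσ
      convert this
    · intro x hx l hl ho
      exact mem_filter.2 ⟨hl, x, ho, (mem_filter.1 hx).2⟩
  · have := sum_card_bipartiteAbove_eq_sum_card_bipartiteBelow (s := ({σ | ∀ k, σ k ≠ 0} : Finset (Fin (3 * I) → SignType))) (t := Ls)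
      (fun σ l => ∃ x, On x l ∧ ∀ k, SignType.sign ((P k).eval x) = σ k)
    unfold bipartiteAbove bipartiteBelow at this
    rw [this]
    refine (sum_le_card_nsmul _ _ (18 * 2 ^ I + 1) fun l _ => ?_).trans (by rw [smul_eq_mul])
    have := cells_le P l
    rw [filter_filter]
    refine le_trans ?_ (this.trans (Nat.add_le_add_right h1 1))
    exact le_of_eq (by congr!)

set_option maxHeartbeats 1000000 in
open Classical in
theorem incid (M : ℕ) : ∀ (n : ℕ) (Ls : Finset Ln), #Ls = n → Lines Ls → #Ls ≤ M ^ 2 →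
    (∀ Q : MP, Q ≠ 0 → Q.totalDegree ≤ 2 → #{l ∈ Ls | restr l Q = 0} ≤ M) →
    ∀ k, 2 ≤ k → k ≤ M → ∀ S : Finset V3, (∀ x ∈ S, k ≤ #{l ∈ Ls | On x l}) → #S * k ^ 2 ≤ 10 ^ 8 * #Ls * M := by
  intro n
  induction n using Nat.strong_induction_on with
  | _ n ih =>
  intro Ls hn hL hLM hM k hk hkM S0 hS0
  by_contra! hcon
  have hkL : k ≤ #Ls := by
    have : S0.Nonempty := by
      rw [← card_pos]; by_contra h
      have : #S0 = 0 := by omega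
      rw [this] at hcon; omega
    obtain ⟨x, hx⟩ := this
    exact (hS0 x hx).trans (card_le_card (filter_subset _ _))
  obtain ⟨S, hSS, hS1, hS2⟩ : ∃ S ⊆ S0, 10 ^ 8 * #Ls * M < #S * k ^ 2 ∧ #S * k ^ 2 ≤ 2 * 10 ^ 8 * #Ls * M := by
    have hk2 : 0 < k ^ 2 := by positivity
    set q := 10 ^ 8 * #Ls * M / k ^ 2 with hq
    have g1 : q * k ^ 2 ≤ 10 ^ 8 * #Ls * M := Nat.div_mul_le_self _ _
    have g2 : 10 ^ 8 * #Ls * M < (q + 1) * k ^ 2 := by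
      have := Nat.lt_mul_div_succ (10 ^ 8 * #Ls * M) hk2
      rw [← hq] at this; linarith
    have g3 : q + 1 ≤ #S0 := by
      by_contra! h
      have : #S0 * k ^ 2 ≤ q * k ^ 2 := Nat.mul_le_mul_right _ (by omega)
      omega
    obtain ⟨S, h, hc⟩ := exists_subset_card_eq g3
    refine ⟨S, h, by rw [hc]; exact g2, ?_⟩
    rw [hc]
    have : k ^ 2 ≤ #Ls * M := by rw [sq]; exact Nat.mul_le_mul hkL hkM
    nlinarith
  have hS : ∀ x ∈ S, k ≤ #{l ∈ Ls | On x l} := fun x hx => hS0 x (hSS hx)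
  have hp := pairs hL hS
  have hk1 : k ^ 2 ≤ 2 * (k * (k - 1)) := by
    obtain ⟨j, rfl⟩ : ∃ j, k = j + 2 := ⟨k - 2, by omega⟩
    simp; nlinarith
  have hp2 : ∀ (A : Finset V3) (B : Finset Ln), B ⊆ Ls → (∀ x ∈ A, k ≤ #{l ∈ B | On x l}) → #A * k ^ 2 ≤ 2 * #B ^ 2 := by
    intro A B hB hA
    have := pairs (hL.mono hB) hA
    calc #A * k ^ 2 ≤ #A * (2 * (k * (k - 1))) := Nat.mul_le_mul_left _ hk1
      _ = 2 * (#A * (k * (k - 1))) := by ring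
      _ ≤ _ := by omega
  have hLpos : 0 < #Ls := by omega
  have h3 : 10 ^ 8 * M < 2 * #Ls := by
    have := hp2 S Ls subset_rfl hS
    by_contra! h
    have : #Ls * (2 * #Ls) ≤ #Ls * (10 ^ 8 * M) := Nat.mul_le_mul_left _ h
    nlinarith
  obtain ⟨I, R1, R2, R3, R4⟩ := arith (L := #Ls) (s := #S) (k := k) (M := M) (by exact_mod_cast hk) (by exact_mod_cast hkM)
    (by exact_mod_cast hLM) (by exact_mod_cast hS1) (by exact_mod_cast hS2) (by exact_mod_cast h3)
  obtain ⟨P, hP0, hPd, Sg, A, B, hc1, hc2, hc3⟩ := cells S Ls I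
  have hrich : ∀ σ ∈ Sg, ∀ x ∈ A σ, k ≤ #{l ∈ B σ | On x l} := by
    intro σ hσ x hx
    obtain ⟨a1, a2, a3, a4⟩ := hc2 σ hσ
    refine (hS x (a1 hx)).trans (card_le_card fun l hl => ?_)
    obtain ⟨g1, g2⟩ := mem_filter.1 hl
    exact mem_filter.2 ⟨a4 x hx l g1 g2, g2⟩
  set D : ℝ := (2:ℝ) ^ I with hD
  have hD1 : 1 ≤ D := one_le_pow₀ (by norm_num)
  have e8 : (8:ℝ) ^ I = D ^ 3 := by rw [hD, ← pow_mul, mul_comm, pow_mul]; norm_num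
  have hk0 : (0:ℝ) < k := by exact_mod_cast (by omega : 0 < k)
  have hL0 : (0:ℝ) < #Ls := by exact_mod_cast hLpos
  have hSpos : 0 < #S := by
    by_contra h
    have : #S = 0 := by omega
    rw [this] at hS1; omega
  have hs0 : (0:ℝ) < #S := by exact_mod_cast hSpos
  have hsB : ∑ σ ∈ Sg, (#(B σ) : ℝ) ≤ 19 * #Ls * D := by
    have : ((∑ σ ∈ Sg, #(B σ) : ℕ) : ℝ) ≤ #Ls * (18 * 2 ^ I + 1) := by exact_mod_cast hc3
    push_cast at this
    rw [← hD] at this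
    nlinarith
  have hoff : 2 * ∑ σ ∈ Sg, (#(A σ) : ℝ) ≤ #S := by
    have hA3 : ∀ σ ∈ Sg, (#(A σ) : ℝ) * D ^ 3 ≤ #S := by
      intro σ hσ
      rw [← e8]; exact_mod_cast (hc2 σ hσ).2.2.1
    refine le_of_mul_le_mul_right (a := (k:ℝ)) ?_ hk0
    rcases R4 with R4 | R4
    · set t := Real.sqrt (2 * #S / D ^ 3) with ht
      have ht2 : t ^ 2 * D ^ 3 = 2 * #S := by
        rw [ht, Real.sq_sqrt (by positivity)]; field_simp
      have ht0 : 0 ≤ t := Real.sqrt_nonneg _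
      have g1 : ∀ σ ∈ Sg, (#(A σ) : ℝ) * k ≤ t * #(B σ) := by
        intro σ hσ
        refine le_of_pow_le_pow_left₀ (n := 2) (by norm_num) (by positivity) ?_
        have w1 : (#(A σ) : ℝ) * k ^ 2 ≤ 2 * (#(B σ)) ^ 2 := by
          exact_mod_cast hp2 (A σ) (B σ) (hc2 σ hσ).2.1 (hrich σ hσ)
        have w2 := hA3 σ hσ
        refine le_of_mul_le_mul_right (a := D ^ 3) ?_ (by positivity)
        calc ((#(A σ) : ℝ) * k) ^ 2 * D ^ 3 = (#(A σ) * D ^ 3 : ℝ) * (#(A σ) * k ^ 2) := by ring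
          _ ≤ (#S : ℝ) * (2 * (#(B σ)) ^ 2) := by gcongr
          _ = (t ^ 2 * D ^ 3) * (#(B σ)) ^ 2 := by rw [ht2]; ring
          _ = _ := by ring
      have g2 : (∑ σ ∈ Sg, (#(A σ) : ℝ)) * k ≤ t * (19 * #Ls * D) := by
        rw [sum_mul]
        refine (sum_le_sum g1).trans ?_
        rw [← mul_sum]; gcongr
      have g3 : t * (38 * #Ls * D) ≤ #S * k := by
        refine le_of_pow_le_pow_left₀ (n := 2) (by norm_num) (by positivity) ?_
        refine le_of_mul_le_mul_right (a := D) ?_ (by positivity)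
        calc (t * (38 * #Ls * D)) ^ 2 * D = (t ^ 2 * D ^ 3 : ℝ) * (1444 * #Ls ^ 2) := by ring
          _ = (#S * #Ls : ℝ) * (2888 * #Ls) := by rw [ht2]; ring
          _ ≤ (#S * #Ls : ℝ) * (10 ^ 8 * M * D) := by gcongr
          _ = (#S * D : ℝ) * (10 ^ 8 * #Ls * M) := by ring
          _ ≤ (#S * D : ℝ) * (#S * k ^ 2) := by
            have : (10 ^ 8 * #Ls * M : ℝ) ≤ #S * k ^ 2 := by exact_mod_cast hS1.le
            gcongr
          _ = _ := by ring
      linarith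
    · have g1 : ∀ σ ∈ Sg, (#(A σ) : ℝ) * k ≤ 2 * #(B σ) := by
        intro σ hσ
        have : 2 * #(A σ) ≤ k := by
          have w := hA3 σ hσ
          have : (2 * #(A σ) : ℝ) ≤ k := by
            refine le_of_mul_le_mul_right (a := D ^ 3) ?_ (by positivity)
            linarith
          exact_mod_cast this
        exact_mod_cast few (hL.mono (hc2 σ hσ).2.1) (hrich σ hσ) this
      have g2 : (∑ σ ∈ Sg, (#(A σ) : ℝ)) * k ≤ 2 * (19 * #Ls * D) := by
        rw [sum_mul]
        refine (sum_le_sum g1).trans ?_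
        rw [← mul_sum]; gcongr
      have : 0 < D * #Ls := by positivity
      linarith
  let S1 : Finset V3 := {x ∈ S | P.eval x = 0}
  have hS1c : (#S : ℝ) ≤ 2 * #S1 := by
    have e : #S1 + #{x ∈ S | ¬ P.eval x = 0} = #S := card_filter_add_card_filter_not _
    have h : #{x ∈ S | ¬ P.eval x = 0} ≤ ∑ σ ∈ Sg, #(A σ) := by
      refine (card_le_card (t := Sg.biUnion A) fun x hx => ?_).trans card_biUnion_le
      obtain ⟨g1, g2⟩ := mem_filter.1 hx
      exact mem_biUnion.2 (hc1 x g1 g2)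
    have e' : (#S1 : ℝ) + #{x ∈ S | ¬ P.eval x = 0} = #S := by exact_mod_cast e
    have h' : (#{x ∈ S | ¬ P.eval x = 0} : ℝ) ≤ ∑ σ ∈ Sg, (#(A σ) : ℝ) := by exact_mod_cast h
    linarith
  obtain ⟨E, hEL, hEc, S3, -, hS3r, hfin⟩ := surface hP0 hL (S1 := S1) (fun x hx => (mem_filter.1 hx).2) (M := M) hk
    (k' := max 2 ((k + 1) / 2)) rfl (fun x hx => hS x (mem_filter.1 hx).1) hM
  set d := P.totalDegree with hd
  have hdD : (d : ℝ) ≤ 18 * D := by rw [hD]; exact_mod_cast hPd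
  have hd0 : (0:ℝ) ≤ d := by positivity
  have R1' : 1800 * (d:ℝ) * #Ls ≤ #S * k := by
    calc 1800 * (d:ℝ) * #Ls ≤ 1800 * (18 * D) * #Ls := by gcongr
      _ ≤ _ := by linarith
  have R2' : 1400 * (d:ℝ) ^ 2 ≤ #Ls := by
    calc 1400 * (d:ℝ) ^ 2 ≤ 1400 * (18 * D) ^ 2 := by gcongr
      _ ≤ _ := by linarith
  have R3' : 80 * (d:ℝ) * M ≤ 10 ^ 8 * #Ls := by
    calc 80 * (d:ℝ) * M ≤ 80 * (18 * D) * M := by gcongr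
      _ ≤ _ := by linarith
  have hE14 : 14 * (#E : ℝ) ≤ #Ls := by
    have : (#E : ℝ) ≤ 100 * d ^ 2 := by exact_mod_cast hEc
    linarith
  have hElt : #E < n := by
    rw [← hn]
    have : (#E : ℝ) < #Ls := by linarith [(by positivity : (0:ℝ) ≤ #E)]
    exact_mod_cast this
  have hih := ih #E hElt E rfl (hL.mono hEL) ((card_le_card hEL).trans hLM)
    (fun Q h h' => (card_le_card (filter_subset_filter _ hEL)).trans (hM Q h h')) (max 2 ((k + 1) / 2)) (le_max_left _ _)
    (by omega) S3 hS3r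
  have hkk : k ^ 2 ≤ 4 * (max 2 ((k + 1) / 2)) ^ 2 := by
    have : k ≤ 2 * max 2 ((k + 1) / 2) := by omega
    calc k ^ 2 ≤ (2 * max 2 ((k + 1) / 2)) ^ 2 := Nat.pow_le_pow_left this 2
      _ = _ := by ring
  have f1 : (#S3 : ℝ) * k ^ 2 ≤ 4 * (10 ^ 8 * #E * M) := by
    have : #S3 * k ^ 2 ≤ 4 * (10 ^ 8 * #E * M) := by
      calc #S3 * k ^ 2 ≤ #S3 * (4 * (max 2 ((k + 1) / 2)) ^ 2) := Nat.mul_le_mul_left _ hkk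
        _ = 4 * (#S3 * (max 2 ((k + 1) / 2)) ^ 2) := by ring
        _ ≤ _ := Nat.mul_le_mul_left _ hih
    exact_mod_cast this
  have f2 : (#S1 : ℝ) * k ^ 2 ≤ #S3 * k ^ 2 + 36 * #Ls * d * k + 8 * d * M ^ 2 := by exact_mod_cast hfin
  have f3 : (10 ^ 8 * #Ls * M : ℝ) < #S * k ^ 2 := by exact_mod_cast hS1
  have hM0 : (0:ℝ) ≤ M := by positivity
  have t1 : 36 * #Ls * d * k ≤ (0.02 : ℝ) * (#S * k ^ 2) := by
    have := mul_le_mul_of_nonneg_right R1' hk0.le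
    linarith
  have t2 : 8 * d * (M:ℝ) ^ 2 ≤ 0.1 * (#S * k ^ 2) := by
    have := mul_le_mul_of_nonneg_right R3' hM0
    linarith
  have t3 : 4 * (10 ^ 8 * #E * M) ≤ (0.3 : ℝ) * (#S * k ^ 2) := by
    have := mul_le_mul_of_nonneg_right hE14 hM0
    have : 0 ≤ (#E : ℝ) * M := by positivity
    linarith
  have t4 : (#S : ℝ) * k ^ 2 ≤ 2 * (#S1 * k ^ 2) := by
    have := mul_le_mul_of_nonneg_right hS1c (sq_nonneg (k:ℝ))
    linarith
  have : (0:ℝ) < #S * k ^ 2 := by positivity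
  linarith

end TT
end GK

namespace GK
section HY
open Finset UpperHalfPlane

abbrev V4 := Fin 4 → ℝ

def mem (a c : ℍ) (v : V4) : Prop :=
  v 0 * a.re + v 1 = c.re * (v 2 * a.re + v 3) - c.im * (v 2 * a.im) ∧
  v 0 * a.im = c.re * (v 2 * a.im) + c.im * (v 2 * a.re + v 3)

def Lam (a c : ℍ) (p q : ℝ) : V4 :=
  ![c.re * q + c.im * p, a.im * (c.re * p - c.im * q) - a.re * (c.re * q + c.im * p), q, a.im * p - a.re * q]

lemma mem_Lam (a c : ℍ) (p q : ℝ) : mem a c (Lam a c p q) := by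
  constructor <;> simp [Lam] <;> ring

lemma exists_Lam {a c : ℍ} {v : V4} (h : mem a c v) : ∃ p q, v = Lam a c p q := by
  have ha : a.im ≠ 0 := a.im_pos.ne'
  refine ⟨(v 3 + a.re * v 2) / a.im, v 2, ?_⟩
  obtain ⟨h1, h2⟩ := h
  have h0 : v 0 = c.re * v 2 + c.im * ((v 3 + a.re * v 2) / a.im) := by
    field_simp
    linear_combination h2
  have e : a.im * ((v 3 + a.re * v 2) / a.im) = v 3 + a.re * v 2 := by field_simp
  funext i; fin_cases i
  · exact h0
  · simp [Lam]
    rw [← h0]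
    linear_combination h1 - c.re * e
  · simp [Lam]
  · simp [Lam]; linear_combination - e

lemma mem_lin {a c : ℍ} {v w : V4} (hv : mem a c v) (hw : mem a c w) (s t : ℝ) : mem a c (s • v + t • w) := by
  obtain ⟨h1, h2⟩ := hv
  obtain ⟨h3, h4⟩ := hw
  constructor <;> simp
  · linear_combination s * h1 + t * h3
  · linear_combination s * h2 + t * h4

lemma Lam_lin (a c : ℍ) (p q p' q' s t : ℝ) : s • Lam a c p q + t • Lam a c p' q' = Lam a c (s * p + t * p') (s * q + t * q') := by
  funext i; fin_cases i <;> simp [Lam] <;> ring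

lemma eq_of_Lam {a c a' c' : ℍ} (h1 : mem a' c' (Lam a c 1 0)) (h2 : mem a' c' (Lam a c 0 1)) : a = a' ∧ c = c' := by
  obtain ⟨h1, h3⟩ := h1
  obtain ⟨h2, h4⟩ := h2
  simp [Lam] at h1 h2 h3 h4
  have ha := a.im_pos
  have ha' := a'.im_pos
  have hc := c.im_pos
  have hc' := c'.im_pos
  have hx : a'.re - a.re = 0 := by
    have : (a'.re - a.re) * (2 * c.im * a'.im) = 0 := by
      linear_combination a'.im * h1 - a.im * h4 + (a'.re - a.re) * h3
    rcases mul_eq_zero.1 this with h | h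
    · exact h
    · have : 0 < 2 * c.im * a'.im := by positivity
      linarith
  have hx' : a'.re = a.re := by linarith
  rw [hx'] at h1 h2 h4
  have hX : c.re = c'.re := by
    have : a.im * (c.re - c'.re) = 0 := by linear_combination h1
    have := (mul_eq_zero.1 this).resolve_left ha.ne'
    linarith
  have hy : a.im = a'.im := by
    have : c.im * (a.im - a'.im) * (a.im + a'.im) = 0 := by
      linear_combination -a.im * h2 - a'.im * h3
    rcases mul_eq_zero.1 this with h | h
    · have := (mul_eq_zero.1 h).resolve_left hc.ne'
      linarith
    · linarith
  rw [← hy] at h3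
  have hY : c.im = c'.im := by
    have : a.im * (c.im - c'.im) = 0 := by linear_combination h3
    have := (mul_eq_zero.1 this).resolve_left ha.ne'
    linarith
  exact ⟨UpperHalfPlane.ext (Complex.ext hx'.symm hy), UpperHalfPlane.ext (Complex.ext hX hY)⟩

lemma eq_of_mem {a c c' : ℍ} {v : V4} (hv : v ≠ 0) (h : mem a c v) (h' : mem a c' v) : c = c' := by
  obtain ⟨p, q, rfl⟩ := exists_Lam h
  obtain ⟨h1, h2⟩ := h'
  simp [Lam] at h1 h2
  have ha := a.im_pos
  have e1 : p * (c.re - c'.re) - q * (c.im - c'.im) = 0 := by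
    have : a.im * (p * (c.re - c'.re) - q * (c.im - c'.im)) = 0 := by linear_combination h1
    exact (mul_eq_zero.1 this).resolve_left ha.ne'
  have e2 : q * (c.re - c'.re) + p * (c.im - c'.im) = 0 := by
    have : a.im * (q * (c.re - c'.re) + p * (c.im - c'.im)) = 0 := by linear_combination h2
    exact (mul_eq_zero.1 this).resolve_left ha.ne'
  have hpq : p ^ 2 + q ^ 2 ≠ 0 := by
    intro h0
    have hp : p = 0 := by nlinarith [sq_nonneg p, sq_nonneg q]
    have hq : q = 0 := by nlinarith [sq_nonneg p, sq_nonneg q]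
    apply hv
    funext i; fin_cases i <;> simp [Lam, hp, hq]
  have f1 : c.re - c'.re = 0 := by
    have : (p ^ 2 + q ^ 2) * (c.re - c'.re) = 0 := by linear_combination p * e1 + q * e2
    exact (mul_eq_zero.1 this).resolve_left hpq
  have f2 : c.im - c'.im = 0 := by
    have : (p ^ 2 + q ^ 2) * (c.im - c'.im) = 0 := by linear_combination p * e2 - q * e1
    exact (mul_eq_zero.1 this).resolve_left hpq
  exact UpperHalfPlane.ext (Complex.ext (by simpa using sub_eq_zero.1 f1) (by simpa using sub_eq_zero.1 f2))

/-- two equal distances give a common vector -/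
lemma common {a b c e : ℍ} (hab : a ≠ b) (hd : dist a b = dist c e) : ∃ v : V4, v ≠ 0 ∧ mem a c v ∧ mem b e v := by
  have h1 := tanh_half_dist a b
  rw [hd, tanh_half_dist c e] at h1
  set m : ℂ := ((c:ℂ) - e) * (b - (starRingEnd ℂ) a) with hm
  set n : ℂ := ((starRingEnd ℂ) c - e) * (b - a) with hn
  have hconj : ∀ z w : ℍ, dist (z:ℂ) ((starRingEnd ℂ) w) = ‖(starRingEnd ℂ) (z:ℂ) - w‖ := by
    intro z w
    rw [dist_eq_norm, ← Complex.norm_conj]; simp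
  have hpos : ∀ z w : ℍ, 0 < dist (z:ℂ) ((starRingEnd ℂ) w) := by
    intro z w
    rw [dist_pos]
    intro h
    have := congrArg Complex.im h
    simp at this
    have h1 := z.im_pos
    have h2 := w.im_pos
    linarith
  have hmn : ‖m‖ = ‖n‖ := by
    rw [div_eq_div_iff (hpos _ _).ne' (hpos _ _).ne', hconj a b, hconj c e, dist_eq_norm, dist_eq_norm] at h1
    rw [hm, hn, norm_mul, norm_mul, norm_sub_rev (b:ℂ), norm_sub_rev (b:ℂ) a, h1, mul_comm]
  obtain ⟨u, hu, hum⟩ : ∃ u : ℂ, u ≠ 0 ∧ u * m = (starRingEnd ℂ) u * n := by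
    by_cases h0 : m = 0
    · rw [h0, norm_zero, eq_comm, norm_eq_zero] at hmn
      exact ⟨1, one_ne_zero, by simp [h0, hmn]⟩
    · have hq : (starRingEnd ℂ) m * m = (starRingEnd ℂ) n * n := by
        rw [← Complex.normSq_eq_conj_mul_self, ← Complex.normSq_eq_conj_mul_self, Complex.normSq_eq_norm_sq, Complex.normSq_eq_norm_sq, hmn]
      by_cases h1 : (starRingEnd ℂ) m + n = 0
      · refine ⟨Complex.I * (starRingEnd ℂ) m, mul_ne_zero Complex.I_ne_zero (by simpa using h0), ?_⟩
        have : n = - (starRingEnd ℂ) m := by linear_combination h1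
        rw [this]; simp; ring
      · refine ⟨_, h1, ?_⟩
        simp
        linear_combination hq
  refine ⟨Lam a c (u.re) (u.im), ?_, mem_Lam _ _ _ _, ?_⟩
  · intro h
    have h2 := congrFun h 2
    have h3 := congrFun h 3
    simp [Lam] at h2 h3
    rw [h2] at h3
    simp [a.im_pos.ne'] at h3
    exact hu (Complex.ext h3 h2)
  · have r1 := congrArg Complex.re hum
    have r2 := congrArg Complex.im hum
    simp [hm, hn] at r1 r2
    constructor <;> simp [Lam]
    · linear_combination (1/2) * r2
    · linear_combination (-1/2) * r1

end HY
end GK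

namespace GK
section QF
open Finset UpperHalfPlane

def qf (f : Fin 10 → ℝ) (v : V4) : ℝ := f 0 * v 0 ^ 2 + f 1 * v 1 ^ 2 + f 2 * v 2 ^ 2 + f 3 * v 3 ^ 2 + f 4 * (v 0 * v 1) +
  f 5 * (v 0 * v 2) + f 6 * (v 0 * v 3) + f 7 * (v 1 * v 2) + f 8 * (v 1 * v 3) + f 9 * (v 2 * v 3)

def van (f : Fin 10 → ℝ) (a c : ℍ) : Prop := ∀ p q, qf f (Lam a c p q) = 0

lemma three_roots {A B C c1 c2 c3 : ℂ} (h1 : A * c1 ^ 2 + B * c1 + C = 0) (h2 : A * c2 ^ 2 + B * c2 + C = 0)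
    (h3 : A * c3 ^ 2 + B * c3 + C = 0) (h12 : c1 ≠ c2) (h13 : c1 ≠ c3) (h23 : c2 ≠ c3) : A = 0 ∧ B = 0 ∧ C = 0 := by
  have e1 : A * (c1 + c2) + B = 0 := by
    have : (c1 - c2) * (A * (c1 + c2) + B) = 0 := by linear_combination h1 - h2
    exact (mul_eq_zero.1 this).resolve_left (sub_ne_zero.2 h12)
  have e2 : A * (c1 + c3) + B = 0 := by
    have : (c1 - c3) * (A * (c1 + c3) + B) = 0 := by linear_combination h1 - h3
    exact (mul_eq_zero.1 this).resolve_left (sub_ne_zero.2 h13)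
  have hA : A = 0 := by
    have : A * (c2 - c3) = 0 := by linear_combination e1 - e2
    exact (mul_eq_zero.1 this).resolve_right (sub_ne_zero.2 h23)
  have hB : B = 0 := by rw [hA] at e1; simpa using e1
  exact ⟨hA, hB, by rw [hA, hB] at h1; simpa using h1⟩

def Herm (f : Fin 10 → ℝ) (a : ℍ) : Prop := (f 0 = (a.re ^ 2 + a.im ^ 2) * f 1 ∧ f 4 = 2 * a.re * f 1) ∧
  (f 2 = (a.re ^ 2 + a.im ^ 2) * f 3 ∧ f 9 = 2 * a.re * f 3) ∧ (f 5 = (a.re ^ 2 + a.im ^ 2) * f 8 ∧ f 6 + f 7 = 2 * a.re * f 8)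

lemma herm {f : Fin 10 → ℝ} {a c1 c2 c3 : ℍ} (h1 : van f a c1) (h2 : van f a c2) (h3 : van f a c3)
    (h12 : c1 ≠ c2) (h13 : c1 ≠ c3) (h23 : c2 ≠ c3) : Herm f a := by
  let W : ℝ → ℝ → ℝ → ℂ := fun r s t => ⟨a.im ^ 2 * r - (t - a.re * s + a.re ^ 2 * r), - (a.im * (s - 2 * a.re * r))⟩
  have key : ∀ c : ℍ, van f a c → W (f 1) (f 4) (f 0) * (c:ℂ) ^ 2 + W (f 8) (f 6 + f 7) (f 5) * c + W (f 3) (f 9) (f 2) = 0 := by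
    intro c h
    have e1 := h 1 0
    have e2 := h 0 1
    have e3 := h 1 1
    simp [qf, Lam] at e1 e2 e3
    apply Complex.ext
    · simp [W, sq]
      linear_combination e1 - e2
    · simp [W, sq]
      linear_combination - (e3 - e1 - e2)
  obtain ⟨hA, hB, hC⟩ := three_roots (key c1 h1) (key c2 h2) (key c3 h3) (fun h => h12 (UpperHalfPlane.ext h))
    (fun h => h13 (UpperHalfPlane.ext h)) (fun h => h23 (UpperHalfPlane.ext h))
  have fin : ∀ r s t, W r s t = 0 → t = (a.re ^ 2 + a.im ^ 2) * r ∧ s = 2 * a.re * r := by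
    intro r s t h
    have w1 := congrArg Complex.re h
    have w2 := congrArg Complex.im h
    simp [W, a.im_pos.ne'] at w1 w2
    have : s = 2 * a.re * r := by linarith
    refine ⟨?_, this⟩
    rw [this] at w1
    linear_combination - w1
  exact ⟨fin _ _ _ hA, fin _ _ _ hC, fin _ _ _ hB⟩

lemma herm2 {f : Fin 10 → ℝ} {a a' c : ℍ} (h : Herm f a) (h' : Herm f a') (hne : a ≠ a') (hv : van f a c) : f = 0 := by
  have z : ∀ g t s : ℝ, (t = (a.re ^ 2 + a.im ^ 2) * g ∧ s = 2 * a.re * g) →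
      (t = (a'.re ^ 2 + a'.im ^ 2) * g ∧ s = 2 * a'.re * g) → g = 0 := by
    rintro g t s ⟨h1, h2⟩ ⟨h3, h4⟩
    by_contra hg
    apply hne
    have hx : a.re = a'.re := by
      have : (a.re - a'.re) * g = 0 := by linarith
      have := (mul_eq_zero.1 this).resolve_right hg
      linarith
    have hy : a.im = a'.im := by
      have : (a.im - a'.im) * (a.im + a'.im) * g = 0 := by rw [hx] at h1; linarith
      have := (mul_eq_zero.1 this).resolve_right hg
      have p1 := a.im_pos
      have p2 := a'.im_pos
      rcases mul_eq_zero.1 this with h | h <;> linarith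
    exact UpperHalfPlane.ext (Complex.ext hx hy)
  obtain ⟨h1, h2, h3⟩ := h
  obtain ⟨h1', h2', h3'⟩ := h'
  have z1 := z _ _ _ h1 h1'
  have z3 := z _ _ _ h2 h2'
  have z8 := z _ _ _ h3 h3'
  rw [z1] at h1
  rw [z3] at h2
  rw [z8] at h3
  simp at h1 h2 h3
  have e := hv 1 0
  simp [qf, Lam, h1, h2, h3, z1, z3, z8] at e
  have z6 : f 6 = 0 := by
    rcases e with e | e
    · exact e
    · exact absurd e (by simp [c.im_pos.ne', a.im_pos.ne'])
  funext i
  fin_cases i <;> simp [h1, h2, h3, z1, z3, z8, z6]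
  linarith [h3.2]

open Classical in
lemma quadcount {f : Fin 10 → ℝ} (hf : f ≠ 0) (P : Finset ℍ) : #{ac ∈ P ×ˢ P | van f ac.1 ac.2} ≤ 3 * #P := by
  let R : ℍ → Finset ℍ := fun a => {c ∈ P | van f a c}
  have e : #{ac ∈ P ×ˢ P | van f ac.1 ac.2} = ∑ a ∈ P, #(R a) := by
    simp only [R, card_filter, sum_product]
  have hR : ∀ a, ¬ #(R a) ≤ 2 → Herm f a ∧ ∃ c, van f a c := by
    intro a h
    obtain ⟨c1, c2, c3, h1, h2, h3, h12, h13, h23⟩ := two_lt_card_iff.1 (not_le.1 h)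
    exact ⟨herm (mem_filter.1 h1).2 (mem_filter.1 h2).2 (mem_filter.1 h3).2 h12 h13 h23, c1, (mem_filter.1 h1).2⟩
  have hRN : ∀ a, #(R a) ≤ #P := fun a => card_le_card (filter_subset _ _)
  rw [e]
  by_cases h : ∃ a0 ∈ P, ¬ #(R a0) ≤ 2
  · obtain ⟨a0, ha0, h0⟩ := h
    calc ∑ a ∈ P, #(R a) ≤ ∑ a ∈ P, (2 + if a = a0 then #P else 0) := by
          refine sum_le_sum fun a ha => ?_
          by_cases haa : a = a0
          · simp [haa]; have := hRN a0; omega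
          · simp only [haa, if_false, add_zero]
            by_contra hc
            obtain ⟨c1, c, hc'⟩ := hR a hc
            exact hf (herm2 c1 (hR a0 h0).1 haa hc')
      _ = 3 * #P := by
          rw [sum_add_distrib, sum_ite_eq', if_pos ha0]; simp; ring
  · push Not at h
    calc ∑ a ∈ P, #(R a) ≤ ∑ a ∈ P, 2 := sum_le_sum h
      _ ≤ 3 * #P := by simp; omega

def phi (s : ℝ) (v : V4) : ℝ := v 0 + s * v 1 + s ^ 2 * v 2 + s ^ 3 * v 3
def pr (v : V4) : V3 := ![v 1, v 2, v 3]
def lift (s : ℝ) (x : V3) : V4 := ![1 - s * x 0 - s ^ 2 * x 1 - s ^ 3 * x 2, x 0, x 1, x 2]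

lemma phi_lift (s x) : phi s (lift s x) = 1 := by simp [phi, lift]; ring
lemma pr_lift (s x) : pr (lift s x) = x := by funext i; fin_cases i <;> simp [pr, lift]
lemma lift_pr {s v} (h : phi s v = 1) : lift s (pr v) = v := by
  funext i; fin_cases i <;> simp [pr, lift]
  simp [phi] at h; linarith

lemma quadpoly (s : ℝ) (Q : MP) (hQ : Q.totalDegree ≤ 2) : ∃ f : Fin 10 → ℝ, ∀ v, phi s v = 1 → Q.eval (pr v) = qf f v := by
  rw [Q.as_sum]
  refine Finset.sum_induction _ (fun Q : MP => ∃ f : Fin 10 → ℝ, ∀ v, phi s v = 1 → Q.eval (pr v) = qf f v) ?_ ?_ ?_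
  · rintro Q Q' ⟨f, hf⟩ ⟨f', hf'⟩
    refine ⟨f + f', fun v hv => ?_⟩
    rw [map_add, hf v hv, hf' v hv]; simp [qf]; ring
  · exact ⟨0, fun v hv => by simp [qf]⟩
  · intro m hm
    have hd := (MvPolynomial.le_totalDegree hm).trans hQ
    rw [Finsupp.sum_fintype _ _ (by simp), Fin.sum_univ_three] at hd
    set c := MvPolynomial.coeff m Q
    have hev : ∀ v, MvPolynomial.eval (pr v) (MvPolynomial.monomial m c) = c * (v 1 ^ m 0 * v 2 ^ m 1 * v 3 ^ m 2) := by
      intro v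
      rw [MvPolynomial.eval_monomial, Finsupp.prod_fintype _ _ (by simp), Fin.prod_univ_three]
      simp [pr]
    simp only [hev]
    generalize m 0 = i at *
    generalize m 1 = j at *
    generalize m 2 = k at *
    clear hev hm
    have hi : i ≤ 2 := by omega
    have hj : j ≤ 2 := by omega
    have hk : k ≤ 2 := by omega
    have r1 : ∀ (g : V4 → ℝ) (n : ℕ) (f : Fin 10 → ℝ), (∀ v, g v * phi s v ^ n = qf f v) → ∃ f : Fin 10 → ℝ, ∀ v, phi s v = 1 → c * g v = qf f v := by
      intro g n f h
      refine ⟨c • f, fun v hv => ?_⟩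
      have := h v
      rw [hv, one_pow, mul_one] at this
      rw [this]; simp [qf]; ring
    interval_cases i <;> interval_cases j <;> interval_cases k <;> simp at hd
    · exact r1 _ 2 ![1, s^2, s^4, s^6, 2*s, 2*s^2, 2*s^3, 2*s^3, 2*s^4, 2*s^5] (fun v => by simp [qf, phi]; ring)
    · exact r1 _ 1 ![0, 0, 0, s^3, 0, 0, 1, 0, s, s^2] (fun v => by simp [qf, phi]; ring)
    · exact r1 _ 0 ![0, 0, 0, 1, 0, 0, 0, 0, 0, 0] (fun v => by simp [qf, phi])
    · exact r1 _ 1 ![0, 0, s^2, 0, 0, 1, 0, s, 0, s^3] (fun v => by simp [qf, phi]; ring)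
    · exact r1 _ 0 ![0, 0, 0, 0, 0, 0, 0, 0, 0, 1] (fun v => by simp [qf, phi])
    · exact r1 _ 0 ![0, 0, 1, 0, 0, 0, 0, 0, 0, 0] (fun v => by simp [qf, phi])
    · exact r1 _ 1 ![0, s, 0, 0, 1, 0, 0, s^2, s^3, 0] (fun v => by simp [qf, phi]; ring)
    · exact r1 _ 0 ![0, 0, 0, 0, 0, 0, 0, 0, 1, 0] (fun v => by simp [qf, phi])
    · exact r1 _ 0 ![0, 0, 0, 0, 0, 0, 0, 1, 0, 0] (fun v => by simp [qf, phi])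
    · exact r1 _ 0 ![0, 1, 0, 0, 0, 0, 0, 0, 0, 0] (fun v => by simp [qf, phi])

end QF
end GK

namespace GK
section EN
open Finset UpperHalfPlane

noncomputable def ln (s : ℝ) (a c : ℍ) : Ln := (pr (Lam a c (1 / phi s (Lam a c 1 0)) 0),
  pr (Lam a c (- phi s (Lam a c 0 1) / phi s (Lam a c 1 0)) 1))

lemma phi_Lam (s : ℝ) (a c : ℍ) (p q : ℝ) : phi s (Lam a c p q) = p * phi s (Lam a c 1 0) + q * phi s (Lam a c 0 1) := by
  simp [phi, Lam]; ring

lemma pt_ln (s : ℝ) (a c : ℍ) (t : ℝ) : pt (ln s a c) t =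
    pr (Lam a c (1 / phi s (Lam a c 1 0) + t * (- phi s (Lam a c 0 1) / phi s (Lam a c 1 0))) t) := by
  funext i; fin_cases i <;> simp [pt, ln, pr, Lam] <;> ring

lemma on_ln {s : ℝ} {a c : ℍ} (h : phi s (Lam a c 1 0) ≠ 0) (x : V3) : On x (ln s a c) ↔ mem a c (lift s x) := by
  constructor
  · rintro ⟨t, rfl⟩
    rw [pt_ln, lift_pr]
    · exact mem_Lam _ _ _ _
    · rw [phi_Lam]; field_simp; ring
  · intro hm
    obtain ⟨p, q, hpq⟩ := exists_Lam hm
    refine ⟨q, ?_⟩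
    have h1 := phi_lift s x
    rw [hpq, phi_Lam] at h1
    have : 1 / phi s (Lam a c 1 0) + q * (- phi s (Lam a c 0 1) / phi s (Lam a c 1 0)) = p := by
      field_simp; linarith
    rw [pt_ln, this, ← hpq, pr_lift]

lemma two_on {s : ℝ} {a c a' c' : ℍ} {x y : V3} (hxy : x ≠ y) (h1 : mem a c (lift s x)) (h2 : mem a c (lift s y))
    (h3 : mem a' c' (lift s x)) (h4 : mem a' c' (lift s y)) : a = a' ∧ c = c' := by
  obtain ⟨p, q, hp⟩ := exists_Lam h1
  obtain ⟨p', q', hp'⟩ := exists_Lam h2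
  have f1 := phi_lift s x
  have f2 := phi_lift s y
  rw [hp, phi_Lam] at f1
  rw [hp', phi_Lam] at f2
  set u := phi s (Lam a c 1 0)
  set w := phi s (Lam a c 0 1)
  have hD : p * q' - p' * q ≠ 0 := by
    intro h0
    apply hxy
    have e1 : p = p' := by linear_combination -p * f2 + p' * f1 + w * h0
    have e2 : q = q' := by linear_combination -q * f2 + q' * f1 - u * h0
    rw [← pr_lift s x, ← pr_lift s y, hp, hp', e1, e2]
  rw [hp] at h3
  rw [hp'] at h4
  apply eq_of_Lam
  · have := mem_lin h3 h4 (q' / (p * q' - p' * q)) (- q / (p * q' - p' * q))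
    rw [Lam_lin] at this
    convert this using 2
    · rw [div_mul_eq_mul_div, div_mul_eq_mul_div, ← add_div, eq_div_iff hD]; ring
    · rw [div_mul_eq_mul_div, div_mul_eq_mul_div, ← add_div, eq_div_iff hD]; ring
  · have := mem_lin h3 h4 (- p' / (p * q' - p' * q)) (p / (p * q' - p' * q))
    rw [Lam_lin] at this
    convert this using 2
    · rw [div_mul_eq_mul_div, div_mul_eq_mul_div, ← add_div, eq_div_iff hD]; ring
    · rw [div_mul_eq_mul_div, div_mul_eq_mul_div, ← add_div, eq_div_iff hD]; ring

lemma generic (W : Finset V4) (hW : ∀ v ∈ W, v ≠ 0) : ∃ s, ∀ v ∈ W, phi s v ≠ 0 := by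
  open Polynomial in
  let F : V4 → ℝ[X] := fun v => C (v 0) + C (v 1) * X + C (v 2) * X ^ 2 + C (v 3) * X ^ 3
  have hF : ∀ v, v ≠ 0 → F v ≠ 0 := by
    intro v hv h0
    apply hv
    have c0 := congrArg (fun p => Polynomial.coeff p 0) h0
    have c1 := congrArg (fun p => Polynomial.coeff p 1) h0
    have c2 := congrArg (fun p => Polynomial.coeff p 2) h0
    have c3 := congrArg (fun p => Polynomial.coeff p 3) h0
    simp [F, Polynomial.coeff_X, Polynomial.coeff_C, Polynomial.coeff_X_pow] at c0 c1 c2 c3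
    funext i; fin_cases i <;> simp [c0, c1, c2, c3]
  have hP : ∏ v ∈ W, F v ≠ 0 := prod_ne_zero_iff.2 fun v hv => hF v (hW v hv)
  by_contra! hcon
  apply hP
  refine Polynomial.funext fun s => ?_
  obtain ⟨v, hv, h0⟩ := hcon s
  rw [Polynomial.eval_prod, Polynomial.eval_zero]
  refine prod_eq_zero hv ?_
  rw [← h0]; simp [F, phi]; ring

lemma van_of_restr {s : ℝ} {a c : ℍ} (h : phi s (Lam a c 1 0) ≠ 0) {Q : MP} {f : Fin 10 → ℝ}
    (hf : ∀ v, phi s v = 1 → Q.eval (pr v) = qf f v) (h0 : restr (ln s a c) Q = 0) : van f a c := by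
  rw [restr_zero_iff] at h0
  have g1 : ∀ p q, phi s (Lam a c p q) ≠ 0 → qf f (Lam a c p q) = 0 := by
    intro p q hn
    set r := phi s (Lam a c p q) with hr
    have e : phi s (Lam a c (p / r) (q / r)) = 1 := by
      rw [phi_Lam]; rw [phi_Lam] at hr; field_simp; linarith
    have := hf _ e
    rw [h0 _ ((on_ln h _).2 (by rw [lift_pr e]; exact mem_Lam _ _ _ _))] at this
    have e2 : qf f (Lam a c p q) = r ^ 2 * qf f (Lam a c (p / r) (q / r)) := by
      have : Lam a c p q = r • Lam a c (p / r) (q / r) := by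
        have := Lam_lin a c (p / r) (q / r) 0 0 r 0
        rw [zero_smul, add_zero] at this
        rw [this]
        congr 1 <;> field_simp <;> ring
      rw [this]; simp [qf]; ring
    rw [e2, ← this, mul_zero]
  intro p q
  by_cases hn : phi s (Lam a c p q) = 0
  · have k : ∀ t : ℝ, t ≠ 0 → qf f (Lam a c (p + t) q) = 0 := by
      intro t ht
      apply g1
      rw [phi_Lam] at hn ⊢
      have : (p + t) * phi s (Lam a c 1 0) + q * phi s (Lam a c 0 1) = t * phi s (Lam a c 1 0) := by linarith
      rw [this]; exact mul_ne_zero ht h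
    have k1 := k 1 (by norm_num)
    have k2 := k 2 (by norm_num)
    have k3 := k 3 (by norm_num)
    simp only [qf, Lam] at k1 k2 k3 ⊢
    simp at k1 k2 k3 ⊢
    linear_combination 3 * k1 - 3 * k2 + k3
  · exact g1 p q hn

lemma phi_smul (s t : ℝ) (v : V4) : phi s (t • v) = t * phi s v := by
  simp [phi]; ring

lemma sq_le_sum (m : ℕ) (hm : 2 ≤ m) : m ^ 2 ≤ ∑ k ∈ Icc 2 m, 4 * k := by
  induction m, hm using Nat.le_induction with
  | base => simp
  | succ n hn ih =>
    rw [sum_Icc_succ_top (by omega)]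
    nlinarith

set_option maxHeartbeats 1000000 in
open Classical in
theorem energy (P : Finset ℍ) : (#{q ∈ (P ×ˢ P) ×ˢ (P ×ˢ P) | q.1.1 ≠ q.2.1 ∧ dist q.1.1 q.2.1 = dist q.1.2 q.2.2} : ℝ) ≤
    12 * 10 ^ 8 * (#P : ℝ) ^ 3 * (1 + Real.log #P) := by
  set N := #P with hN
  set Q : Finset ((ℍ × ℍ) × (ℍ × ℍ)) := {q ∈ (P ×ˢ P) ×ˢ (P ×ˢ P) | q.1.1 ≠ q.2.1 ∧ dist q.1.1 q.2.1 = dist q.1.2 q.2.2} with hQ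
  have hv : ∀ q : (ℍ × ℍ) × (ℍ × ℍ), ∃ v : V4, v ≠ 0 ∧ (q ∈ Q → mem q.1.1 q.1.2 v ∧ mem q.2.1 q.2.2 v) := by
    intro q
    by_cases hq : q ∈ Q
    · obtain ⟨-, h1, h2⟩ := mem_filter.1 hq
      obtain ⟨v, hv, h⟩ := common h1 h2
      exact ⟨v, hv, fun _ => h⟩
    · exact ⟨1, one_ne_zero, fun h => absurd h hq⟩
  choose vq hv0 hvm using hv
  obtain ⟨s, hs⟩ := generic (Q.image vq ∪ (P ×ˢ P).image (fun ac => Lam ac.1 ac.2 1 0)) (by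
    intro v hv
    rcases mem_union.1 hv with hv | hv
    · obtain ⟨q, -, rfl⟩ := mem_image.1 hv
      exact hv0 q
    · obtain ⟨ac, -, rfl⟩ := mem_image.1 hv
      intro h0
      have := congrFun h0 0
      simp [Lam] at this
      exact ac.2.im_pos.ne' this)
  have hs1 : ∀ ac ∈ P ×ˢ P, phi s (Lam ac.1 ac.2 1 0) ≠ 0 := fun ac h => hs _ (mem_union_right _ (mem_image_of_mem _ h))
  have hs2 : ∀ q ∈ Q, phi s (vq q) ≠ 0 := fun q h => hs _ (mem_union_left _ (mem_image_of_mem _ h))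
  let g : ℍ × ℍ → Ln := fun ac => ln s ac.1 ac.2
  let Ls : Finset Ln := (P ×ˢ P).image g
  have hon : ∀ ac ∈ P ×ˢ P, ∀ x, On x (g ac) ↔ mem ac.1 ac.2 (lift s x) := fun ac h x => on_ln (hs1 ac h) x
  have hdir : ∀ ac, (g ac).2 ≠ 0 := by
    intro ac h0
    have := congrFun h0 1
    simp [g, ln, pr, Lam] at this
  have h2 : ∀ ac ∈ P ×ˢ P, ∀ ac' ∈ P ×ˢ P, ∀ x y, x ≠ y → On x (g ac) → On x (g ac') → On y (g ac) → On y (g ac') → ac = ac' := by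
    intro ac h ac' h' x y hxy h1 h2 h3 h4
    rw [hon _ h] at h1 h3
    rw [hon _ h'] at h2 h4
    have := two_on hxy h1 h3 h2 h4
    exact Prod.ext this.1 this.2
  have hinj : Set.InjOn g (P ×ˢ P : Finset (ℍ × ℍ)) := by
    intro ac h ac' h' he
    refine h2 ac h ac' h' (pt (g ac) 0) (pt (g ac) 1) (fun h => zero_ne_one (pt_inj (hdir ac) h)) ⟨_, rfl⟩ ⟨0, by rw [he]⟩ ⟨_, rfl⟩ ⟨1, by rw [he]⟩
  have hLc : #Ls = N ^ 2 := by
    rw [card_image_of_injOn hinj, card_product, sq]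
  have hL : Lines Ls := by
    refine ⟨fun l hl => ?_, fun l hl l' hl' hne x y a1 a2 a3 a4 => ?_⟩
    · obtain ⟨ac, -, rfl⟩ := mem_image.1 hl
      exact hdir ac
    · obtain ⟨ac, h, rfl⟩ := mem_image.1 hl
      obtain ⟨ac', h', rfl⟩ := mem_image.1 hl'
      by_contra hxy
      exact hne (by rw [h2 ac h ac' h' x y hxy a1 a2 a3 a4])
  have hM : ∀ F : MP, F ≠ 0 → F.totalDegree ≤ 2 → #{l ∈ Ls | restr l F = 0} ≤ 3 * N := by
    intro F hF hd
    obtain ⟨f, hf⟩ := quadpoly s F hd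
    have hf0 : f ≠ 0 := by
      rintro rfl
      apply hF
      refine MvPolynomial.funext fun x => ?_
      have := hf (lift s x) (phi_lift s x)
      rw [pr_lift] at this
      rw [this]; simp [qf]
    let T : Finset (ℍ × ℍ) := {ac ∈ P ×ˢ P | van f ac.1 ac.2}
    have hT : #T ≤ 3 * N := quadcount hf0 P
    have hT2 : #(T.image g) ≤ #T := card_image_le
    refine le_trans (card_le_card (t := T.image g) ?_) (hT2.trans hT)
    intro l hl
    obtain ⟨hl, h0⟩ := mem_filter.1 hl
    obtain ⟨ac, h, rfl⟩ := mem_image.1 hl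
    exact mem_image_of_mem _ (mem_filter.2 ⟨h, van_of_restr (hs1 ac h) hf h0⟩)
  let xq : (ℍ × ℍ) × (ℍ × ℍ) → V3 := fun q => pr ((1 / phi s (vq q)) • vq q)
  have hxq : ∀ q ∈ Q, On (xq q) (g q.1) ∧ On (xq q) (g q.2) := by
    intro q hq
    obtain ⟨m1, m2⟩ := hvm q hq
    have e : phi s ((1 / phi s (vq q)) • vq q) = 1 := by
      have h0 := hs2 q hq
      have : phi s ((1 / phi s (vq q)) • vq q) = 1 / phi s (vq q) * phi s (vq q) := by
        exact phi_smul _ _ _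
      rw [this]; exact one_div_mul_cancel h0
    have hm := mem_product.1 (mem_filter.1 hq).1
    rw [hon _ hm.1, hon _ hm.2, lift_pr e]
    have w1 := mem_lin m1 m1 (1 / phi s (vq q)) 0
    have w2 := mem_lin m2 m2 (1 / phi s (vq q)) 0
    rw [zero_smul, add_zero] at w1 w2
    exact ⟨w1, w2⟩
  let X := Q.image xq
  let A : V3 → Finset Ln := fun x => {l ∈ Ls | On x l}
  have hQA : #Q ≤ ∑ x ∈ X, #(A x) ^ 2 := by
    have : #Q ≤ #(X.sigma fun x => A x ×ˢ A x) := by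
      refine card_le_card_of_injOn (fun q => ⟨xq q, (g q.1, g q.2)⟩) ?_ ?_
      · intro q hq
        have hm := mem_product.1 (mem_filter.1 hq).1
        have := hxq q hq
        simp only [coe_sigma, Set.mem_sigma_iff, mem_coe, mem_product]
        exact ⟨mem_image_of_mem _ hq, mem_filter.2 ⟨mem_image_of_mem _ hm.1, this.1⟩, mem_filter.2 ⟨mem_image_of_mem _ hm.2, this.2⟩⟩
      · intro q hq q' hq' he
        have hm := mem_product.1 (mem_filter.1 hq).1
        have hm' := mem_product.1 (mem_filter.1 hq').1
        simp only [Sigma.mk.injEq, heq_eq_eq, Prod.mk.injEq] at he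
        exact Prod.ext (hinj hm.1 hm'.1 he.2.1) (hinj hm.2 hm'.2 he.2.2)
    rw [card_sigma] at this
    simpa [card_product, sq] using this
  have hA2 : ∀ x ∈ X, 2 ≤ #(A x) := by
    intro x hx
    obtain ⟨q, hq, rfl⟩ := mem_image.1 hx
    obtain ⟨hm, hne, -⟩ := mem_filter.1 hq
    have hm := mem_product.1 hm
    have := hxq q hq
    refine one_lt_card.2 ⟨g q.1, mem_filter.2 ⟨mem_image_of_mem _ hm.1, this.1⟩, g q.2, mem_filter.2 ⟨mem_image_of_mem _ hm.2, this.2⟩, fun h => ?_⟩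
    exact hne (congrArg Prod.fst (hinj hm.1 hm.2 h))
  have hAN : ∀ x, #(A x) ≤ N := by
    intro x
    refine (card_le_card (t := ({ac ∈ P ×ˢ P | mem ac.1 ac.2 (lift s x)} : Finset _).image g) fun l hl => ?_).trans (card_image_le.trans ?_)
    · obtain ⟨hl, h0⟩ := mem_filter.1 hl
      obtain ⟨ac, h, rfl⟩ := mem_image.1 hl
      exact mem_image_of_mem _ (mem_filter.2 ⟨h, (hon ac h x).1 h0⟩)
    · refine card_le_card_of_injOn Prod.fst (fun ac h => (mem_product.1 (mem_filter.1 h).1).1) ?_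
      rintro ⟨a, c⟩ h ⟨a', c'⟩ h' he
      dsimp at he
      subst he
      have hl0 : lift s x ≠ 0 := by
        intro h0
        have := phi_lift s x
        rw [h0] at this
        simp [phi] at this
      exact congrArg (Prod.mk a) (eq_of_mem hl0 (mem_filter.1 h).2 (mem_filter.1 h').2)
  have hrich : ∀ k ∈ Icc 2 N, ((4 * k * #{x ∈ X | k ≤ #(A x)} : ℕ) : ℝ) ≤ 12 * 10 ^ 8 * (N:ℝ) ^ 3 * (k:ℝ)⁻¹ := by
    intro k hk
    obtain ⟨hk2, hkN⟩ := mem_Icc.1 hk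
    have := incid (3 * N) _ Ls rfl hL (by rw [hLc]; nlinarith) hM k hk2 (by omega) {x ∈ X | k ≤ #(A x)}
      (fun x hx => (mem_filter.1 hx).2)
    rw [hLc] at this
    have h' : (#{x ∈ X | k ≤ #(A x)} : ℝ) * k ^ 2 ≤ 10 ^ 8 * N ^ 2 * (3 * N) := by exact_mod_cast this
    have hk0 : (0:ℝ) < k := by exact_mod_cast (by omega : 0 < k)
    rw [← div_eq_mul_inv, le_div_iff₀ hk0]
    push_cast
    linarith
  have hsum : ∑ x ∈ X, #(A x) ^ 2 ≤ ∑ k ∈ Icc 2 N, 4 * k * #{x ∈ X | k ≤ #(A x)} := by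
    calc ∑ x ∈ X, #(A x) ^ 2 ≤ ∑ x ∈ X, ∑ k ∈ Icc 2 N, if k ≤ #(A x) then 4 * k else 0 := by
          refine sum_le_sum fun x hx => ?_
          rw [← sum_filter]
          refine (sq_le_sum _ (hA2 x hx)).trans (sum_le_sum_of_subset fun k hk => ?_)
          have := mem_Icc.1 hk
          exact mem_filter.2 ⟨mem_Icc.2 ⟨this.1, this.2.trans (hAN x)⟩, this.2⟩
      _ = ∑ k ∈ Icc 2 N, ∑ x ∈ X, if k ≤ #(A x) then 4 * k else 0 := sum_comm
      _ = _ := by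
          refine sum_congr rfl fun k _ => ?_
          rw [← sum_filter, sum_const, smul_eq_mul, mul_comm]
  have hfin : ((∑ k ∈ Icc 2 N, 4 * k * #{x ∈ X | k ≤ #(A x)} : ℕ) : ℝ) ≤ 12 * 10 ^ 8 * (N:ℝ) ^ 3 * (1 + Real.log N) := by
    rw [Nat.cast_sum]
    refine (sum_le_sum hrich).trans ?_
    rw [← mul_sum]
    refine mul_le_mul_of_nonneg_left ?_ (by positivity)
    refine le_trans ?_ (harmonic_le_one_add_log N)
    rw [harmonic_eq_sum_Icc]
    push_cast
    refine sum_le_sum_of_subset_of_nonneg (Icc_subset_Icc_left (by norm_num)) (fun k _ _ => by positivity)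
  refine le_trans ?_ hfin
  exact_mod_cast hQA.trans hsum

end EN
end GK

namespace GK
section MD
open Finset

lemma dist_sq (p q : ℍ) : 2 * p.im * q.im * (Real.cosh (dist p q) - 1) = (p.re - q.re) ^ 2 + (p.im - q.im) ^ 2 := by
  rw [UpperHalfPlane.cosh_dist]
  have h1 := p.im_pos.ne'
  have h2 := q.im_pos.ne'
  rw [Complex.dist_eq, Complex.sq_norm, Complex.normSq_apply]
  simp
  field_simp

lemma dist_le_iff (p q q' : ℍ) : dist p q ≤ dist p q' ↔
    ((p.re - q.re) ^ 2 + (p.im - q.im) ^ 2) * q'.im ≤ ((p.re - q'.re) ^ 2 + (p.im - q'.im) ^ 2) * q.im := by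
  rw [← dist_sq, ← dist_sq]
  have h1 := p.im_pos
  have h2 := q.im_pos
  have h3 := q'.im_pos
  rw [show 2 * p.im * q.im * (Real.cosh (dist p q) - 1) * q'.im = (2 * p.im * q.im * q'.im) * (Real.cosh (dist p q) - 1) by ring,
    show 2 * p.im * q'.im * (Real.cosh (dist p q') - 1) * q.im = (2 * p.im * q.im * q'.im) * (Real.cosh (dist p q') - 1) by ring,
    mul_le_mul_iff_right₀ (by positivity), sub_le_sub_iff_right, Real.cosh_le_cosh, abs_of_nonneg dist_nonneg, abs_of_nonneg dist_nonneg]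

lemma smul_im (γ : SL(2, ℤ)) (q : ℍ) :
    (γ • q).im * ((γ 1 0 * q.re + γ 1 1) ^ 2 + (γ 1 0 * q.im) ^ 2) = q.im := by
  have h := ModularGroup.im_smul_eq_div_normSq γ q
  have h0 := UpperHalfPlane.normSq_denom_ne_zero (γ : GL (Fin 2) ℝ) q.im_pos.ne'
  rw [eq_div_iff h0] at h
  refine Eq.trans ?_ h
  congr 1
  simp [UpperHalfPlane.denom, Complex.normSq_apply]
  ring

lemma smul_abs (γ : SL(2, ℤ)) (q : ℍ) : ((γ • q).re ^ 2 + (γ • q).im ^ 2) * ((γ 1 0 * q.re + γ 1 1) ^ 2 + (γ 1 0 * q.im) ^ 2) =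
    (γ 0 0 * q.re + γ 0 1) ^ 2 + (γ 0 0 * q.im) ^ 2 := by
  have h := UpperHalfPlane.specialLinearGroup_apply γ q
  have h0 := UpperHalfPlane.denom_ne_zero (γ : GL (Fin 2) ℝ) q
  have h1 : ((γ 1 0 : ℂ) * q + γ 1 1) ≠ 0 := by simpa [UpperHalfPlane.denom] using h0
  have h2 : ((γ • q : ℍ) : ℂ) * ((γ 1 0 : ℂ) * q + γ 1 1) = (γ 0 0 : ℂ) * q + γ 0 1 := by
    rw [h]
    simpa using div_mul_cancel₀ _ h1
  have h3 := congrArg Complex.normSq h2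
  rw [Complex.normSq_mul] at h3
  generalize γ • q = w at h3 ⊢
  simp [Complex.normSq_apply] at h3
  linear_combination h3

def G0 : Set SL(2, ℤ) := {γ | ∀ i j, |γ i j| ≤ 2}

lemma G0_fin : G0.Finite := by
  have : (Set.pi Set.univ fun _ : Fin 2 => Set.pi Set.univ fun _ : Fin 2 => Set.Icc (-2 : ℤ) 2).Finite :=
    Set.Finite.pi fun _ => Set.Finite.pi fun _ => Set.finite_Icc _ _
  refine (this.preimage (f := fun γ : SL(2, ℤ) => (fun i j => γ i j : Fin 2 → Fin 2 → ℤ)) ?_).subset ?_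
  · intro γ _ γ' _ h
    ext i j
    exact congrFun (congrFun h i) j
  · intro γ h i _ j _
    exact abs_le.1 (h i j)

lemma G0_one : 1 ∈ G0 := by
  intro i j; fin_cases i <;> fin_cases j <;> simp

lemma G0_inv {γ : SL(2, ℤ)} (h : γ ∈ G0) : γ⁻¹ ∈ G0 := by
  intro i j
  rw [Matrix.SpecialLinearGroup.SL2_inv_expl]
  fin_cases i <;> fin_cases j <;> simp <;> apply h

lemma int_sq {a b : ℤ} {u V : ℝ} (hu : |u| ≤ 1 / 2) (hV : 1 ≤ u ^ 2 + V ^ 2) :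
    3 / 4 * (a : ℝ) ^ 2 ≤ (a * u + b) ^ 2 + (a * V) ^ 2 ∧ 3 / 4 * (b : ℝ) ^ 2 ≤ (a * u + b) ^ 2 + (a * V) ^ 2 := by
  have h1 := abs_le.1 hu
  have hab : |(a:ℝ) * b * (2 * u)| ≤ |(a:ℝ)| * |(b:ℝ)| := by
    rw [abs_mul, abs_mul]
    have : |2 * u| ≤ 1 := by rw [abs_mul, abs_two]; linarith
    exact mul_le_of_le_one_right (by positivity) this
  have h2 := (abs_le.1 hab).1
  have h3 : (a:ℝ) ^ 2 * 1 ≤ (a:ℝ) ^ 2 * (u ^ 2 + V ^ 2) := mul_le_mul_of_nonneg_left hV (sq_nonneg _)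
  have ha := sq_abs (a:ℝ)
  have hb := sq_abs (b:ℝ)
  constructor
  · nlinarith [sq_nonneg (|(a:ℝ)| / 2 - |(b:ℝ)|)]
  · nlinarith [sq_nonneg (|(a:ℝ)| - |(b:ℝ)| / 2)]

lemma int_le {a : ℤ} (h : 3 / 4 * (a : ℝ) ^ 2 ≤ 4) : |a| ≤ 2 := by
  have : (a:ℝ) ^ 2 < 9 := by linarith
  have : a ^ 2 < 9 := by exact_mod_cast this
  rw [abs_le]; constructor <;> nlinarith

lemma fd_facts {q : ℍ} (h : q ∈ ModularGroup.fd) : |q.re| ≤ 1 / 2 ∧ 1 ≤ q.re ^ 2 + q.im ^ 2 := by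
  refine ⟨h.2, ?_⟩
  have := h.1
  rw [Complex.normSq_apply] at this
  simp at this
  nlinarith

lemma r_le {x x' u y v V r : ℝ} (hv : 0 < v) (hw : 0 < V) (e1 : V * r = v) (hpq : v ≤ y) (hv2 : 3 / 4 ≤ v ^ 2)
    (hxu : (x - u) ^ 2 ≤ 1) (hlt : ((x - x') ^ 2 + (y - V) ^ 2) * v ≤ ((x - u) ^ 2 + (y - v) ^ 2) * V) : r ≤ 3 := by
  have k2 : (y - V) ^ 2 * r ≤ 1 + (y - v) ^ 2 := by
    have : ((y - V) ^ 2 * r) * V ≤ (1 + (y - v) ^ 2) * V := by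
      have : ((y - V) ^ 2 * r) * V = (y - V) ^ 2 * v := by rw [← e1]; ring
      rw [this]
      have a1 := mul_nonneg (sq_nonneg (x - x')) hv.le
      have a2 := mul_le_mul_of_nonneg_right hxu hw.le
      linarith
    exact le_of_mul_le_mul_right this hw
  by_contra hcon
  push Not at hcon
  have k3 : (r - 1) * y ^ 2 ≤ 1 + V * (r - 1) * v := by
    rw [← e1] at k2 ⊢; linarith
  have hyv : v ^ 2 ≤ y ^ 2 := pow_le_pow_left₀ hv.le hpq 2
  have k4 : (r - 1) * v ^ 2 ≤ 1 + V * (r - 1) * v :=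
    le_trans (mul_le_mul_of_nonneg_left hyv (by linarith)) k3
  have k5 : V ^ 2 * (r * (r - 1) ^ 2) ≤ 1 := by
    rw [← e1] at k4; linarith
  have k6 : v ^ 2 * (r - 1) ^ 2 ≤ r := by
    have := mul_le_mul_of_nonneg_right k5 (by linarith : 0 ≤ r)
    rw [← e1]; linarith
  have k7 := mul_le_mul_of_nonneg_right hv2 (sq_nonneg (r - 1))
  nlinarith only [k6, k7, hcon]

lemma reduce_aux {p q : ℍ} (hp : p ∈ ModularGroup.fd) (hq : q ∈ ModularGroup.fd) (hpq : q.im ≤ p.im) (γ : SL(2, ℤ)) :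
    ∃ γ' ∈ G0, dist p (γ' • q) ≤ dist p (γ • q) := by
  by_cases hle : dist p q ≤ dist p (γ • q)
  · exact ⟨1, G0_one, by simpa using hle⟩
  push Not at hle
  obtain ⟨n, hn1, hn2⟩ : ∃ n : ℤ, |p.re - (γ • q).re - n| ≤ 1 / 2 ∧ |p.re - (γ • q).re - n| ≤ |p.re - (γ • q).re| :=
    ⟨round (p.re - (γ • q).re), abs_sub_round _, by simpa using round_le (p.re - (γ • q).re) 0⟩
  set γ' : SL(2, ℤ) := ModularGroup.T ^ n * γ with hγ'
  have hre : (γ' • q).re = (γ • q).re + n := by rw [hγ', mul_smul, ModularGroup.re_T_zpow_smul]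
  have him : (γ' • q).im = (γ • q).im := by rw [hγ', mul_smul, ModularGroup.im_T_zpow_smul]
  have hd : dist p (γ' • q) ≤ dist p (γ • q) := by
    rw [dist_le_iff, him, hre]
    have := sq_le_sq.2 hn2
    refine mul_le_mul_of_nonneg_right ?_ (γ • q).im_pos.le
    have e : p.re - ((γ • q).re + n) = p.re - (γ • q).re - n := by ring
    rw [e]; linarith
  refine ⟨γ', ?_, hd⟩
  have hlt := (hd.trans hle.le)
  rw [dist_le_iff] at hlt
  have hx : |p.re - (γ' • q).re| ≤ 1 / 2 := by
    rw [hre]; convert hn1 using 2; ring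
  clear_value γ'
  clear hre him hd hle hn1 hn2 hγ'
  obtain ⟨f1, f2⟩ := fd_facts hp
  obtain ⟨f3, f4⟩ := fd_facts hq
  have e1 := smul_im γ' q
  have e2 := smul_abs γ' q
  have hdet := Matrix.det_fin_two γ'.1
  rw [γ'.2] at hdet
  have i1 := int_sq (a := γ' 1 0) (b := γ' 1 1) f3 f4
  have i2 := int_sq (a := γ' 0 0) (b := γ' 0 1) f3 f4
  rw [← e2] at i2
  have hw := (γ' • q).im_pos
  have hy := p.im_pos
  have hv := q.im_pos
  set w := γ' • q with hwd
  clear_value w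
  obtain ⟨r, hr⟩ : ∃ r : ℝ, r = (γ' 1 0 * q.re + γ' 1 1) ^ 2 + (γ' 1 0 * q.im) ^ 2 := ⟨_, rfl⟩
  rw [← hr] at e1 i1 i2 e2
  have g1 := abs_le.1 f1
  have g3 := abs_le.1 f3
  have gx := abs_le.1 hx
  have hv2 : 3 / 4 ≤ q.im ^ 2 := by nlinarith only [f4, g3.1, g3.2]
  have hwre : w.re ^ 2 ≤ 1 := by nlinarith only [g1.1, g1.2, gx.1, gx.2]
  have hrpos : 0 < r := by
    exact pos_of_mul_pos_right (e1.symm ▸ hv) hw.le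
  have hr3 : r ≤ 3 := by
    have hxu : (p.re - q.re) ^ 2 ≤ 1 := by nlinarith only [g1.1, g1.2, g3.1, g3.2]
    exact r_le hv hw e1 hpq hv2 hxu hlt
  have hc : |γ' 1 0| ≤ 2 := int_le (by linarith [i1.1])
  have hd' : |γ' 1 1| ≤ 2 := int_le (by linarith [i1.2])
  have hab : |γ' 0 0| ≤ 2 ∧ |γ' 0 1| ≤ 2 := by
    by_cases c0 : γ' 1 0 = 0
    · have hdet' : γ' 0 0 * γ' 1 1 = 1 := by
        have : (1:ℤ) = γ' 0 0 * γ' 1 1 - γ' 0 1 * γ' 1 0 := hdet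
        rw [c0] at this; linarith
      have hr1 : r = 1 := by
        rw [hr, c0]
        rcases Int.eq_one_or_neg_one_of_mul_eq_one' hdet' with h | h <;> simp [h.2]
      have ha1 : (γ' 0 0 : ℝ) ^ 2 = 1 := by
        rcases Int.eq_one_or_neg_one_of_mul_eq_one' hdet' with h | h <;> simp [h.1]
      rw [hr1] at e1 e2
      have : (γ' 0 0 * q.re + γ' 0 1) ^ 2 ≤ 1 := by rw [mul_one] at e1; rw [e1, mul_pow, ha1] at e2; linarith
      have hau : (γ' 0 0 * q.re) ^ 2 ≤ 1 / 4 := by rw [mul_pow, ha1]; nlinarith only [g3.1, g3.2]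
      refine ⟨?_, int_le ?_⟩
      · rcases Int.eq_one_or_neg_one_of_mul_eq_one' hdet' with h | h <;> simp [h.1]
      · nlinarith only [this, hau, sq_nonneg (2 * (γ' 0 0 * q.re) + (γ' 0 0 * q.re + γ' 0 1))]
    · have c1 : (1:ℝ) ≤ (γ' 1 0 : ℝ) ^ 2 := by
        have : (1:ℤ) ≤ (γ' 1 0) ^ 2 := by
          have := sq_pos_of_ne_zero c0
          omega
        exact_mod_cast this
      have hrv : q.im ^ 2 ≤ r := by
        rw [hr, mul_pow]; nlinarith only [c1, sq_nonneg (γ' 1 0 * q.re + γ' 1 1 : ℝ), sq_nonneg q.im, mul_le_mul_of_nonneg_right c1 (sq_nonneg q.im)]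
      have hwr : w.im ^ 2 * r ≤ 1 := by
        rw [← e1] at hrv
        have : (w.im ^ 2 * r) * r ≤ 1 * r := by linarith
        exact le_of_mul_le_mul_right this hrpos
      have : (w.re ^ 2 + w.im ^ 2) * r ≤ 4 := by nlinarith only [hwre, hwr, hr3, hrpos]
      exact ⟨int_le (i2.1.trans this), int_le (i2.2.trans this)⟩
  intro i j
  fin_cases i <;> fin_cases j
  · exact hab.1
  · exact hab.2
  · exact hc
  · exact hd'

lemma dist_sl (γ : SL(2, ℤ)) (p q : ℍ) : dist (γ • p) (γ • q) = dist p q :=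
  dist_smul (γ : SL(2, ℝ)) p q

lemma dist_inv (p q : ℍ) (γ : SL(2, ℤ)) : dist p (γ • q) = dist q (γ⁻¹ • p) := by
  rw [dist_comm q, ← dist_sl γ (γ⁻¹ • p) q, smul_inv_smul]

lemma reduce {p q : ℍ} (hp : p ∈ ModularGroup.fd) (hq : q ∈ ModularGroup.fd) (γ : SL(2, ℤ)) :
    ∃ γ' ∈ G0, dist p (γ' • q) ≤ dist p (γ • q) := by
  rcases le_total q.im p.im with h | h
  · exact reduce_aux hp hq h γ
  · obtain ⟨g, hg, hle⟩ := reduce_aux hq hp h γ⁻¹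
    refine ⟨g⁻¹, G0_inv hg, ?_⟩
    rw [dist_inv, inv_inv, dist_inv p q γ]
    exact hle

lemma bdd (p q : ℍ) : BddBelow (Set.range fun γ : SL(2, ℤ) => dist p (γ • q)) :=
  ⟨0, by rintro _ ⟨γ, rfl⟩; exact dist_nonneg⟩

lemma attained {p q : ℍ} (hp : p ∈ ModularGroup.fd) (hq : q ∈ ModularGroup.fd) :
    ∃ γ ∈ G0, modularDist p q = dist p (γ • q) := by
  obtain ⟨γ, hγ, hmin⟩ := Set.exists_min_image G0 (fun γ => dist p (γ • q)) G0_fin ⟨1, G0_one⟩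
  refine ⟨γ, hγ, le_antisymm (ciInf_le (bdd p q) γ) (le_ciInf fun δ => ?_)⟩
  obtain ⟨δ', h1, h2⟩ := reduce hp hq δ
  exact (hmin δ' h1).trans h2

lemma md_smul (p q : ℍ) (g h : SL(2, ℤ)) : modularDist (g • p) (h • q) = modularDist p q := by
  unfold modularDist
  refine Equiv.iInf_congr ((Equiv.mulLeft g⁻¹).trans (Equiv.mulRight h)) fun γ => ?_
  simp only [Equiv.trans_apply, Equiv.coe_mulLeft, Equiv.coe_mulRight]
  rw [mul_smul, mul_smul, ← dist_sl g p, smul_inv_smul]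

lemma md_orbit {p q : ℍ} (g h : SL(2, ℤ)) (he : g • p = h • q) : modularDist p q = 0 := by
  rw [← md_smul p q g h, he]
  refine le_antisymm ?_ (Real.iInf_nonneg fun _ => dist_nonneg)
  refine (ciInf_le (bdd (h • q) (h • q)) 1).trans ?_
  rw [one_smul, dist_self]

end MD
end GK

namespace GK
section FT
open Finset

set_option maxHeartbeats 1000000 in
open Classical in
lemma main_count (P : Finset ℍ) (hN : 2 ≤ #P) (hP : ∀ p ∈ P, ∀ q ∈ P, p ≠ q → modularDist p q ≠ 0) :
    ((#P : ℝ) * (#P - 1)) ^ 2 ≤ (#(P.offDiag.image fun x => modularDist x.1 x.2) : ℝ) *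
      (12 * 10 ^ 8 * (#G0_fin.toFinset * #P : ℝ) ^ 3 * (1 + Real.log (#G0_fin.toFinset * #P))) := by
  choose h hh using ModularGroup.exists_smul_mem_fd
  let f : ℍ → ℍ := fun p => h p • p
  have hf : ∀ p, f p ∈ ModularGroup.fd := hh
  choose G hG0 hG using fun p q => attained (hf p) (hf q)
  have hmd : ∀ p q, modularDist p q = dist (f p) (G p q • f q) := fun p q => by
    rw [← hG]; exact (md_smul p q (h p) (h q)).symm
  let Γ := G0_fin.toFinset
  have hΓ1 : 1 ∈ Γ := G0_fin.mem_toFinset.2 G0_one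
  let P' : Finset ℍ := (Γ ×ˢ P).image fun x => x.1 • f x.2
  have hP'c : #P' ≤ #Γ * #P := card_image_le.trans (card_product _ _).le
  have hP'1 : ∀ p ∈ P, f p ∈ P' := fun p hp => mem_image.2 ⟨(1, p), mem_product.2 ⟨hΓ1, hp⟩, one_smul _ _⟩
  have hP'2 : ∀ p, ∀ q ∈ P, G p q • f q ∈ P' := fun p q hq =>
    mem_image.2 ⟨(G p q, q), mem_product.2 ⟨G0_fin.mem_toFinset.2 (hG0 p q), hq⟩, rfl⟩
  have hinj : ∀ p ∈ P, ∀ q ∈ P, ∀ g g' : SL(2, ℤ), g • f p = g' • f q → p = q := by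
    intro p hp q hq g g' he
    by_contra hne
    refine hP p hp q hq hne (md_orbit (g * h p) (g' * h q) ?_)
    rw [mul_smul, mul_smul]; exact he
  let m : ℍ × ℍ → ℝ := fun x => modularDist x.1 x.2
  let O := P.offDiag
  let D := O.image m
  let E : Finset ((ℍ × ℍ) × (ℍ × ℍ)) := {q ∈ (P' ×ˢ P') ×ˢ (P' ×ˢ P') | q.1.1 ≠ q.2.1 ∧ dist q.1.1 q.2.1 = dist q.1.2 q.2.2}
  have hE : (#E : ℝ) ≤ 12 * 10 ^ 8 * (#P' : ℝ) ^ 3 * (1 + Real.log #P') := energy P'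
  have hOE : ∑ t ∈ D, #{x ∈ O | m x = t} ^ 2 ≤ #E := by
    have e : ∑ t ∈ D, #{x ∈ O | m x = t} ^ 2 = #(D.sigma fun t => ({x ∈ O | m x = t} : Finset _) ×ˢ ({x ∈ O | m x = t} : Finset _)) := by
      rw [card_sigma]
      exact sum_congr rfl fun t _ => by rw [card_product, sq]
    rw [e]
    refine card_le_card_of_injOn (fun z => ((f z.2.1.1, f z.2.2.1), (G z.2.1.1 z.2.1.2 • f z.2.1.2, G z.2.2.1 z.2.2.2 • f z.2.2.2))) ?_ ?_
    · rintro ⟨t, ⟨p, q⟩, ⟨p', q'⟩⟩ hz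
      have hz := (mem_sigma.1 hz).2
      obtain ⟨a1, a2⟩ := mem_product.1 hz
      obtain ⟨b1, b2⟩ := mem_filter.1 a1
      obtain ⟨c1, c2⟩ := mem_filter.1 a2
      obtain ⟨u1, u2, u3⟩ := mem_offDiag.1 b1
      obtain ⟨v1, v2, v3⟩ := mem_offDiag.1 c1
      dsimp only at u1 u2 u3 v1 v2 v3 b2 c2
      refine mem_filter.2 ⟨mem_product.2 ⟨mem_product.2 ⟨hP'1 _ u1, hP'1 _ v1⟩, mem_product.2 ⟨hP'2 _ _ u2, hP'2 _ _ v2⟩⟩, ?_, ?_⟩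
      · intro h0
        apply hP p u1 q u2 u3
        rw [hmd, dist_eq_zero]; exact h0
      · show dist (f p) (G p q • f q) = dist (f p') (G p' q' • f q')
        rw [← hmd, ← hmd]
        exact b2.trans c2.symm
    · rintro ⟨t, ⟨p, q⟩, ⟨p', q'⟩⟩ hz ⟨t2, ⟨p2, q2⟩, ⟨p2', q2'⟩⟩ hz2 he
      have hz := (mem_sigma.1 hz).2
      obtain ⟨a1, a2⟩ := mem_product.1 hz
      obtain ⟨b1, b2⟩ := mem_filter.1 a1
      obtain ⟨c1, c2⟩ := mem_filter.1 a2
      obtain ⟨u1, u2, u3⟩ := mem_offDiag.1 b1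
      obtain ⟨v1, v2, v3⟩ := mem_offDiag.1 c1
      have hz2 := (mem_sigma.1 hz2).2
      obtain ⟨a1', a2'⟩ := mem_product.1 hz2
      obtain ⟨b1', b2'⟩ := mem_filter.1 a1'
      obtain ⟨c1', c2'⟩ := mem_filter.1 a2'
      obtain ⟨u1', u2', u3'⟩ := mem_offDiag.1 b1'
      obtain ⟨v1', v2', v3'⟩ := mem_offDiag.1 c1'
      simp only [Prod.mk.injEq] at he
      obtain ⟨⟨e1, e2⟩, e3, e4⟩ := he
      dsimp only at u1 u2 u3 v1 v2 v3 b2 c2 u1' u2' u3' v1' v2' v3' b2' c2'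
      have d1 : p = p2 := hinj p u1 p2 u1' 1 1 (by rw [one_smul, one_smul]; exact e1)
      have d2 : p' = p2' := hinj p' v1 p2' v1' 1 1 (by rw [one_smul, one_smul]; exact e2)
      have d3 : q = q2 := hinj q u2 q2 u2' _ _ e3
      have d4 : q' = q2' := hinj q' v2 q2' v2' _ _ e4
      subst d1 d2 d3 d4
      have : t = t2 := b2.symm.trans b2'
      subst this
      rfl
  have hO : #O = ∑ t ∈ D, #{x ∈ O | m x = t} := card_eq_sum_card_image m O
  have hCS : #O ^ 2 ≤ #D * #E := by
    rw [hO]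
    exact (sq_sum_le_card_mul_sum_sq).trans (Nat.mul_le_mul_left _ hOE)
  have hOc : (#O : ℝ) = (#P : ℝ) * (#P - 1) := by
    have : #O = #P * #P - #P := offDiag_card P
    rw [this, Nat.cast_sub (Nat.le_mul_self _)]; push_cast; ring
  rw [← hOc]
  have hCS' : (#O : ℝ) ^ 2 ≤ #D * #E := by exact_mod_cast hCS
  refine hCS'.trans (mul_le_mul_of_nonneg_left (hE.trans ?_) (Nat.cast_nonneg _))
  have hp1 : 1 ≤ #P' := by
    obtain ⟨p, hp⟩ := card_pos.1 (by omega : 0 < #P)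
    exact card_pos.2 ⟨_, hP'1 p hp⟩
  have hp1' : (1:ℝ) ≤ #P' := by exact_mod_cast hp1
  have hle : (#P' : ℝ) ≤ #Γ * #P := by exact_mod_cast hP'c
  have hlog := Real.log_le_log (by linarith) hle
  have hlog0 := Real.log_nonneg hp1'
  have h3 := pow_le_pow_left₀ (by linarith) hle 3
  exact mul_le_mul (mul_le_mul_of_nonneg_left h3 (by norm_num)) (by linarith) (by linarith) (by positivity)

end FT
end GK

/-- There is an absolute constant `c > 0` such that any `N ≥ 2` points in the hyperbolic
plane projecting to distinct points of the modular surface determine at least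
`c · N / log N` distinct modular-surface distances. -/
theorem distinct_distances_modular_surface :
    ∃ c : ℝ, 0 < c ∧ ∀ P : Finset ℍ, 2 ≤ P.card →
      (∀ p ∈ P, ∀ q ∈ P, p ≠ q → modularDist p q ≠ 0) →
      c * (P.card : ℝ) / Real.log P.card ≤
        ({t : ℝ | ∃ p ∈ P, ∃ q ∈ P, p ≠ q ∧ modularDist p q = t}.ncard : ℝ) := by
  classical
  obtain ⟨K, hK⟩ : ∃ K : ℝ, K = (GK.G0_fin.toFinset.card : ℝ) := ⟨_, rfl⟩
  have hK1 : 1 ≤ K := by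
    rw [hK]
    have : 0 < GK.G0_fin.toFinset.card := Finset.card_pos.2 ⟨1, GK.G0_fin.mem_toFinset.2 GK.G0_one⟩
    exact_mod_cast this
  have hlK := Real.log_nonneg hK1
  set C := 4 * (12 * 10 ^ 8 * K ^ 3 * (3 + 2 * Real.log K)) with hC
  have hC0 : 0 < C := by positivity
  refine ⟨1 / C, by positivity, fun P hN hP => ?_⟩
  have hset : {t : ℝ | ∃ p ∈ P, ∃ q ∈ P, p ≠ q ∧ modularDist p q = t} =
      (P.offDiag.image fun x => modularDist x.1 x.2 : Finset ℝ) := by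
    ext t
    simp only [Set.mem_setOf_eq, Finset.coe_image, Set.mem_image, Finset.mem_coe, Finset.mem_offDiag, Prod.exists]
    constructor
    · rintro ⟨p, hp, q, hq, hne, rfl⟩
      exact ⟨p, q, ⟨hp, hq, hne⟩, rfl⟩
    · rintro ⟨p, q, ⟨hp, hq, hne⟩, rfl⟩
      exact ⟨p, hp, q, hq, hne, rfl⟩
  rw [hset, Set.ncard_coe_finset]
  have hm := GK.main_count P hN hP
  rw [← hK] at hm
  set D : ℝ := ((P.offDiag.image fun x => modularDist x.1 x.2).card : ℝ) with hD
  have hD0 : 0 ≤ D := Nat.cast_nonneg _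
  clear_value D
  clear hset
  have hn2 : (2:ℝ) ≤ (P.card : ℝ) := by exact_mod_cast hN
  set n : ℝ := (P.card : ℝ) with hn
  clear_value n
  have hn0 : 0 < n := by linarith
  have hlog : 1 / 2 ≤ Real.log n := by
    have h1 := Real.log_le_log (by norm_num) hn2
    have := Real.log_two_gt_d9
    linarith
  rw [div_mul_eq_mul_div, one_mul, div_div, div_le_iff₀ (by positivity)]
  rw [Real.log_mul (by linarith) (by linarith)] at hm
  have hb : 1 + (Real.log K + Real.log n) ≤ (3 + 2 * Real.log K) * Real.log n := by nlinarith
  have h1 : n ^ 4 ≤ 4 * (n * (n - 1)) ^ 2 := by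
    have : n ^ 2 ≤ (2 * (n - 1)) ^ 2 := pow_le_pow_left₀ hn0.le (by linarith) 2
    nlinarith [mul_le_mul_of_nonneg_left this (sq_nonneg n)]
  have h2 : D * (12 * 10 ^ 8 * (K * n) ^ 3 * (1 + (Real.log K + Real.log n))) ≤
      D * (12 * 10 ^ 8 * (K * n) ^ 3 * ((3 + 2 * Real.log K) * Real.log n)) := by
    gcongr
  have h3 : n * n ^ 3 ≤ D * (C * Real.log n) * n ^ 3 := by
    rw [hC]
    calc n * n ^ 3 = n ^ 4 := by ring
      _ ≤ 4 * (D * (12 * 10 ^ 8 * (K * n) ^ 3 * ((3 + 2 * Real.log K) * Real.log n))) := by linarith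
      _ = _ := by ring
  exact le_of_mul_le_mul_right h3 (by positivity)

end
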